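/- Let d ≥ 2. Suppose Ω : ℝ^d \ {0} → ℝ is homogeneous of degree zero, ‖Ω‖_{L log⁺L(S^{d−1})} < ∞, and Ω satisfies the first-order moment conditions ∫_{S^{d−1}} Ω(θ) θ^α dθ = 0 for every multi-index α ∈ ℤ₊^d with |α| = 1. Let A : ℝ^d → ℝ be Lipschitz with Lipschitz constant ‖∇A‖_∞. Let the Calderón commutator T_{Ω,A} be given for f ∈ C_c^∞(ℝ^d) by T_{Ω,A} f(x) = p.v. ∫_{ℝ^d} (Ω(x−y)/|x−y|^d) · ((A(x)−A(y))/|x−y|) · f(y) dy, assumed to exist a.e. for such f. Then there is a constant C depending only on d such that for all λ > 0 and f ∈ C_c^∞(ℝ^d), m({x ∈ ℝ^d : |T_{Ω,A} f(x)| > λ}) ≤ C λ^{−1} 𝒞_Ω ‖∇A‖_∞ ‖f‖_{L¹}. -/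

import Mathlib

open MeasureTheory Metric Filter Topology ENNReal

noncomputable section

/-- The surface measure on the unit sphere `S^{d-1}` of `ℝ^d`. -/
def sphereMeasure (d : ℕ) :
    Measure (sphere (0 : EuclideanSpace ℝ (Fin d)) 1) :=
  (volume : Measure (EuclideanSpace ℝ (Fin d))).toSphere

/-- `‖Ω‖_{L¹(S^{d-1})}`. -/
def sphL1 (d : ℕ) (Ω : EuclideanSpace ℝ (Fin d) → ℝ) : ℝ :=
  ∫ θ : sphere (0 : EuclideanSpace ℝ (Fin d)) 1, |Ω θ| ∂(sphereMeasure d)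

/-- `‖Ω‖_{L log⁺ L(S^{d-1})} = ∫ |Ω| log(2+|Ω|)`. -/
def sphLlogL (d : ℕ) (Ω : EuclideanSpace ℝ (Fin d) → ℝ) : ℝ :=
  ∫ θ : sphere (0 : EuclideanSpace ℝ (Fin d)) 1,
    |Ω θ| * Real.log (2 + |Ω θ|) ∂(sphereMeasure d)

/-- The constant `𝒞_Ω`. -/
def COmega (d : ℕ) (Ω : EuclideanSpace ℝ (Fin d) → ℝ) : ℝ :=
  sphLlogL d Ω +
    ∫ θ : sphere (0 : EuclideanSpace ℝ (Fin d)) 1,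
      |Ω θ| * (1 + max (Real.log (|Ω θ| / sphL1 d Ω)) 0) ∂(sphereMeasure d)

set_option linter.unusedSectionVars false

section Superposition

open scoped FourierTransform RealInnerProductSpace

variable {E : Type*} [NormedAddCommGroup E] [InnerProductSpace ℝ E] [FiniteDimensional ℝ E]
  [MeasurableSpace E] [BorelSpace E]

/-- The `L²` norm of an integrable function equals that of its Fourier integral. -/
theorem eLpNorm_fourier_eq_of_integrable {f : E → ℂ} (h1 : Integrable f) (h2 : MemLp f 2) :
    eLpNorm (𝓕 f) 2 volume = eLpNorm f 2 volume := by
  set g : Lp ℂ 2 (volume : Measure E) := 𝓕 h2.toLp with hg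
  have hloc : LocallyIntegrable (fun x => g x) (volume : Measure E) :=
    (Lp.memLp g).locallyIntegrable (by norm_num)
  have hcont : Continuous (𝓕 f) :=
    VectorFourier.fourierIntegral_continuous Real.continuous_fourierChar
      (by exact continuous_inner) h1
  have hae : 𝓕 f =ᵐ[volume] g := by
    refine ae_eq_of_integral_contDiff_smul_eq hcont.locallyIntegrable hloc ?_
    intro φ hφ hφc
    have hφ' : ContDiff ℝ (⊤ : ℕ∞) (Complex.ofRealCLM ∘ φ) := Complex.ofRealCLM.contDiff.comp hφ
    have hc' : HasCompactSupport (Complex.ofRealCLM ∘ φ) := hφc.comp_left rfl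
    set Φ : SchwartzMap E ℂ := hc'.toSchwartzMap hφ' with hΦ
    have hΦφ : ∀ x, Φ x = (φ x : ℂ) := fun x => rfl
    have e1 : ∫ x, Φ x • g x = ∫ x, (𝓕 Φ) x • f x := by
      have h := congrArg (fun T : TemperedDistribution E ℂ => T Φ)
        (Lp.fourier_toTemperedDistribution_eq (h2.toLp))
      simp only [TemperedDistribution.fourier_apply, Lp.toTemperedDistribution_apply] at h
      rw [← hg] at h
      rw [← h]
      refine integral_congr_ae ?_
      filter_upwards [h2.coeFn_toLp] with x hx
      rw [hx]
    have e2 : ∫ x, (𝓕 Φ) x • f x = ∫ x, Φ x • (𝓕 f) x := by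
      have := VectorFourier.integral_fourierIntegral_smul_eq_flip (L := innerₗ E)
        (μ := volume) (ν := volume) Real.continuous_fourierChar continuous_inner Φ.integrable h1
      rw [SchwartzMap.fourier_coe]
      simpa [Real.fourier_eq, VectorFourier.fourierIntegral, real_inner_comm] using this
    calc ∫ x, φ x • (𝓕 f) x = ∫ x, Φ x • (𝓕 f) x := by simp [hΦφ]
      _ = ∫ x, Φ x • g x := by rw [e1, e2]
      _ = ∫ x, φ x • g x := by simp [hΦφ]
  rw [eLpNorm_congr_ae hae]
  have h3 : ‖g‖ = ‖h2.toLp‖ := Lp.norm_fourier_eq _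
  rw [Lp.norm_def, Lp.norm_def, ENNReal.toReal_eq_toReal_iff' (Lp.eLpNorm_ne_top _)
    (Lp.eLpNorm_ne_top _)] at h3
  rw [h3, eLpNorm_congr_ae h2.coeFn_toLp]

theorem measurePreserving_shear {Y : Type*} [MeasurableSpace Y] {μ : Measure Y} [SFinite μ]
    {v : Y → E} (hv : Measurable v) :
    MeasurePreserving (fun p : Y × E => (p.1, p.2 - v p.1)) (μ.prod volume) (μ.prod volume) := by
  refine MeasurePreserving.skew_product (f := id) (g := fun y x => x - v y)
    (MeasurePreserving.id μ) (measurable_snd.sub (hv.comp measurable_fst)) ?_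
  exact Eventually.of_forall fun y => (measurePreserving_sub_right volume (v y)).map_eq

variable {Y : Type*} [MeasurableSpace Y] {μ : Measure Y} [SFinite μ] {v : Y → E}
  {Ψ : Y → E → ℂ}

theorem integrable_shear (hv : Measurable v)
    (hΨ : Integrable (fun p : Y × E => Ψ p.1 p.2) (μ.prod volume)) :
    Integrable (fun p : Y × E => Ψ p.1 (p.2 - v p.1)) (μ.prod volume) :=
  (measurePreserving_shear hv).integrable_comp_of_integrable hΨ

theorem integrable_superposition (hv : Measurable v)
    (hΨ : Integrable (fun p : Y × E => Ψ p.1 p.2) (μ.prod volume)) :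
    Integrable (fun x => ∫ y, Ψ y (x - v y) ∂μ) :=
  (integrable_shear hv hΨ).integral_prod_right

theorem integral_norm_superposition_le (hv : Measurable v)
    (hΨ : Integrable (fun p : Y × E => Ψ p.1 p.2) (μ.prod volume)) :
    ∫ x, ‖∫ y, Ψ y (x - v y) ∂μ‖ ≤ ∫ y, (∫ x, ‖Ψ y x‖) ∂μ := by
  have hs := integrable_shear hv hΨ
  calc ∫ x, ‖∫ y, Ψ y (x - v y) ∂μ‖ ≤ ∫ x, ∫ y, ‖Ψ y (x - v y)‖ ∂μ :=
        integral_mono (integrable_superposition hv hΨ).norm hs.norm.integral_prod_right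
          fun x => norm_integral_le_integral_norm _
    _ = ∫ y, (∫ x, ‖Ψ y (x - v y)‖) ∂μ := (integral_integral_swap hs.norm).symm
    _ = ∫ y, (∫ x, ‖Ψ y x‖) ∂μ := by
        congr 1 with y
        exact integral_sub_right_eq_self (fun x => ‖Ψ y x‖) (v y)

theorem fourier_superposition (hv : Measurable v)
    (hΨ : Integrable (fun p : Y × E => Ψ p.1 p.2) (μ.prod volume)) (ξ : E) :
    𝓕 (fun x => ∫ y, Ψ y (x - v y) ∂μ) ξ = ∫ y, 𝐞 (-⟪v y, ξ⟫) • 𝓕 (Ψ y) ξ ∂μ := by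
  have hs := integrable_shear hv hΨ
  have hc : Continuous fun x : E => 𝐞 (-⟪x, ξ⟫) :=
    Real.continuous_fourierChar.comp (by fun_prop)
  have hi : Integrable (fun p : Y × E => 𝐞 (-⟪p.2, ξ⟫) • Ψ p.1 (p.2 - v p.1)) (μ.prod volume) := by
    refine hs.mono ?_ (Eventually.of_forall fun p => by simp)
    have hc' : Continuous fun x : E => ((𝐞 (-⟪x, ξ⟫) : Circle) : ℂ) :=
      continuous_subtype_val.comp hc
    exact (hc'.measurable.comp measurable_snd).aestronglyMeasurable.smul hs.aestronglyMeasurable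
  simp only [Real.fourier_eq]
  calc ∫ x, 𝐞 (-⟪x, ξ⟫) • ∫ y, Ψ y (x - v y) ∂μ
      = ∫ x, ∫ y, 𝐞 (-⟪x, ξ⟫) • Ψ y (x - v y) ∂μ := by
        congr 1 with x
        simp only [Circle.smul_def]
        rw [integral_smul]
    _ = ∫ y, (∫ x, 𝐞 (-⟪x, ξ⟫) • Ψ y (x - v y)) ∂μ := (integral_integral_swap hi).symm
    _ = ∫ y, 𝐞 (-⟪v y, ξ⟫) • (∫ x, 𝐞 (-⟪x, ξ⟫) • Ψ y x) ∂μ := by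
        congr 1 with y
        rw [← integral_sub_right_eq_self (fun x => 𝐞 (-⟪x, ξ⟫) • Ψ y x) (v y)]
        simp only [Circle.smul_def]
        rw [← integral_smul]
        congr 1 with x
        rw [smul_smul, ← Circle.coe_mul, ← AddChar.map_add_eq_mul, inner_sub_left]
        congr 4
        ring

end Superposition

section Average

open scoped FourierTransform RealInnerProductSpace

variable {E : Type*} [NormedAddCommGroup E] [InnerProductSpace ℝ E] [FiniteDimensional ℝ E]
  [MeasurableSpace E] [BorelSpace E]
variable {Y : Type*} [MeasurableSpace Y] {μ : Measure Y} [SFinite μ] {v : Y → E}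
  {w : Y → ℂ} {f g : E → ℂ}

/-- The average of translates `∫ w(y) f(x - v(y)) dμ(y)`. -/
def translateAvg (μ : Measure Y) (w : Y → ℂ) (v : Y → E) (f : E → ℂ) (x : E) : ℂ :=
  ∫ y, w y * f (x - v y) ∂μ

theorem integrable_translateAvg (hv : Measurable v) (hw : Integrable w μ) (hf : Integrable f) :
    Integrable (translateAvg μ w v f) :=
  integrable_superposition hv (Ψ := fun y x => w y * f x) (hw.mul_prod hf)

theorem integral_norm_translateAvg_le (hv : Measurable v) (hw : Integrable w μ)
    (hf : Integrable f) :
    ∫ x, ‖translateAvg μ w v f x‖ ≤ (∫ y, ‖w y‖ ∂μ) * ∫ x, ‖f x‖ := by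
  refine (integral_norm_superposition_le hv (Ψ := fun y x => w y * f x)
    (hw.mul_prod hf)).trans_eq ?_
  simp only [norm_mul, integral_const_mul, integral_mul_const]

theorem fourier_translateAvg (hv : Measurable v) (hw : Integrable w μ) (hf : Integrable f)
    (ξ : E) :
    𝓕 (translateAvg μ w v f) ξ = (∫ y, 𝐞 (-⟪v y, ξ⟫) • w y ∂μ) * 𝓕 f ξ := by
  unfold translateAvg
  rw [fourier_superposition hv (Ψ := fun y x => w y * f x) (hw.mul_prod hf) ξ,
    ← integral_mul_const]
  congr 1 with y
  rw [smul_mul_assoc]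
  congr 1
  simp only [Real.fourier_eq]
  rw [← integral_const_mul]
  congr 1 with x
  rw [mul_smul_comm]

theorem translateAvg_comm {Y' : Type*} [MeasurableSpace Y'] {μ' : Measure Y'} [SFinite μ']
    {v' : Y' → E} {w' : Y' → ℂ} (hv : Measurable v) (hw : Integrable w μ)
    (hv' : Measurable v') (hw' : Integrable w' μ') (hf : Integrable f) :
    translateAvg μ w v (translateAvg μ' w' v' f) =ᵐ[volume]
      translateAvg μ' w' v' (translateAvg μ w v f) := by
  have h : Integrable (fun p : (Y × Y') × E =>
      (w p.1.1 * w' p.1.2) * f (p.2 - (v p.1.1 + v' p.1.2))) ((μ.prod μ').prod volume) :=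
    integrable_shear (Ψ := fun (y : Y × Y') x => (w y.1 * w' y.2) * f x)
      ((hv.comp measurable_fst).add (hv'.comp measurable_snd)) ((hw.mul_prod hw').mul_prod hf)
  filter_upwards [h.prod_left_ae] with x hx
  calc translateAvg μ w v (translateAvg μ' w' v' f) x
      = ∫ y, ∫ y', (w y * w' y') * f (x - (v y + v' y')) ∂μ' ∂μ := by
        simp only [translateAvg, ← integral_const_mul, mul_assoc, sub_sub]
    _ = ∫ y', ∫ y, (w y * w' y') * f (x - (v y + v' y')) ∂μ ∂μ' := integral_integral_swap hx
    _ = translateAvg μ' w' v' (translateAvg μ w v f) x := by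
        simp only [translateAvg, ← integral_const_mul]
        congr 1 with y'
        congr 1 with y
        rw [sub_sub, add_comm (v y)]
        ring

theorem translateAvg_add (hv : Measurable v) (hw : Integrable w μ)
    (hf : Integrable f) (hg : Integrable g) :
    translateAvg μ w v (fun x => f x + g x) =ᵐ[volume]
      fun x => translateAvg μ w v f x + translateAvg μ w v g x := by
  have e1 := (integrable_shear (Ψ := fun y x => w y * f x) hv (hw.mul_prod hf)).prod_left_ae
  have e2 := (integrable_shear (Ψ := fun y x => w y * g x) hv (hw.mul_prod hg)).prod_left_ae
  filter_upwards [e1, e2] with x h1 h2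
  simp only [translateAvg]
  rw [← integral_add h1 h2]
  congr 1 with y
  simp [mul_add]

end Average

section Profile

open scoped FourierTransform RealInnerProductSpace

variable {E : Type*} [NormedAddCommGroup E] [InnerProductSpace ℝ E]

/-- The truncated paraboloid `(1 - ‖u‖²)₊`. -/
def capProfile (u : E) : ℝ := max (1 - ‖u‖ ^ 2) 0

theorem capProfile_nonneg (u : E) : 0 ≤ capProfile u := le_max_right _ _

theorem capProfile_le_one (u : E) : capProfile u ≤ 1 :=
  max_le (by nlinarith [sq_nonneg ‖u‖]) zero_le_one

theorem capProfile_eq_zero {u : E} (hu : 1 ≤ ‖u‖) : capProfile u = 0 :=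
  max_eq_right (by nlinarith)

theorem continuous_capProfile : Continuous (capProfile : E → ℝ) := by
  unfold capProfile; fun_prop

theorem support_capProfile_subset : Function.support (capProfile : E → ℝ) ⊆ closedBall 0 1 := by
  intro u hu
  rw [mem_closedBall_zero_iff]
  by_contra h
  exact hu (capProfile_eq_zero (not_le.1 h).le)

theorem abs_capProfile_sub_le (u v : E) : |capProfile u - capProfile v| ≤ 2 * ‖u - v‖ := by
  have key : ∀ a b : E, capProfile a - capProfile b ≤ 2 * ‖a - b‖ := by
    intro a b
    have h1 := norm_sub_norm_le b a
    rw [norm_sub_rev] at h1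
    rcases le_total 1 ‖a‖ with ha | ha
    · rw [capProfile_eq_zero ha]
      linarith [capProfile_nonneg b, norm_nonneg (a - b)]
    · have : capProfile a = 1 - ‖a‖ ^ 2 := max_eq_left (by nlinarith [norm_nonneg a])
      rw [this]
      rcases le_total 1 ‖b‖ with hb | hb
      · rw [capProfile_eq_zero hb]; nlinarith [norm_nonneg a]
      · have hb' : 1 - ‖b‖ ^ 2 ≤ capProfile b := le_max_left _ _
        nlinarith [norm_nonneg a, norm_nonneg b, norm_nonneg (a - b)]
  rw [abs_le]
  constructor
  · have := key v u
    rw [norm_sub_rev] at this; linarith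
  · exact key u v

variable [FiniteDimensional ℝ E] [MeasurableSpace E] [BorelSpace E]

theorem hasCompactSupport_capProfile : HasCompactSupport (capProfile : E → ℝ) :=
  HasCompactSupport.of_support_subset_isCompact (isCompact_closedBall 0 1)
    support_capProfile_subset

theorem integrable_capProfile : Integrable (capProfile : E → ℝ) :=
  continuous_capProfile.integrable_of_hasCompactSupport hasCompactSupport_capProfile

variable (E) in
/-- The integral of `capProfile`. -/
def capMass : ℝ := ∫ u : E, capProfile u

theorem capMass_pos : 0 < capMass E := by
  refine continuous_capProfile.integral_pos_of_hasCompactSupport_nonneg_nonzero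
    hasCompactSupport_capProfile capProfile_nonneg (x := 0) ?_
  simp [capProfile]

theorem hasFDerivAt_capProfile_sq (u : E) :
    HasFDerivAt (fun u : E => ((capProfile u ^ 2 : ℝ) : ℂ))
      ((-4 * capProfile u) • (Complex.ofRealCLM ∘L innerSL ℝ u)) u := by
  have h1 : ∀ t : ℝ, HasDerivAt (fun t : ℝ => max t 0 ^ 2) (2 * max t 0) t := by
    intro t
    rcases lt_trichotomy t 0 with ht | rfl | ht
    · rw [max_eq_right ht.le, mul_zero]
      refine (hasDerivAt_const t (0 : ℝ)).congr_of_eventuallyEq ?_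
      filter_upwards [gt_mem_nhds ht] with s hs
      simp [max_eq_right (le_of_lt hs)]
    · rw [hasDerivAt_iff_isLittleO]
      simp only [max_self, mul_zero, smul_zero, sub_zero, ne_eq, OfNat.ofNat_ne_zero,
        not_false_eq_true, zero_pow]
      refine Asymptotics.IsBigO.trans_isLittleO (g := fun s : ℝ => s ^ 2) ?_ ?_
      · refine Asymptotics.IsBigO.of_bound 1 (Eventually.of_forall fun s => ?_)
        rcases le_total s 0 with h | h
        · simp [max_eq_right h]; positivity
        · simp [max_eq_left h]
      · simpa using Asymptotics.isLittleO_pow_id (𝕜 := ℝ) (n := 2) (by norm_num)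
    · rw [max_eq_left ht.le]
      have := hasDerivAt_pow 2 t
      simp only [Nat.cast_ofNat, Nat.add_one_sub_one, pow_one] at this
      refine this.congr_of_eventuallyEq ?_
      filter_upwards [lt_mem_nhds ht] with s hs
      simp [max_eq_left (le_of_lt hs)]
  have h2 : HasFDerivAt (fun u : E => 1 - ‖u‖ ^ 2) (-(2 • innerSL ℝ u)) u :=
    (hasStrictFDerivAt_norm_sq u).hasFDerivAt.const_sub 1
  have h3 := (h1 (1 - ‖u‖ ^ 2)).comp_hasFDerivAt u h2
  have h4 := Complex.ofRealCLM.hasFDerivAt.comp u h3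
  refine h4.congr_fderiv ?_
  ext w
  simp [capProfile]
  ring

theorem fourier_inner_mul_capProfile (w ζ : E) :
    𝓕 (fun u : E => ((⟪w, u⟫ * capProfile u : ℝ) : ℂ)) ζ =
      -(Real.pi * Complex.I / 2) * ⟪w, ζ⟫ * 𝓕 (fun u : E => ((capProfile u ^ 2 : ℝ) : ℂ)) ζ := by
  set Z : E → ℂ := fun u => ((capProfile u ^ 2 : ℝ) : ℂ) with hZ
  have hcomp : HasCompactSupport Z := by
    refine hasCompactSupport_capProfile.comp_left (g := fun t : ℝ => ((t ^ 2 : ℝ) : ℂ)) (by simp)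
  have hZi : Integrable Z := by
    refine Continuous.integrable_of_hasCompactSupport ?_ hcomp
    have := continuous_capProfile (E := E)
    fun_prop
  have hd : Differentiable ℝ Z := fun u => (hasFDerivAt_capProfile_sq u).differentiableAt
  have hfd : fderiv ℝ Z = fun u => (-4 * capProfile u) • (Complex.ofRealCLM ∘L innerSL ℝ u) :=
    funext fun u => (hasFDerivAt_capProfile_sq u).fderiv
  have hfi : Integrable (fderiv ℝ Z) := by
    refine Continuous.integrable_of_hasCompactSupport ?_ (hcomp.fderiv ℝ)
    rw [hfd]
    have := continuous_capProfile (E := E)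
    fun_prop
  have h := congrFun (Real.fourier_fderiv hZi hd hfi) ζ
  have h2 := congrArg (fun T : E →L[ℝ] ℂ => T w) h
  rw [Real.fourier_continuousLinearMap_apply hfi] at h2
  have e1 : (fun u => fderiv ℝ Z u w) =
      fun u => (-4 : ℂ) • ((⟪w, u⟫ * capProfile u : ℝ) : ℂ) := by
    rw [hfd]
    ext u
    simp [real_inner_comm]
    ring
  rw [e1] at h2
  have e2 : 𝓕 (fun u => (-4 : ℂ) • ((⟪w, u⟫ * capProfile u : ℝ) : ℂ)) ζ =
      (-4 : ℂ) • 𝓕 (fun u : E => ((⟪w, u⟫ * capProfile u : ℝ) : ℂ)) ζ := by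
    simp only [Real.fourier_eq]
    rw [← integral_smul]
    congr 1 with x
    rw [smul_comm]
  rw [e2] at h2
  have h3 : (innerSL ℝ ζ) w = ⟪w, ζ⟫ := real_inner_comm _ _
  simp only [VectorFourier.fourierSMulRight_apply, neg_apply, h3, smul_eq_mul] at h2
  simp only [neg_smul, ← Complex.real_smul] at h2 ⊢
  simp only [Complex.real_smul] at h2 ⊢
  linear_combination (-1/4 : ℂ) * h2

theorem one_sub_fourier_capProfile (ζ : E) (τ : ℝ) :
    ((capMass E : ℝ) : ℂ) - 𝓕 (fun u : E => (capProfile u : ℂ)) (τ • ζ) =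
      Real.pi ^ 2 * ‖ζ‖ ^ 2 *
        ∫ ρ in (0 : ℝ)..τ, ρ * 𝓕 (fun u : E => ((capProfile u ^ 2 : ℝ) : ℂ)) (ρ • ζ) := by
  set Z : E → ℂ := fun u => ((capProfile u ^ 2 : ℝ) : ℂ) with hZ
  have hcont := continuous_capProfile (E := E)
  have hcs : HasCompactSupport (fun u : E => (capProfile u : ℂ)) :=
    hasCompactSupport_capProfile.comp_left (g := fun t : ℝ => (t : ℂ)) (by simp)
  have hi : Integrable (fun u : E => (capProfile u : ℂ)) :=
    Continuous.integrable_of_hasCompactSupport (by fun_prop) hcs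
  have hi2 : Integrable (fun u : E => ‖u‖ * ‖(capProfile u : ℂ)‖) :=
    Continuous.integrable_of_hasCompactSupport (by fun_prop) (hcs.norm.mul_left)
  have hZc : Continuous (𝓕 Z) := by
    refine VectorFourier.fourierIntegral_continuous Real.continuous_fourierChar
      (by exact continuous_inner) ?_
    refine Continuous.integrable_of_hasCompactSupport (by fun_prop) ?_
    exact hasCompactSupport_capProfile.comp_left (g := fun t : ℝ => ((t ^ 2 : ℝ) : ℂ)) (by simp)
  have hder : ∀ ρ : ℝ, HasDerivAt (fun ρ : ℝ => 𝓕 (fun u : E => (capProfile u : ℂ)) (ρ • ζ))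
      (-(Real.pi ^ 2 * ‖ζ‖ ^ 2) * (ρ * 𝓕 Z (ρ • ζ))) ρ := by
    intro ρ
    have h1 := Real.hasFDerivAt_fourier hi hi2 (ρ • ζ)
    have h2 : HasDerivAt (fun ρ : ℝ => ρ • ζ) ζ ρ := by
      simpa using (hasDerivAt_id ρ).smul_const ζ
    have h3 := h1.comp_hasDerivAt ρ h2
    refine h3.congr_deriv ?_
    have hfi : Integrable (VectorFourier.fourierSMulRight (innerSL ℝ (E := E))
        (fun u : E => (capProfile u : ℂ))) := by
      refine Integrable.mono' (hi2.const_mul (2 * Real.pi * ‖innerSL ℝ (E := E)‖))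
        ?_ (Eventually.of_forall fun u => ?_)
      · exact hi.1.fourierSMulRight
      · exact (VectorFourier.norm_fourierSMulRight_le _ _ _).trans_eq (by ring)
    rw [Real.fourier_continuousLinearMap_apply hfi]
    have e1 : (fun u : E => VectorFourier.fourierSMulRight (innerSL ℝ (E := E))
        (fun u : E => (capProfile u : ℂ)) u ζ) =
        fun u => (-(2 * Real.pi * Complex.I)) • ((⟪ζ, u⟫ * capProfile u : ℝ) : ℂ) := by
      ext u
      simp [VectorFourier.fourierSMulRight_apply, innerSL_apply_apply ℝ, real_inner_comm ζ u]
    have e2 : 𝓕 (fun u => (-(2 * Real.pi * Complex.I)) • ((⟪ζ, u⟫ * capProfile u : ℝ) : ℂ))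
        (ρ • ζ) = (-(2 * Real.pi * Complex.I)) •
          𝓕 (fun u : E => ((⟪ζ, u⟫ * capProfile u : ℝ) : ℂ)) (ρ • ζ) := by
      simp only [Real.fourier_eq]
      rw [← integral_smul]
      congr 1 with x
      rw [smul_comm]
    rw [e1, e2, fourier_inner_mul_capProfile, inner_smul_right, real_inner_self_eq_norm_sq]
    simp only [smul_eq_mul, Complex.ofReal_mul]
    have hZ' : (fun u : E => ((capProfile u ^ 2 : ℝ) : ℂ)) = Z := rfl
    rw [hZ']
    push_cast
    linear_combination (Real.pi ^ 2 * ρ * ‖ζ‖ ^ 2 * 𝓕 Z (ρ • ζ)) * Complex.I_sq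
  have h0 : 𝓕 (fun u : E => (capProfile u : ℂ)) ((0 : ℝ) • ζ) = (capMass E : ℂ) := by
    rw [zero_smul, Real.fourier_eq, capMass, ← integral_complex_ofReal]
    simp
  have hint := intervalIntegral.integral_eq_sub_of_hasDerivAt (a := 0) (b := τ)
    (fun ρ _ => hder ρ) (Continuous.intervalIntegrable (by fun_prop) _ _)
  rw [h0, intervalIntegral.integral_const_mul] at hint
  linear_combination hint

end Profile

section Directional

open scoped FourierTransform RealInnerProductSpace

variable {E : Type*} [NormedAddCommGroup E] [InnerProductSpace ℝ E]

/-- The self-adjoint map that fixes `e^⊥` and stretches the unit vector `e` by `1 + M`. -/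
def stretch (e : E) (M : ℝ) : E →L[ℝ] E :=
  ContinuousLinearMap.id ℝ E + M • (innerSL ℝ e).smulRight e

theorem stretch_apply (e : E) (M : ℝ) (u : E) : stretch e M u = u + (M * ⟪e, u⟫) • e := by
  simp [stretch, smul_smul]

theorem inner_stretch (e : E) (M : ℝ) (u ξ : E) : ⟪stretch e M u, ξ⟫ = ⟪u, stretch e M ξ⟫ := by
  simp only [stretch_apply, inner_add_left, inner_add_right, real_inner_smul_left,
    real_inner_smul_right, real_inner_comm u e]
  ring

theorem inner_self_stretch {e : E} (he : ‖e‖ = 1) (M : ℝ) (ξ : E) :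
    ⟪e, stretch e M ξ⟫ = (1 + M) * ⟪e, ξ⟫ := by
  simp only [stretch_apply, inner_add_right, real_inner_smul_right,
    real_inner_self_eq_norm_sq, he]
  ring

theorem norm_stretch_sq {e : E} (he : ‖e‖ = 1) (M : ℝ) (ξ : E) :
    ‖stretch e M ξ‖ ^ 2 = ‖ξ‖ ^ 2 + (M ^ 2 + 2 * M) * ⟪e, ξ⟫ ^ 2 := by
  rw [stretch_apply, ← real_inner_self_eq_norm_sq]
  simp only [inner_add_left, inner_add_right, real_inner_smul_left,
    real_inner_smul_right, real_inner_self_eq_norm_sq, real_inner_comm ξ e]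
  rw [norm_smul, he, mul_one, Real.norm_eq_abs, sq_abs]
  ring

theorem norm_le_norm_stretch {e : E} (he : ‖e‖ = 1) {M : ℝ} (hM : 0 ≤ M) (ξ : E) :
    ‖ξ‖ ≤ ‖stretch e M ξ‖ := by
  refine le_of_sq_le_sq ?_ (norm_nonneg _)
  rw [norm_stretch_sq he]
  have : 0 ≤ (M ^ 2 + 2 * M) * ⟪e, ξ⟫ ^ 2 := by positivity
  linarith

variable [FiniteDimensional ℝ E] [MeasurableSpace E] [BorelSpace E]

/-- Averaging over the ellipsoid of axes `τ`, elongated by `1 + M` in the direction `e`. -/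
def dirAvg (e : E) (M τ : ℝ) (F : E → ℂ) : E → ℂ :=
  translateAvg volume (fun u : E => ((capProfile u / capMass E : ℝ) : ℂ))
    (fun u => τ • stretch e M u) F

/-- The correction operator replacing the derivative of `F` along `e`. -/
def dirCorr (e : E) (M τ : ℝ) (F : E → ℂ) : E → ℂ :=
  translateAvg ((volume.restrict (Set.Ioc 0 τ)).prod volume)
    (fun p : ℝ × E =>
      (((M ^ 2 + 2 * M) / (1 + M) * (⟪e, p.2⟫ * capProfile p.2) / capMass E : ℝ) : ℂ))
    (fun p => p.1 • stretch e M p.2) F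

variable {e : E} {M τ : ℝ} {F : E → ℂ}

theorem integrable_dirAvg_weight :
    Integrable (fun u : E => ((capProfile u / capMass E : ℝ) : ℂ)) :=
  (integrable_capProfile.div_const _).ofReal

theorem integral_norm_dirAvg_weight :
    ∫ u : E, ‖((capProfile u / capMass E : ℝ) : ℂ)‖ = 1 := by
  have : ∀ u : E, ‖((capProfile u / capMass E : ℝ) : ℂ)‖ = capProfile u / capMass E := fun u => by
    rw [Complex.norm_real, Real.norm_of_nonneg]
    exact div_nonneg (capProfile_nonneg u) capMass_pos.le
  simp only [this, integral_div]
  exact div_self capMass_pos.ne'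

theorem continuous_dirCorr_weight :
    Continuous fun p : ℝ × E =>
      (((M ^ 2 + 2 * M) / (1 + M) * (⟪e, p.2⟫ * capProfile p.2) / capMass E : ℝ) : ℂ) := by
  have := continuous_capProfile (E := E)
  fun_prop

theorem integrable_inner_mul_capProfile :
    Integrable (fun u : E => ⟪e, u⟫ * capProfile u) := by
  have := continuous_capProfile (E := E)
  exact Continuous.integrable_of_hasCompactSupport (by fun_prop)
    hasCompactSupport_capProfile.mul_left

theorem integrable_dirCorr_weight :
    Integrable (fun p : ℝ × E =>
      (((M ^ 2 + 2 * M) / (1 + M) * (⟪e, p.2⟫ * capProfile p.2) / capMass E : ℝ) : ℂ))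
      ((volume.restrict (Set.Ioc 0 τ)).prod volume) := by
  refine Integrable.ofReal ?_
  have h1 : Integrable (fun _ : ℝ => (M ^ 2 + 2 * M) / (1 + M)) (volume.restrict (Set.Ioc 0 τ)) :=
    integrable_const _
  exact (h1.mul_prod (integrable_inner_mul_capProfile (e := e))).div_const _

theorem integral_norm_dirCorr_weight_le (he : ‖e‖ = 1) (hM : 1 ≤ M) (hτ : 0 ≤ τ) :
    ∫ p : ℝ × E,
      ‖(((M ^ 2 + 2 * M) / (1 + M) * (⟪e, p.2⟫ * capProfile p.2) / capMass E : ℝ) : ℂ)‖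
        ∂((volume.restrict (Set.Ioc 0 τ)).prod volume) ≤ 2 * M * τ := by
  have hm := capMass_pos (E := E)
  have hK : (M ^ 2 + 2 * M) / (1 + M) ≤ 2 * M := by
    rw [div_le_iff₀ (by linarith)]; nlinarith
  have hint : Integrable (fun p : ℝ × E => 2 * M * (capProfile p.2 / capMass E))
      ((volume.restrict (Set.Ioc 0 τ)).prod volume) :=
    (integrable_const (2 * M)).mul_prod (integrable_capProfile.div_const (capMass E))
  calc _ ≤ ∫ p : ℝ × E, 2 * M * (capProfile p.2 / capMass E)
        ∂((volume.restrict (Set.Ioc 0 τ)).prod volume) := by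
        refine integral_mono integrable_dirCorr_weight.norm hint fun p => ?_
        simp only
        rw [Complex.norm_real, mul_div_assoc, norm_mul, Real.norm_of_nonneg (by positivity)]
        refine mul_le_mul hK ?_ (norm_nonneg _) (by linarith)
        rw [norm_div, Real.norm_of_nonneg hm.le, norm_mul,
          Real.norm_of_nonneg (capProfile_nonneg _)]
        gcongr
        rcases le_total 1 ‖p.2‖ with h | h
        · simp [capProfile_eq_zero h]
        · have h3 : ‖⟪e, p.2⟫‖ ≤ 1 := (norm_inner_le_norm _ _).trans (by rw [he]; linarith)
          nlinarith [capProfile_nonneg p.2]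
    _ = 2 * M * τ := by
        rw [integral_prod_mul (fun _ : ℝ => 2 * M) (fun u : E => capProfile u / capMass E)]
        rw [integral_div, ← capMass, div_self hm.ne']
        simp [hτ]; ring

theorem measurable_dirAvg_shift : Measurable fun u : E => τ • stretch e M u := by fun_prop

theorem measurable_dirCorr_shift : Measurable fun p : ℝ × E => p.1 • stretch e M p.2 := by
  have : Continuous fun p : ℝ × E => p.1 • stretch e M p.2 := by fun_prop
  exact this.measurable

theorem integrable_dirAvg (hF : Integrable F) : Integrable (dirAvg e M τ F) :=
  integrable_translateAvg measurable_dirAvg_shift integrable_dirAvg_weight hF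

theorem integral_norm_dirAvg_le (hF : Integrable F) :
    ∫ x, ‖dirAvg e M τ F x‖ ≤ ∫ x, ‖F x‖ := by
  refine (integral_norm_translateAvg_le measurable_dirAvg_shift integrable_dirAvg_weight hF).trans ?_
  rw [integral_norm_dirAvg_weight, one_mul]

theorem integrable_dirCorr (hF : Integrable F) : Integrable (dirCorr e M τ F) :=
  integrable_translateAvg measurable_dirCorr_shift integrable_dirCorr_weight hF

theorem integral_norm_dirCorr_le (he : ‖e‖ = 1) (hM : 1 ≤ M) (hτ : 0 ≤ τ) (hF : Integrable F) :
    ∫ x, ‖dirCorr e M τ F x‖ ≤ 2 * M * τ * ∫ x, ‖F x‖ := by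
  refine (integral_norm_translateAvg_le measurable_dirCorr_shift
    integrable_dirCorr_weight hF).trans ?_
  exact mul_le_mul_of_nonneg_right (integral_norm_dirCorr_weight_le he hM hτ)
    (integral_nonneg fun _ => norm_nonneg _)

variable (E) in
/-- `∫₀^τ ρ 𝓕(capProfile²)(ρ ζ) dρ`, normalised so that `1 - η̂(τζ) = ‖ζ‖² · capTail τ ζ`. -/
def capTail (τ : ℝ) (ζ : E) : ℂ :=
  Real.pi ^ 2 / capMass E *
    ∫ ρ in (0 : ℝ)..τ, ρ * 𝓕 (fun u : E => ((capProfile u ^ 2 : ℝ) : ℂ)) (ρ • ζ)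

theorem fourier_dirAvg (hF : Integrable F) (ξ : E) :
    𝓕 (dirAvg e M τ F) ξ =
      (1 - ‖stretch e M ξ‖ ^ 2 * capTail E τ (stretch e M ξ)) * 𝓕 F ξ := by
  have hm : ((capMass E : ℝ) : ℂ) ≠ 0 := by exact_mod_cast capMass_pos.ne'
  rw [dirAvg, fourier_translateAvg measurable_dirAvg_shift integrable_dirAvg_weight hF]
  congr 1
  have h := one_sub_fourier_capProfile (stretch e M ξ) τ
  have e1 : ∫ u : E, 𝐞 (-⟪τ • stretch e M u, ξ⟫) • ((capProfile u / capMass E : ℝ) : ℂ) =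
      𝓕 (fun u : E => (capProfile u : ℂ)) (τ • stretch e M ξ) / capMass E := by
    rw [Real.fourier_eq, ← integral_div]
    congr 1 with u
    rw [real_inner_smul_left, inner_stretch, real_inner_smul_right]
    simp only [Circle.smul_def, smul_eq_mul, Complex.ofReal_div]
    ring
  rw [e1, capTail]
  field_simp
  linear_combination -h

theorem fourier_dirCorr (he : ‖e‖ = 1) (hM : 0 ≤ M) (hτ : 0 ≤ τ) (hF : Integrable F) (ξ : E) :
    𝓕 (dirCorr e M τ F) ξ =
      (M ^ 2 + 2 * M) * ⟪e, ξ⟫ * capTail E τ (stretch e M ξ) / (2 * Real.pi * Complex.I)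
        * 𝓕 F ξ := by
  have hm : ((capMass E : ℝ) : ℂ) ≠ 0 := by exact_mod_cast capMass_pos.ne'
  have hM' : (1 + M : ℂ) ≠ 0 := by exact_mod_cast (by linarith : (1 + M : ℝ) ≠ 0)
  rw [dirCorr, fourier_translateAvg measurable_dirCorr_shift integrable_dirCorr_weight hF]
  congr 1
  have hc : Continuous fun p : ℝ × E => ((𝐞 (-⟪p.1 • stretch e M p.2, ξ⟫) : Circle) : ℂ) :=
    continuous_subtype_val.comp (Real.continuous_fourierChar.comp (by fun_prop))
  rw [integral_prod _ (by
    refine (integrable_dirCorr_weight (e := e) (M := M) (τ := τ)).mono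
      (hc.aestronglyMeasurable.smul continuous_dirCorr_weight.aestronglyMeasurable)
      (Eventually.of_forall fun p => ?_)
    simp)]
  have e1 : ∀ ρ : ℝ, ∫ u : E, 𝐞 (-⟪ρ • stretch e M u, ξ⟫) •
      (((M ^ 2 + 2 * M) / (1 + M) * (⟪e, u⟫ * capProfile u) / capMass E : ℝ) : ℂ) =
      (-(Real.pi * Complex.I / 2) * (M ^ 2 + 2 * M) * ⟪e, ξ⟫ / capMass E) *
        (ρ * 𝓕 (fun u : E => ((capProfile u ^ 2 : ℝ) : ℂ)) (ρ • stretch e M ξ)) := by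
    intro ρ
    have h := fourier_inner_mul_capProfile e (ρ • stretch e M ξ)
    rw [real_inner_smul_right, inner_self_stretch he] at h
    calc _ = ((M ^ 2 + 2 * M) / (1 + M) / capMass E : ℂ) *
        𝓕 (fun u : E => ((⟪e, u⟫ * capProfile u : ℝ) : ℂ)) (ρ • stretch e M ξ) := by
          rw [Real.fourier_eq, ← integral_const_mul]
          congr 1 with u
          rw [real_inner_smul_left, inner_stretch, real_inner_smul_right]
          simp only [Circle.smul_def, smul_eq_mul]
          push_cast
          ring
      _ = _ := by
          rw [h]
          push_cast
          field_simp
  simp only [e1]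
  rw [integral_const_mul, ← intervalIntegral.integral_of_le hτ, capTail]
  have hpi : (Real.pi : ℂ) ≠ 0 := by exact_mod_cast Real.pi_ne_zero
  have hI := Complex.I_ne_zero
  field_simp
  rw [Complex.I_sq]
  ring

/-- If `⟪e, ∇⟫ F` is expressed through `F'` and the derivatives of `G i`, the part of `F` not seen
by `dirAvg` is, up to `dirCorr F'`, controlled by Fourier multipliers that are small away from the
hyperplane `e^⊥`. -/
theorem fourier_sub_dirAvg_sub_dirCorr (he : ‖e‖ = 1) (hM : 0 ≤ M) (hτ : 0 ≤ τ)
    {ι : Type*} [Fintype ι] (b : ι → E) {F' : E → ℂ} {G : ι → E → ℂ}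
    (hF : Integrable F) (hF' : Integrable F') (hG : ∀ i, Integrable (G i)) (ξ : E)
    (h : ⟪e, ξ⟫ * 𝓕 F ξ = (2 * Real.pi * Complex.I)⁻¹ * 𝓕 F' ξ +
      ∑ i, (⟪b i, ξ⟫ : ℂ) * 𝓕 (G i) ξ) :
    𝓕 (fun x => F x - dirAvg e M τ F x - dirCorr e M τ F' x) ξ =
      ((‖ξ‖ ^ 2 / ‖stretch e M ξ‖ ^ 2 : ℝ) : ℂ) * 𝓕 (fun x => F x - dirAvg e M τ F x) ξ +
      ∑ i, (((M ^ 2 + 2 * M) * ⟪e, ξ⟫ * ⟪b i, ξ⟫ / ‖stretch e M ξ‖ ^ 2 : ℝ) : ℂ) *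
        𝓕 (fun x => G i x - dirAvg e M τ (G i) x) ξ := by
  have hsub : ∀ {f g : E → ℂ}, Integrable f → Integrable g →
      𝓕 (fun x => f x - g x) ξ = 𝓕 f ξ - 𝓕 g ξ := by
    intro f g hf hg
    simp only [Real.fourier_eq, smul_sub]
    exact integral_sub ((Real.fourierIntegral_convergent_iff ξ).2 hf)
      ((Real.fourierIntegral_convergent_iff ξ).2 hg)
  have hA : ∀ {f : E → ℂ}, Integrable f → 𝓕 (fun x => f x - dirAvg e M τ f x) ξ =
      ‖stretch e M ξ‖ ^ 2 * capTail E τ (stretch e M ξ) * 𝓕 f ξ := by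
    intro f hf
    rw [hsub hf (integrable_dirAvg hf), fourier_dirAvg hf]
    ring
  have hH : Integrable fun x => F x - dirAvg e M τ F x := hF.sub (integrable_dirAvg hF)
  rw [hsub hH (integrable_dirCorr hF'), hA hF,
    fourier_dirCorr he hM hτ hF']
  simp only [fun i => hA (hG i)]
  rcases eq_or_ne ξ 0 with rfl | hξ
  · simp
  have hD : ((‖stretch e M ξ‖ : ℝ) : ℂ) ≠ 0 := by
    have := (norm_pos_iff.2 hξ).trans_le (norm_le_norm_stretch he hM ξ)
    exact_mod_cast this.ne'
  have e1 : ∑ i, (((M ^ 2 + 2 * M) * ⟪e, ξ⟫ * ⟪b i, ξ⟫ / ‖stretch e M ξ‖ ^ 2 : ℝ) : ℂ) *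
        (‖stretch e M ξ‖ ^ 2 * capTail E τ (stretch e M ξ) * 𝓕 (G i) ξ) =
      (M ^ 2 + 2 * M) * ⟪e, ξ⟫ * capTail E τ (stretch e M ξ) *
        ∑ i, (⟪b i, ξ⟫ : ℂ) * 𝓕 (G i) ξ := by
    rw [Finset.mul_sum]
    refine Finset.sum_congr rfl fun i _ => ?_
    push_cast
    field_simp
  have e2 : ((‖stretch e M ξ‖ : ℝ) : ℂ) ^ 2 = ‖ξ‖ ^ 2 + (M ^ 2 + 2 * M) * ⟪e, ξ⟫ ^ 2 := by
    exact_mod_cast norm_stretch_sq he M ξ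
  have e3 : ((‖ξ‖ ^ 2 / ‖stretch e M ξ‖ ^ 2 : ℝ) : ℂ) * (‖stretch e M ξ‖ ^ 2 *
      capTail E τ (stretch e M ξ) * 𝓕 F ξ) = ‖ξ‖ ^ 2 * capTail E τ (stretch e M ξ) * 𝓕 F ξ := by
    push_cast
    field_simp
  rw [e1, e3, e2]
  linear_combination (M ^ 2 + 2 * M) * ⟪e, ξ⟫ * capTail E τ (stretch e M ξ) * h

end Directional

section Cancellation

open scoped RealInnerProductSpace

variable {E : Type*} [NormedAddCommGroup E] [InnerProductSpace ℝ E] [FiniteDimensional ℝ E]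
  [MeasurableSpace E] [BorelSpace E]

theorem integral_comp_continuousLinearEquiv {F : Type*} [NormedAddCommGroup F] [NormedSpace ℝ F]
    (S : E ≃L[ℝ] E) (f : E → F) :
    ∫ u, f (S u) = |(LinearMap.det (S : E →ₗ[ℝ] E))⁻¹| • ∫ u, f u := by
  have hdet : LinearMap.det (S : E →ₗ[ℝ] E) ≠ 0 := (LinearEquiv.isUnit_det' S.toLinearEquiv).ne_zero
  have h := Measure.map_linearMap_addHaar_eq_smul_addHaar (volume : Measure E) hdet
  have h2 := S.toHomeomorph.measurableEmbedding.integral_map (μ := volume) f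
  have e : (⇑S.toHomeomorph : E → E) = ⇑(S : E →ₗ[ℝ] E) := rfl
  rw [e, h, integral_smul_measure, ENNReal.toReal_ofReal (abs_nonneg _)] at h2
  exact h2.symm

theorem integral_abs_capProfile_sub_le (v : E) :
    ∫ u : E, |capProfile u - capProfile (u + v)| ≤
      4 * volume.real (closedBall (0 : E) 1) * ‖v‖ := by
  set s : Set E := closedBall 0 1 ∪ closedBall (-v) 1
  have hfin : volume s ≠ ⊤ :=
    (measure_union_lt_top measure_closedBall_lt_top measure_closedBall_lt_top).ne
  have h0 : ∀ u, |capProfile u - capProfile (u + v)| ≤ s.indicator (fun _ => 2 * ‖v‖) u := by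
    intro u
    by_cases hu : u ∈ s
    · rw [Set.indicator_of_mem hu]
      refine (abs_capProfile_sub_le _ _).trans_eq ?_
      simp
    · rw [Set.indicator_of_notMem hu]
      simp only [s, Set.mem_union, mem_closedBall, not_or, not_le, dist_eq_norm,
        sub_neg_eq_add, sub_zero] at hu
      simp [capProfile_eq_zero hu.1.le, capProfile_eq_zero hu.2.le]
  have hs : MeasurableSet s := measurableSet_closedBall.union measurableSet_closedBall
  calc ∫ u : E, |capProfile u - capProfile (u + v)|
      ≤ ∫ u, s.indicator (fun _ => 2 * ‖v‖) u :=
        integral_mono_of_nonneg (Eventually.of_forall fun _ => abs_nonneg _)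
          ((integrable_indicator_iff hs).2 (integrableOn_const hfin)) (Eventually.of_forall h0)
    _ = volume.real s * (2 * ‖v‖) := by
        rw [integral_indicator hs, setIntegral_const, smul_eq_mul]
    _ ≤ (2 * volume.real (closedBall (0 : E) 1)) * (2 * ‖v‖) := by
        gcongr
        refine (measureReal_union_le _ _).trans_eq ?_
        rw [Measure.real, Measure.real, Measure.addHaar_closedBall_center volume (-v)]
        ring
    _ = _ := by ring

/-- `τ • stretch e M` as an invertible map. -/
def stretchEquiv (e : E) (he : ‖e‖ = 1) (M : ℝ) (hM : 0 ≤ M) (τ : ℝ) (hτ : 0 < τ) : E ≃L[ℝ] E :=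
  (LinearEquiv.ofInjectiveEndo ((τ • stretch e M : E →L[ℝ] E) : E →ₗ[ℝ] E) (by
    rw [← LinearMap.ker_eq_bot, LinearMap.ker_eq_bot']
    intro u hu
    have h1 : τ • stretch e M u = 0 := hu
    have h2 := (smul_eq_zero.1 h1).resolve_left hτ.ne'
    have := norm_le_norm_stretch he hM u
    rw [h2, norm_zero] at this
    exact norm_le_zero_iff.1 this)).toContinuousLinearEquiv

variable {e : E} {M τ : ℝ}

theorem stretchEquiv_apply (he : ‖e‖ = 1) (hM : 0 ≤ M) (hτ : 0 < τ) (u : E) :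
    stretchEquiv e he M hM τ hτ u = τ • stretch e M u := rfl

theorem norm_stretchEquiv_symm_le (he : ‖e‖ = 1) (hM : 0 ≤ M) (hτ : 0 < τ) (v : E) :
    ‖(stretchEquiv e he M hM τ hτ).symm v‖ ≤ ‖v‖ / τ := by
  obtain ⟨u, rfl⟩ := (stretchEquiv e he M hM τ hτ).surjective v
  rw [ContinuousLinearEquiv.symm_apply_apply, stretchEquiv_apply, norm_smul,
    Real.norm_of_nonneg hτ.le, mul_div_cancel_left₀ _ hτ.ne']
  exact norm_le_norm_stretch he hM u

variable (E) in
/-- The constant in the cancellation estimate `integral_norm_dirAvg_le_of_integral_eq_zero`. -/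
def capConst : ℝ := 4 * volume.real (closedBall (0 : E) 1) / capMass E

theorem capConst_nonneg : 0 ≤ capConst E := by
  have := capMass_pos (E := E)
  unfold capConst; positivity

theorem integral_norm_dirAvg_le_of_integral_eq_zero (he : ‖e‖ = 1) (hM : 0 ≤ M) (hτ : 0 < τ)
    {b : E → ℂ} (hb : Integrable b) {y₀ : E} {r : ℝ} (hsupp : ∀ y, b y ≠ 0 → ‖y - y₀‖ ≤ r)
    (hmean : ∫ y, b y = 0) :
    ∫ x, ‖dirAvg e M τ b x‖ ≤ capConst E * (r / τ) * ∫ y, ‖b y‖ := by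
  have hm := capMass_pos (E := E)
  set S := stretchEquiv e he M hM τ hτ with hS
  set J : ℝ := |(LinearMap.det (S : E →ₗ[ℝ] E))⁻¹| with hJ
  set φ : E → ℂ := fun y => ((J * (capProfile (S.symm y) / capMass E) : ℝ) : ℂ) with hφ
  have hcap := continuous_capProfile (E := E)
  have hφc : Continuous φ := by fun_prop
  have hφi : Integrable φ := by
    refine hφc.integrable_of_hasCompactSupport ?_
    have h1 : HasCompactSupport (fun y => capProfile (S.symm y)) :=
      hasCompactSupport_capProfile.comp_homeomorph S.symm.toHomeomorph
    exact h1.comp_left (g := fun t : ℝ => ((J * (t / capMass E) : ℝ) : ℂ)) (by simp)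
  have hfull : Integrable (fun p : E × E => b p.1 * φ p.2) (volume.prod volume) := hb.mul_prod hφi
  have hsh : Integrable (fun p : E × E => b p.1 * φ (p.2 - (y₀ - p.1))) (volume.prod volume) :=
    integrable_shear (Ψ := fun y x => b y * φ x) (v := fun y => y₀ - y) (by fun_prop) hfull
  have hΨ : Integrable (fun p : E × E => b p.1 * (φ p.2 - φ (p.2 - (y₀ - p.1))))
      (volume.prod volume) := by
    simp only [mul_sub]
    exact hfull.sub hsh
  have hrep : ∀ x, dirAvg e M τ b x = ∫ y, b y * (φ (x - y) - φ (x - y - (y₀ - y))) := by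
    intro x
    have h1 : dirAvg e M τ b x = ∫ y, b y * φ (x - y) := by
      calc dirAvg e M τ b x
          = ∫ u, (fun y => ((capProfile (S.symm y) / capMass E : ℝ) : ℂ) * b (x - y)) (S u) := by
            simp only [dirAvg, translateAvg, ContinuousLinearEquiv.symm_apply_apply]
            rfl
        _ = J • ∫ y, ((capProfile (S.symm y) / capMass E : ℝ) : ℂ) * b (x - y) :=
            integral_comp_continuousLinearEquiv S
              (fun y => ((capProfile (S.symm y) / capMass E : ℝ) : ℂ) * b (x - y))
        _ = J • ∫ y, ((capProfile (S.symm (x - y)) / capMass E : ℝ) : ℂ) * b y := by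
            rw [← integral_sub_left_eq_self _ volume x]
            simp
        _ = ∫ y, b y * φ (x - y) := by
            rw [← integral_smul]
            congr 1 with y
            simp only [hφ, Complex.real_smul]
            push_cast
            ring
    have h2 : ∫ y, b y * φ (x - y₀) = 0 := by rw [integral_mul_const, hmean, zero_mul]
    have hbd : ∃ C, ∀ z, ‖φ z‖ ≤ C := by
      refine ⟨J * (1 / capMass E), fun z => ?_⟩
      rw [hφ, Complex.norm_real, Real.norm_of_nonneg (mul_nonneg (abs_nonneg _)
        (div_nonneg (capProfile_nonneg _) hm.le))]
      gcongr
      exact capProfile_le_one _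
    obtain ⟨C, hC⟩ := hbd
    have i1 : Integrable fun y => b y * φ (x - y) :=
      hb.mul_bdd (c := C) (by fun_prop) (Eventually.of_forall fun y => hC _)
    have i2 : Integrable fun y => b y * φ (x - y₀) := hb.mul_const _
    rw [h1, ← sub_zero (∫ y, b y * φ (x - y)), ← h2, ← integral_sub i1 i2]
    congr 1 with y
    rw [sub_sub x y, add_sub_cancel, mul_sub]
  have hbound : ∀ v : E, ‖v‖ ≤ r → ∫ x, ‖φ x - φ (x - v)‖ ≤ capConst E * (r / τ) := by
    intro v hv
    have e1 : ∀ x, ‖φ x - φ (x - v)‖ = J * (|capProfile (S.symm x) - capProfile (S.symm (x - v))|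
        / capMass E) := by
      intro x
      rw [hφ, ← Complex.ofReal_sub, Complex.norm_real, ← mul_sub, ← sub_div, Real.norm_eq_abs,
        abs_mul, abs_div, abs_of_pos hm, abs_of_nonneg (abs_nonneg _)]
    have e2 := integral_comp_continuousLinearEquiv S (fun x =>
      |capProfile (S.symm x) - capProfile (S.symm (x - v))| / capMass E)
    simp only [e1, integral_const_mul]
    rw [smul_eq_mul] at e2
    rw [← e2]
    simp only [map_sub, ContinuousLinearEquiv.symm_apply_apply, integral_div]
    have h3 := integral_abs_capProfile_sub_le (-(S.symm v))
    simp only [← sub_eq_add_neg, norm_neg] at h3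
    have h4 : ‖S.symm v‖ ≤ r / τ := (norm_stretchEquiv_symm_le he hM hτ v).trans (by gcongr)
    calc _ ≤ 4 * volume.real (closedBall (0 : E) 1) * (r / τ) / capMass E := by
          gcongr
          exact h3.trans (by gcongr)
      _ = _ := by unfold capConst; ring
  have hsup := integral_norm_superposition_le (v := fun y : E => y)
    (Ψ := fun y x => b y * (φ x - φ (x - (y₀ - y)))) measurable_id hΨ
  simp only [hrep]
  refine hsup.trans ?_
  rw [← integral_const_mul]
  refine integral_mono_of_nonneg (Eventually.of_forall fun _ => integral_nonneg fun _ => norm_nonneg _)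
    (hb.norm.const_mul _) (Eventually.of_forall fun y => ?_)
  simp only [norm_mul, integral_const_mul]
  by_cases hy : b y = 0
  · simp [hy]
  · rw [mul_comm]
    refine mul_le_mul_of_nonneg_right (hbound _ ?_) (norm_nonneg _)
    rw [norm_sub_rev]; exact hsupp y hy

end Cancellation

section Euler

variable {E : Type*} [NormedAddCommGroup E] [InnerProductSpace ℝ E] [FiniteDimensional ℝ E]
  [MeasurableSpace E] [BorelSpace E]

/-- Euler's identity against a function homogeneous of degree zero. -/
theorem integral_homogeneous_mul_euler [Nontrivial E] {ω : E → ℝ} (hω : Measurable ω) {B : ℝ}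
    (hB : ∀ z, |ω z| ≤ B) (hom : ∀ r : ℝ, 0 < r → ∀ z : E, z ≠ 0 → ω (r • z) = ω z)
    {W : E → ℂ} {K : NNReal} (hW : LipschitzWith K W) {ρ : ℝ} (hρ : ∀ z, W z ≠ 0 → ‖z‖ ≤ ρ) :
    ∫ z, (ω z : ℂ) * (Module.finrank ℝ E * W z + fderiv ℝ W z z) = 0 := by
  set n := Module.finrank ℝ E with hn
  have hB0 : 0 ≤ B := (abs_nonneg _).trans (hB 0)
  have hcomp : HasCompactSupport W :=
    HasCompactSupport.of_support_subset_isCompact (isCompact_closedBall 0 ρ)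
      fun z hz => mem_closedBall_zero_iff.2 (hρ z hz)
  have hWi : Integrable W := hW.continuous.integrable_of_hasCompactSupport hcomp
  have hωW : Integrable fun z => (ω z : ℂ) * W z := by
    refine hWi.bdd_mul (c := B) (by fun_prop) (Eventually.of_forall fun z => ?_)
    rw [Complex.norm_real]; exact hB z
  set F : ℝ → E → ℂ := fun t z => (ω z : ℂ) * W (t • z) with hF
  have hscale : ∀ t : ℝ, 0 < t → ∫ z, F t z = (t ^ n)⁻¹ • ∫ z, F 1 z := by
    intro t ht
    have h := Measure.integral_comp_smul (volume : Measure E) (fun z => (ω z : ℂ) * W z) t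
    rw [abs_of_nonneg (by positivity)] at h
    simp only [hF, one_smul]
    rw [← h]
    refine integral_congr_ae ?_
    have : ∀ᵐ z : E, z ≠ 0 := by simp [ae_iff]
    filter_upwards [this] with z hz
    rw [hom t ht z hz]
  have hder1 : HasDerivAt (fun t : ℝ => ∫ z, F t z) (-(n : ℝ) • ∫ z, F 1 z) 1 := by
    have h1 : HasDerivAt (fun t : ℝ => (t ^ n)⁻¹ • ∫ z, F 1 z) (-(n : ℝ) • ∫ z, F 1 z) 1 := by
      have := ((hasDerivAt_pow n (1 : ℝ)).inv (by simp)).smul_const (∫ z, F 1 z)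
      simpa using this
    refine h1.congr_of_eventuallyEq ?_
    filter_upwards [lt_mem_nhds (zero_lt_one' ℝ)] with t ht
    exact hscale t ht
  have hdiff := hW.ae_differentiableAt (μ := (volume : Measure E))
  set bound : E → ℝ := (closedBall (0 : E) (2 * ρ)).indicator (fun _ => B * (K * (2 * ρ)))
  have hbound : Integrable bound := by
    refine (integrable_indicator_iff measurableSet_closedBall).2 ?_
    exact integrableOn_const measure_closedBall_lt_top.ne
  have hW0 : ∀ t ∈ ball (1 : ℝ) (1 / 2), ∀ z : E, 2 * ρ < ‖z‖ → W (t • z) = 0 := by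
    intro t ht z hz
    by_contra h
    have h1 := hρ _ h
    rw [mem_ball, Real.dist_eq, abs_lt] at ht
    rw [norm_smul, Real.norm_eq_abs, abs_of_pos (by linarith)] at h1
    nlinarith [norm_nonneg z]
  have key := hasDerivAt_integral_of_dominated_loc_of_lip (μ := (volume : Measure E)) (F := F)
    (F' := fun z => (ω z : ℂ) * fderiv ℝ W z z) (x₀ := (1 : ℝ)) (s := ball 1 (1 / 2))
    (bound := bound) (ball_mem_nhds _ (by norm_num))
    (Eventually.of_forall fun t => by
      have := hW.continuous
      have h2 : Measurable fun z : E => W (t • z) := by fun_prop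
      fun_prop)
    (by simpa [hF] using hωW)
    (by
      have h1 : Measurable (fderiv ℝ W) := measurable_fderiv ℝ W
      have h2 : Measurable fun z : E => fderiv ℝ W z z :=
        isBoundedBilinearMap_apply.continuous.measurable.comp (h1.prodMk measurable_id)
      fun_prop)
    (Eventually.of_forall fun z => by
      refine LipschitzOnWith.of_dist_le_mul fun t ht s hs => ?_
      simp only [hF, bound]
      by_cases hz : z ∈ closedBall (0 : E) (2 * ρ)
      · rw [Set.indicator_of_mem hz, dist_eq_norm, ← mul_sub, norm_mul, Complex.norm_real]
        rw [mem_closedBall_zero_iff] at hz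
        have h1 := hW.dist_le_mul (t • z) (s • z)
        rw [dist_eq_norm, dist_eq_norm, ← sub_smul, norm_smul] at h1
        have h2 : 0 ≤ 2 * ρ := (norm_nonneg z).trans hz
        rw [Real.coe_nnabs, abs_of_nonneg (by positivity), Real.dist_eq]
        calc ‖ω z‖ * ‖W (t • z) - W (s • z)‖ ≤ B * (K * (‖t - s‖ * ‖z‖)) := by
              gcongr
              exact hB z
          _ ≤ B * (K * (‖t - s‖ * (2 * ρ))) := by gcongr
          _ = _ := by rw [Real.norm_eq_abs]; ring
      · rw [Set.indicator_of_notMem hz]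
        rw [mem_closedBall_zero_iff, not_le] at hz
        simp [hW0 t ht z hz, hW0 s hs z hz])
    hbound
    (by
      filter_upwards [hdiff] with z hz
      have h1 : HasDerivAt (fun t : ℝ => t • z) z 1 := by
        simpa using (hasDerivAt_id (1 : ℝ)).smul_const z
      have h2 : HasFDerivAt W (fderiv ℝ W z) ((1 : ℝ) • z) := by
        rw [one_smul]; exact hz.hasFDerivAt
      exact (h2.comp_hasDerivAt (1 : ℝ) h1).const_mul _)
  have huniq := hder1.unique key.2
  have hF1 : ∀ z, F 1 z = (ω z : ℂ) * W z := fun z => by simp [hF]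
  simp only [hF1] at huniq
  simp only [mul_add]
  rw [integral_add ?_ key.1, ← huniq]
  · have : ∀ z, (ω z : ℂ) * (n * W z) = n * (ω z * W z) := fun z => by ring
    simp only [this, integral_const_mul]
    simp
  · have : ∀ z, (ω z : ℂ) * (n * W z) = n * (ω z * W z) := fun z => by ring
    simp only [this]
    exact hωW.const_mul _

theorem integral_homogeneous_mul_euler_mul [Nontrivial E] {ω : E → ℝ} (hω : Measurable ω) {B : ℝ}
    (hB : ∀ z, |ω z| ≤ B) (hom : ∀ r : ℝ, 0 < r → ∀ z : E, z ≠ 0 → ω (r • z) = ω z)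
    {g : E → ℂ} (hg : ContDiff ℝ 1 g) {ρ : ℝ} (hρ : ∀ z, g z ≠ 0 → ‖z‖ ≤ ρ)
    {a : E → ℝ} {K : NNReal} (ha : LipschitzWith K a) :
    ∫ z, (ω z : ℂ) * (Module.finrank ℝ E * (g z * a z) + fderiv ℝ g z z * a z +
      g z * (fderiv ℝ a z z : ℝ)) = 0 := by
  have hcomp : HasCompactSupport g :=
    HasCompactSupport.of_support_subset_isCompact (isCompact_closedBall 0 ρ)
      fun z hz => mem_closedBall_zero_iff.2 (hρ z hz)
  obtain ⟨Kg, hKg⟩ := hg.lipschitzWith_of_hasCompactSupport hcomp (by norm_num)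
  obtain ⟨G, hG⟩ := hg.continuous.bounded_above_of_compact_support hcomp
  have hG0 : 0 ≤ G := (norm_nonneg _).trans (hG 0)
  have hlip : ∀ x y, g x ≠ 0 → ‖g x * a x - g y * a y‖ ≤
      (Kg * (|a 0| + K * |ρ|) + G * K) * ‖x - y‖ := by
    intro x y hx
    have h1 : |a x| ≤ |a 0| + K * |ρ| := by
      have h := ha.dist_le_mul x 0
      rw [Real.dist_eq, dist_zero_right] at h
      have h2 : ‖x‖ ≤ |ρ| := (hρ x hx).trans (le_abs_self _)
      have h3 : |a x| ≤ |a 0| + |a x - a 0| := by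
        have := abs_add_le (a 0) (a x - a 0)
        simpa using this
      have h4 : (K : ℝ) * ‖x‖ ≤ K * |ρ| := by gcongr
      linarith
    have h2 := hKg.dist_le_mul x y
    have h3 := ha.dist_le_mul x y
    rw [dist_eq_norm, dist_eq_norm] at h2 h3
    calc ‖g x * a x - g y * a y‖ = ‖(g x - g y) * a x + g y * ((a x - a y : ℝ) : ℂ)‖ := by
          push_cast; ring_nf
      _ ≤ ‖g x - g y‖ * |a x| + ‖g y‖ * ‖a x - a y‖ := by
          refine (norm_add_le _ _).trans ?_
          rw [norm_mul, norm_mul, Complex.norm_real, Complex.norm_real, Real.norm_eq_abs (a x)]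
      _ ≤ (Kg * ‖x - y‖) * (|a 0| + K * |ρ|) + G * (K * ‖x - y‖) := by
          gcongr
          exact hG y
      _ = _ := by ring
  have hW : LipschitzWith (Kg * (‖a 0‖₊ + K * ‖ρ‖₊) + ⟨G, hG0⟩ * K) fun z => g z * a z := by
    refine LipschitzWith.of_dist_le_mul fun x y => ?_
    rw [dist_eq_norm, dist_eq_norm]
    by_cases hx : g x = 0
    · by_cases hy : g y = 0
      · simp only [hx, hy, zero_mul, sub_zero, norm_zero]
        positivity
      · rw [norm_sub_rev, norm_sub_rev x]
        exact hlip y x hy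
    · exact hlip x y hx
  have h := integral_homogeneous_mul_euler hω hB hom hW (ρ := ρ)
    (fun z hz => hρ z (left_ne_zero_of_mul hz))
  rw [← h]
  refine integral_congr_ae ?_
  filter_upwards [ha.ae_differentiableAt (μ := (volume : Measure E))] with z hz
  have h1 : HasFDerivAt (fun z => (a z : ℂ)) (Complex.ofRealCLM ∘L fderiv ℝ a z) z :=
    Complex.ofRealCLM.hasFDerivAt.comp z hz.hasFDerivAt
  have h2 : HasFDerivAt (fun z => g z * (a z : ℂ)) _ z := ((hg.differentiable (by norm_num)) z).hasFDerivAt.mul h1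
  rw [h2.fderiv]
  simp only [FunLike.coe_add, FunLike.coe_smul, Pi.add_apply, Pi.smul_apply, smul_eq_mul,
    ContinuousLinearMap.comp_apply, Complex.ofRealCLM_apply]
  ring

end Euler

section Geometry

open Module
open scoped RealInnerProductSpace

variable {E : Type*} [NormedAddCommGroup E] [InnerProductSpace ℝ E] [FiniteDimensional ℝ E]
  [MeasurableSpace E] [BorelSpace E]

/-- The map multiplying by `t` in the direction of the unit vector `e` and fixing its
orthogonal complement. -/
def squeeze (e : E) (t : ℝ) : E →ₗ[ℝ] E :=
  LinearMap.transvection ((t - 1) • (innerSL ℝ e).toLinearMap) e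

lemma squeeze_apply (e : E) (t : ℝ) (x : E) :
    squeeze e t x = x + ((t - 1) * ⟪e, x⟫) • e := by
  simp [squeeze, LinearMap.transvection.apply]

lemma det_squeeze {e : E} (he : ‖e‖ = 1) (t : ℝ) : LinearMap.det (squeeze e t) = t := by
  rw [squeeze, LinearMap.transvection.det]
  simp [he]

lemma norm_sq_eq_inner_add_norm_sub {e : E} (he : ‖e‖ = 1) (v : E) :
    ‖v‖ ^ 2 = ⟪e, v⟫ ^ 2 + ‖v - ⟪e, v⟫ • e‖ ^ 2 := by
  rw [norm_sub_sq_real, inner_smul_right, real_inner_comm, norm_smul, he]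
  simp only [Real.norm_eq_abs, mul_one, sq_abs]
  ring

lemma volume_real_closedBall_le (ρ : ℝ) (hρ : 0 ≤ ρ) :
    volume.real (closedBall (0 : E) ρ) = ρ ^ finrank ℝ E * volume.real (ball (0 : E) 1) := by
  rw [Measure.real, Measure.addHaar_closedBall _ _ hρ, ENNReal.toReal_mul,
    ENNReal.toReal_ofReal (by positivity), Measure.real]

lemma volume_real_image_le (f : E →ₗ[ℝ] E) {s : Set E} {ρ : ℝ} (hρ : 0 ≤ ρ)
    (hs : s ⊆ f '' closedBall 0 ρ) :
    volume.real s ≤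
      |LinearMap.det f| * (ρ ^ finrank ℝ E * volume.real (ball (0 : E) 1)) := by
  rw [← volume_real_closedBall_le ρ hρ]
  have hfin : volume (f '' closedBall 0 ρ) ≠ ⊤ := by
    rw [Measure.addHaar_image_linearMap]
    exact ENNReal.mul_ne_top ENNReal.ofReal_ne_top measure_closedBall_lt_top.ne
  refine (measureReal_mono hs hfin).trans (le_of_eq ?_)
  rw [Measure.real, Measure.addHaar_image_linearMap, ENNReal.toReal_mul,
    ENNReal.toReal_ofReal (abs_nonneg _), Measure.real]

lemma volume_real_band_le {e : E} (he : ‖e‖ = 1) {t ρ : ℝ} (ht : 0 < t) (hρ : 0 ≤ ρ) :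
    volume.real {x : E | ‖x‖ ≤ ρ ∧ |⟪e, x⟫| ≤ t * ρ} ≤
      t * ((2 * ρ) ^ finrank ℝ E * volume.real (ball (0 : E) 1)) := by
  have := volume_real_image_le (squeeze e t) (ρ := 2 * ρ)
    (s := {x : E | ‖x‖ ≤ ρ ∧ |⟪e, x⟫| ≤ t * ρ}) (by positivity) ?_
  · rwa [det_squeeze he, abs_of_pos ht] at this
  rintro x ⟨hx, hx'⟩
  refine ⟨squeeze e t⁻¹ x, ?_, ?_⟩
  · rw [mem_closedBall_zero_iff]
    have h1 : squeeze e t⁻¹ x = (x - ⟪e, x⟫ • e) + (t⁻¹ * ⟪e, x⟫) • e := by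
      rw [squeeze_apply]; module
    have h2 := norm_sq_eq_inner_add_norm_sub he x
    have h3 : ‖x - ⟪e, x⟫ • e‖ ≤ ρ := by
      refine le_trans ?_ hx
      refine abs_le_of_sq_le_sq' ?_ (norm_nonneg _) |>.2
      nlinarith [sq_nonneg ⟪e, x⟫]
    have h4 : ‖(t⁻¹ * ⟪e, x⟫) • e‖ ≤ ρ := by
      rw [norm_smul, he, mul_one, Real.norm_eq_abs, abs_mul, abs_of_pos (inv_pos.2 ht)]
      rw [inv_mul_le_iff₀ ht]
      exact hx'
    rw [h1]
    linarith [norm_add_le (x - ⟪e, x⟫ • e) ((t⁻¹ * ⟪e, x⟫) • e)]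
  · have hee : ⟪e, e⟫ = 1 := by rw [real_inner_self_eq_norm_sq, he]; norm_num
    simp only [squeeze_apply, inner_add_right, inner_smul_right, hee]
    have : (t⁻¹ - 1) * ⟪e, x⟫ + (t - 1) * (⟪e, x⟫ + (t⁻¹ - 1) * ⟪e, x⟫ * 1) = 0 := by
      field_simp; ring
    rw [add_assoc, ← add_smul, this, zero_smul, add_zero]

/-- The tube of length `ρ` and width `h ρ` in the direction `e`, centred at the origin. -/
def tube (e : E) (h ρ : ℝ) : Set E := {v | |⟪e, v⟫| ≤ ρ ∧ ‖v - ⟪e, v⟫ • e‖ ≤ h * ρ}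

lemma volume_real_tube_le [Nontrivial E] {e : E} (he : ‖e‖ = 1) {h ρ : ℝ} (hh : 0 < h)
    (hρ : 0 ≤ ρ) :
    volume.real (tube e h ρ) ≤
      h ^ (finrank ℝ E - 1) * ((2 * ρ) ^ finrank ℝ E * volume.real (ball (0 : E) 1)) := by
  have hn : 0 < finrank ℝ E := finrank_pos
  have := volume_real_image_le (h • squeeze e h⁻¹) (ρ := 2 * ρ)
    (s := tube e h ρ) (by positivity) ?_
  · rw [LinearMap.det_smul, det_squeeze he, abs_of_pos (by positivity)] at this
    obtain ⟨m, hm⟩ := Nat.exists_eq_succ_of_ne_zero hn.ne'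
    rw [hm] at this ⊢
    rw [Nat.succ_eq_add_one, pow_succ h, mul_assoc (h ^ m), mul_inv_cancel₀ hh.ne', mul_one] at this
    simpa using this
  rintro x ⟨hx, hx'⟩
  have hee : ⟪e, e⟫ = 1 := by rw [real_inner_self_eq_norm_sq, he]; norm_num
  refine ⟨h⁻¹ • squeeze e h x, ?_, ?_⟩
  · rw [mem_closedBall_zero_iff]
    have h1 : h⁻¹ • squeeze e h x = h⁻¹ • (x - ⟪e, x⟫ • e) + ⟪e, x⟫ • e := by
      rw [squeeze_apply, smul_add, smul_sub, smul_smul, smul_smul, ← mul_assoc, mul_sub,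
        inv_mul_cancel₀ hh.ne']
      module
    rw [h1]
    have h3 : ‖h⁻¹ • (x - ⟪e, x⟫ • e)‖ ≤ ρ := by
      rw [norm_smul, Real.norm_eq_abs, abs_of_pos (inv_pos.2 hh), inv_mul_le_iff₀ hh]
      exact hx'
    have h4 : ‖⟪e, x⟫ • e‖ ≤ ρ := by
      rw [norm_smul, he, mul_one, Real.norm_eq_abs]; exact hx
    linarith [norm_add_le (h⁻¹ • (x - ⟪e, x⟫ • e)) (⟪e, x⟫ • e)]
  · rw [LinearMap.smul_apply, map_smul, smul_smul, mul_inv_cancel₀ hh.ne', one_smul]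
    simp only [squeeze_apply, inner_add_right, inner_smul_right, hee]
    have : (h - 1) * ⟪e, x⟫ + (h⁻¹ - 1) * (⟪e, x⟫ + (h - 1) * ⟪e, x⟫ * 1) = 0 := by
      field_simp; ring
    rw [add_assoc, ← add_smul, this, zero_smul, add_zero]

/-- A partition of `E \ {0}` into measurable cones of aperture `h`. -/
structure IsConePartition (h : ℝ) {N : ℕ} (e : Fin N → E) (S : Fin N → Set E) : Prop where
  norm_eq_one : ∀ ν, ‖e ν‖ = 1
  measurableSet : ∀ ν, MeasurableSet (S ν)
  disjoint : Pairwise fun μ ν => Disjoint (S μ) (S ν)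
  exists_mem : ∀ z, z ≠ 0 → ∃ ν, z ∈ S ν
  smul_mem : ∀ ν, ∀ r : ℝ, 0 < r → ∀ z, r • z ∈ S ν ↔ z ∈ S ν
  norm_sub_le : ∀ ν, ∀ z ∈ S ν, ‖‖z‖⁻¹ • z - e ν‖ ≤ h

lemma card_separated_sphere_le [Nontrivial E] {h : ℝ} (hh : 0 < h) (hh1 : h ≤ 1) (D : Finset E)
    (hD : ∀ x ∈ D, ‖x‖ = 1) (hsep : ∀ x ∈ D, ∀ y ∈ D, x ≠ y → h < dist x y) :
    (D.card : ℝ) * h ^ (finrank ℝ E - 1) ≤ finrank ℝ E * 4 ^ finrank ℝ E := by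
  have hn : 0 < finrank ℝ E := finrank_pos
  set n := finrank ℝ E with hn'
  set B := volume.real (ball (0 : E) 1) with hB
  have hBpos : 0 < B := ENNReal.toReal_pos (measure_ball_pos _ _ one_pos).ne' measure_ball_lt_top.ne
  have hball : ∀ x : E, ∀ s : ℝ, 0 ≤ s → volume.real (ball x s) = s ^ n * B := fun x s hs => by
    rw [Measure.real, Measure.addHaar_ball _ _ hs, ENNReal.toReal_mul,
      ENNReal.toReal_ofReal (by positivity), hB, Measure.real]
  have h1 : volume.real (⋃ x ∈ D, ball x (h / 2)) = D.card * ((h / 2) ^ n * B) := by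
    rw [measureReal_biUnion_finset]
    · rw [Finset.sum_congr rfl fun x _ => hball x (h / 2) (by positivity)]
      simp
    · intro x hx y hy hxy
      exact ball_disjoint_ball (by linarith [hsep x hx y hy hxy])
    · exact fun x _ => measurableSet_ball
  have h2 : volume.real (⋃ x ∈ D, ball x (h / 2)) ≤
      volume.real (ball (0 : E) (1 + h / 2) \ ball 0 (1 - h / 2)) := by
    refine measureReal_mono ?_ ((measure_mono Set.sdiff_subset).trans_lt measure_ball_lt_top).ne
    simp only [Set.iUnion_subset_iff]
    intro x hx y hy
    rw [mem_ball, dist_eq_norm] at hy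
    have h3 := abs_norm_sub_norm_le y x
    rw [hD x hx, abs_le] at h3
    simp only [Set.mem_sdiff, mem_ball_zero_iff]
    constructor <;> linarith
  rw [measureReal_sdiff (ball_subset_ball (by linarith)) measurableSet_ball measure_ball_lt_top.ne,
    hball _ _ (by linarith), hball _ _ (by linarith), h1, ← sub_mul, ← mul_assoc] at h2
  have h4 := le_of_mul_le_mul_right h2 hBpos
  have h5 := (le_abs_self _).trans (abs_pow_sub_pow_le (1 + h / 2) (1 - h / 2) n)
  rw [abs_of_nonneg (by linarith : (0:ℝ) ≤ 1 + h / 2 - (1 - h / 2)),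
    abs_of_nonneg (by linarith : (0:ℝ) ≤ 1 + h / 2), abs_of_nonneg (by linarith : (0:ℝ) ≤ 1 - h/2),
    max_eq_left (by linarith)] at h5
  have h6 : (1 + h / 2) ^ (n - 1) ≤ 2 ^ n :=
    (pow_le_pow_left₀ (by positivity) (by linarith) _).trans (pow_le_pow_right₀ (by norm_num) (by lia))
  have h7 : (D.card : ℝ) * (h / 2) ^ n ≤ h * n * 2 ^ n := by
    refine (h4.trans h5).trans ?_
    have : 1 + h / 2 - (1 - h / 2) = h := by ring
    rw [this]
    gcongr
  obtain ⟨m, hm⟩ := Nat.exists_eq_succ_of_ne_zero hn.ne'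
  rw [hm] at h7 ⊢
  rw [div_pow, Nat.succ_eq_add_one, mul_div_assoc', div_le_iff₀ (by positivity)] at h7
  have h8 : h * (D.card * h ^ m) ≤ h * (((m + 1 : ℕ) : ℝ) * 4 ^ (m + 1)) := by
    calc h * (D.card * h ^ m) = D.card * h ^ (m + 1) := by ring
      _ ≤ _ := h7
      _ = h * (((m + 1 : ℕ) : ℝ) * (2 ^ (m + 1) * 2 ^ (m + 1))) := by ring
      _ = _ := by rw [← mul_pow]; norm_num
  simpa using le_of_mul_le_mul_left h8 hh

lemma exists_isConePartition [Nontrivial E] {h : ℝ} (hh : 0 < h) (hh1 : h ≤ 1) :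
    ∃ (N : ℕ) (e : Fin N → E) (S : Fin N → Set E), IsConePartition h e S ∧
      (N : ℝ) * h ^ (finrank ℝ E - 1) ≤ finrank ℝ E * 4 ^ finrank ℝ E := by
  obtain ⟨D, hD, hsep, hcov⟩ : ∃ D : Finset E, (∀ x ∈ D, ‖x‖ = 1) ∧
      (∀ x ∈ D, ∀ y ∈ D, x ≠ y → h < dist x y) ∧ ∀ z : E, ‖z‖ = 1 → ∃ x ∈ D, ‖z - x‖ ≤ h := by
    lift h to NNReal using hh.le
    have hcomp : IsCompact (sphere (0 : E) 1) := isCompact_sphere _ _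
    have hfin : packingNumber h (sphere (0 : E) 1) ≠ ⊤ := by
      obtain ⟨N, -, hN, hN'⟩ := exists_finite_isCover_of_isCompact (ε := h / 2)
        (by have : h ≠ 0 := by exact_mod_cast hh.ne'
            positivity) hcomp
      have h1 := packingNumber_two_mul_le_externalCoveringNumber (h / 2) (sphere (0 : E) 1)
      rw [mul_div_cancel₀ _ (by norm_num)] at h1
      exact ((h1.trans hN'.externalCoveringNumber_le_encard).trans_lt
        (Set.encard_lt_top_iff.2 hN)).ne
    have hDf : (maximalSeparatedSet h (sphere (0 : E) 1)).Finite := by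
      rw [← Set.encard_lt_top_iff, encard_maximalSeparatedSet hfin]
      exact lt_top_iff_ne_top.2 hfin
    refine ⟨hDf.toFinset, ?_, ?_, ?_⟩
    · intro x hx
      simpa using maximalSeparatedSet_subset (hDf.mem_toFinset.1 hx)
    · intro x hx y hy hxy
      have := isSeparated_maximalSeparatedSet (hDf.mem_toFinset.1 hx) (hDf.mem_toFinset.1 hy) hxy
      simp only [edist_nndist] at this
      exact_mod_cast this
    · intro z hz
      have := isCover_iff_subset_iUnion_closedBall.1 (isCover_maximalSeparatedSet hfin)
        (show z ∈ sphere (0 : E) 1 by simpa using hz)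
      simp only [Set.mem_iUnion, mem_closedBall, dist_eq_norm] at this
      obtain ⟨x, hx, hx'⟩ := this
      exact ⟨x, hDf.mem_toFinset.2 hx, hx'⟩
  let e : Fin D.card → E := fun i => (D.equivFin.symm i : E)
  let U : Fin D.card → Set E := fun i => {z | z ≠ 0 ∧ ‖‖z‖⁻¹ • z - e i‖ ≤ h}
  have hUm : ∀ i, MeasurableSet (U i) := fun i => by
    apply MeasurableSet.inter
    · exact (measurableSet_singleton (0 : E)).compl
    · exact measurableSet_le (f := fun z : E => ‖‖z‖⁻¹ • z - e i‖) (by fun_prop) measurable_const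
  have hUs : ∀ i, ∀ r : ℝ, 0 < r → ∀ z, r • z ∈ U i ↔ z ∈ U i := by
    intro i r hr z
    simp only [U, Set.mem_ofPred_eq, ne_eq, smul_eq_zero, hr.ne', false_or, norm_smul, smul_smul,
      Real.norm_eq_abs, abs_of_pos hr]
    rw [show (r * ‖z‖)⁻¹ * r = ‖z‖⁻¹ by rw [mul_inv_rev, mul_assoc, inv_mul_cancel₀ hr.ne', mul_one]]
  refine ⟨D.card, e, fun i => U i \ ⋃ j, ⋃ (_ : j < i), U j, ⟨?_, ?_, ?_, ?_, ?_, ?_⟩,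
    card_separated_sphere_le hh hh1 D hD hsep⟩
  · exact fun i => hD _ (D.equivFin.symm i).2
  · exact fun i => (hUm i).diff (.iUnion fun j => .iUnion fun _ => hUm j)
  · intro i j hij
    rw [Set.disjoint_left]
    rintro z ⟨h1, h2⟩ ⟨h3, h4⟩
    simp only [Set.mem_iUnion, not_exists] at h2 h4
    rcases lt_or_gt_of_ne hij with h | h
    · exact h4 i h h1
    · exact h2 j h h3
  · intro z hz
    obtain ⟨x, hx, hx'⟩ := hcov (‖z‖⁻¹ • z) (by
      rw [norm_smul, norm_inv, norm_norm, inv_mul_cancel₀ (norm_ne_zero_iff.2 hz)])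
    have hne : ∃ i, z ∈ U i := ⟨D.equivFin ⟨x, hx⟩, hz, by simpa [e] using hx'⟩
    let Z : Finset (Fin D.card) := by classical exact Finset.univ.filter fun i => z ∈ U i
    have hZ : ∀ i, i ∈ Z ↔ z ∈ U i := fun i => by simp [Z]
    have hZn : Z.Nonempty := hne.imp fun i hi => (hZ i).2 hi
    refine ⟨Z.min' hZn, (hZ _).1 (Z.min'_mem hZn), ?_⟩
    simp only [Set.mem_iUnion, not_exists]
    intro j hj hj'
    exact absurd (Z.min'_le j ((hZ j).2 hj')) (not_le.2 hj)
  · intro i r hr z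
    simp only [Set.mem_sdiff, Set.mem_iUnion, hUs _ r hr]
  · exact fun i z hz => hz.1.2

lemma sum_volume_real_cone_le {h : ℝ} {N : ℕ} {e : Fin N → E} {S : Fin N → Set E}
    (hS : IsConePartition h e S) {s : Set E} (hs : MeasurableSet s) (hs' : volume s ≠ ⊤) :
    ∑ ν, volume.real (S ν ∩ s) ≤ volume.real s := by
  rw [← measureReal_biUnion_finset (fun μ _ ν _ hμν =>
      (hS.disjoint hμν).mono Set.inter_subset_left Set.inter_subset_left)
    (fun ν _ => (hS.measurableSet ν).inter hs)
    (fun ν _ => ((measure_mono Set.inter_subset_right).trans_lt hs'.lt_top).ne)]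
  exact measureReal_mono (by simp) hs'

/-- The multipliers of the stretched directions overlap little. -/
lemma sum_sq_mul_volume_cone_le [Nontrivial E] {t : ℝ} (ht : 0 < t) (ht1 : t ≤ 1)
    {N : ℕ} {e : Fin N → E} {S : Fin N → Set E} (hS : IsConePartition (t ^ 4) e S) (ξ : E) :
    ∑ ν, (‖ξ‖ ^ 2 / ‖stretch (e ν) (t ^ 2)⁻¹ ξ‖ ^ 2) ^ 2 * volume.real (S ν ∩ closedBall 0 2) ≤
      (10 * 4 ^ finrank ℝ E * volume.real (ball (0 : E) 1)) * t := by
  set B := volume.real (ball (0 : E) 1) with hB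
  set n := finrank ℝ E with hn
  have hB0 : 0 ≤ B := measureReal_nonneg
  rcases eq_or_ne ξ 0 with rfl | hξ
  · refine (Finset.sum_eq_zero fun ν _ => ?_).trans_le (by positivity)
    simp
  have hξ' : 0 < ‖ξ‖ := norm_pos_iff.2 hξ
  set ω := ‖ξ‖⁻¹ • ξ with hω
  have hω1 : ‖ω‖ = 1 := by
    rw [hω, norm_smul, norm_inv, norm_norm, inv_mul_cancel₀ hξ'.ne']
  set Z : Set E := {x : E | ‖x‖ ≤ 2 ∧ |⟪ω, x⟫| ≤ t * 2} with hZ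
  have hZm : MeasurableSet Z := by
    apply MeasurableSet.inter
    · exact measurableSet_le (f := fun x : E => ‖x‖) (by fun_prop) measurable_const
    · exact measurableSet_le (f := fun x : E => |⟪ω, x⟫|) (by fun_prop) measurable_const
  have hZsub : Z ⊆ closedBall 0 2 := fun x hx => by simpa using hx.1
  have hZfin : volume Z ≠ ⊤ := ((measure_mono hZsub).trans_lt measure_closedBall_lt_top).ne
  have key : ∀ ν, (‖ξ‖ ^ 2 / ‖stretch (e ν) (t ^ 2)⁻¹ ξ‖ ^ 2) ^ 2 *
      volume.real (S ν ∩ closedBall 0 2) ≤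
      volume.real (S ν ∩ Z) + 4 * t * volume.real (S ν ∩ closedBall 0 2) := by
    intro ν
    have hp0 : 0 ≤ ‖ξ‖ ^ 2 / ‖stretch (e ν) (t ^ 2)⁻¹ ξ‖ ^ 2 := by positivity
    have hD := norm_stretch_sq (hS.norm_eq_one ν) (t ^ 2)⁻¹ ξ
    have hK : 0 ≤ ((t ^ 2)⁻¹ ^ 2 + 2 * (t ^ 2)⁻¹) := by positivity
    have hDpos : 0 < ‖stretch (e ν) (t ^ 2)⁻¹ ξ‖ ^ 2 := by rw [hD]; positivity
    have hp1 : ‖ξ‖ ^ 2 / ‖stretch (e ν) (t ^ 2)⁻¹ ξ‖ ^ 2 ≤ 1 := by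
      rw [div_le_one hDpos, hD]
      nlinarith [mul_nonneg hK (sq_nonneg ⟪e ν, ξ⟫)]
    have hσ : 0 ≤ volume.real (S ν ∩ closedBall 0 2) := measureReal_nonneg
    by_cases hsub : S ν ∩ closedBall 0 2 ⊆ S ν ∩ Z
    · have h1 : volume.real (S ν ∩ closedBall 0 2) ≤ volume.real (S ν ∩ Z) :=
        measureReal_mono hsub ((measure_mono Set.inter_subset_right).trans_lt hZfin.lt_top).ne
      have h2 : (‖ξ‖ ^ 2 / ‖stretch (e ν) (t ^ 2)⁻¹ ξ‖ ^ 2) ^ 2 ≤ 1 := pow_le_one₀ hp0 hp1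
      nlinarith [mul_nonneg ht.le hσ]
    · rw [Set.not_subset] at hsub
      obtain ⟨z, ⟨hz, hz2⟩, hz3⟩ := hsub
      rw [mem_closedBall_zero_iff] at hz2
      have hz4 : t * 2 < |⟪ω, z⟫| := by
        by_contra hcon
        exact hz3 ⟨hz, hz2, not_lt.1 hcon⟩
      have hz0 : 0 < ‖z‖ := by
        rw [norm_pos_iff]
        rintro rfl
        simp at hz4
        linarith
      set θ := ‖z‖⁻¹ • z with hθ
      have h1 : t * ‖ξ‖ ≤ |⟪θ, ξ⟫| := by
        rw [hθ, inner_smul_left, abs_mul, conj_trivial, abs_of_pos (inv_pos.2 hz0),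
          le_inv_mul_iff₀ hz0]
        rw [hω, inner_smul_left, abs_mul, conj_trivial, abs_of_pos (inv_pos.2 hξ'),
          lt_inv_mul_iff₀ hξ', real_inner_comm] at hz4
        nlinarith [mul_pos ht hξ']
      have h2 : |⟪θ, ξ⟫| ≤ |⟪e ν, ξ⟫| + t ^ 4 * ‖ξ‖ := by
        have h3 : ⟪θ, ξ⟫ = ⟪e ν, ξ⟫ + ⟪θ - e ν, ξ⟫ := by rw [inner_sub_left]; ring
        rw [h3]
        refine (abs_add_le _ _).trans ?_
        gcongr
        exact (abs_real_inner_le_norm _ _).trans (by gcongr; exact hS.norm_sub_le ν z hz)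
      have h3 : t ^ 2 * ‖ξ‖ ^ 2 ≤ 2 * ⟪e ν, ξ⟫ ^ 2 + 2 * (t ^ 8 * ‖ξ‖ ^ 2) := by
        have h4 : (t * ‖ξ‖) ^ 2 ≤ (|⟪e ν, ξ⟫| + t ^ 4 * ‖ξ‖) ^ 2 :=
          pow_le_pow_left₀ (by positivity) (h1.trans h2) 2
        nlinarith [sq_nonneg (|⟪e ν, ξ⟫| - t ^ 4 * ‖ξ‖), sq_abs ⟪e ν, ξ⟫]
      have h4 : ‖ξ‖ ^ 2 / ‖stretch (e ν) (t ^ 2)⁻¹ ξ‖ ^ 2 ≤ 2 * t ^ 2 := by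
        rw [div_le_iff₀ hDpos, hD]
        have h5 : t ^ 2 * ((t ^ 2)⁻¹ ^ 2 + 2 * (t ^ 2)⁻¹) * ⟪e ν, ξ⟫ ^ 2 ≥
            (t ^ 2)⁻¹ * ⟪e ν, ξ⟫ ^ 2 := by
          have : t ^ 2 * ((t ^ 2)⁻¹ ^ 2 + 2 * (t ^ 2)⁻¹) = (t ^ 2)⁻¹ + 2 := by
            field_simp
          rw [this]
          nlinarith [sq_nonneg ⟪e ν, ξ⟫]
        have h6 : ‖ξ‖ ^ 2 ≤ (t ^ 2)⁻¹ * (2 * ⟪e ν, ξ⟫ ^ 2 + 2 * (t ^ 8 * ‖ξ‖ ^ 2)) := by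
          rw [le_inv_mul_iff₀ (by positivity)]
          exact h3
        have h7 : (t ^ 2)⁻¹ * (2 * (t ^ 8 * ‖ξ‖ ^ 2)) = 2 * t ^ 2 * (t ^ 4 * ‖ξ‖ ^ 2) := by
          field_simp
        have h8 : t ^ 4 ≤ 1 := pow_le_one₀ ht.le ht1
        have h9 : 2 * t ^ 2 * (t ^ 4 * ‖ξ‖ ^ 2) ≤ 2 * t ^ 2 * (1 * ‖ξ‖ ^ 2) := by gcongr
        nlinarith
      have h5 : (‖ξ‖ ^ 2 / ‖stretch (e ν) (t ^ 2)⁻¹ ξ‖ ^ 2) ^ 2 ≤ 4 * t := by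
        refine (pow_le_pow_left₀ hp0 h4 2).trans ?_
        have : t ^ 4 ≤ t := by
          simpa using pow_le_pow_of_le_one ht.le ht1 (show 1 ≤ 4 by norm_num)
        nlinarith
      have h6 : 0 ≤ volume.real (S ν ∩ Z) := measureReal_nonneg
      nlinarith [mul_le_mul_of_nonneg_right h5 hσ]
  refine (Finset.sum_le_sum fun ν _ => key ν).trans ?_
  rw [Finset.sum_add_distrib, ← Finset.mul_sum]
  have h1 := sum_volume_real_cone_le hS hZm hZfin
  have h2 := sum_volume_real_cone_le hS (s := closedBall (0 : E) 2) measurableSet_closedBall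
    measure_closedBall_lt_top.ne
  rw [volume_real_closedBall_le _ (by norm_num), ← hB, ← hn] at h2
  have h3 := volume_real_band_le hω1 ht (ρ := 2) (by norm_num)
  rw [← hB, ← hn, ← hZ] at h3
  have h4 : (2 : ℝ) ^ n ≤ 4 ^ n := pow_le_pow_left₀ (by norm_num) (by norm_num) _
  have h5 : 4 * t * ∑ ν, volume.real (S ν ∩ closedBall 0 2) ≤ 4 * t * (4 ^ n * B) := by
    gcongr
    exact h2.trans (by gcongr)
  have h6 : t * ((2 * 2) ^ n * B) = t * (4 ^ n * B) := by norm_num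
  have h7 : 0 ≤ t * (4 ^ n * B) := by positivity
  linarith

end Geometry

section KernelOperators

open Module
open scoped RealInnerProductSpace FourierTransform Pointwise

variable {E : Type*} [NormedAddCommGroup E] [InnerProductSpace ℝ E] [FiniteDimensional ℝ E]
  [MeasurableSpace E] [BorelSpace E]

theorem norm_translateAvg_le {Y : Type*} [MeasurableSpace Y] {μ : Measure Y} {v : Y → E}
    {w : Y → ℂ} {f : E → ℂ} (hw : Integrable w μ) {K : ℝ} (hf : ∀ x, ‖f x‖ ≤ K) (x : E) :
    ‖translateAvg μ w v f x‖ ≤ (∫ y, ‖w y‖ ∂μ) * K := by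
  unfold translateAvg
  rw [← integral_mul_const]
  refine norm_integral_le_of_norm_le (hw.norm.mul_const _) (ae_of_all _ fun y => ?_)
  rw [norm_mul]
  gcongr
  exact hf _

/-- The integral operator whose kernel at `(x, y)` is `κ (x - y) y`. -/
def kernelOp (κ : E → E → ℝ) (b : E → ℂ) (x : E) : ℂ :=
  ∫ z, (κ z (x - z) : ℂ) * b (x - z)

section

variable {κ : E → E → ℝ} {b : E → ℂ} {K : E → ℝ}

theorem integrable_kernelOp_prod (hκ : Measurable fun p : E × E => κ p.1 p.2) (hb : Integrable b)
    (hK : Integrable K) (hκK : ∀ z y, b y ≠ 0 → |κ z y| ≤ K z) :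
    Integrable (fun p : E × E => (κ p.1 p.2 : ℂ) * b p.2) (volume.prod volume) := by
  refine (hK.ofReal (𝕜 := ℂ) |>.mul_prod hb).mono ?_ (ae_of_all _ fun p => ?_)
  · exact (Complex.measurable_ofReal.comp hκ).aestronglyMeasurable.mul
      hb.aestronglyMeasurable.comp_snd
  · rw [norm_mul, norm_mul]
    by_cases h : b p.2 = 0
    · simp [h]
    gcongr
    simp only [Complex.norm_real, Real.norm_eq_abs, Complex.coe_algebraMap]
    exact (hκK _ _ h).trans (le_abs_self _)

theorem integrable_kernelOp (hκ : Measurable fun p : E × E => κ p.1 p.2) (hb : Integrable b)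
    (hK : Integrable K) (hκK : ∀ z y, b y ≠ 0 → |κ z y| ≤ K z) : Integrable (kernelOp κ b) :=
  integrable_superposition (v := fun z : E => z) measurable_id
    (Ψ := fun z y => (κ z y : ℂ) * b y) (integrable_kernelOp_prod hκ hb hK hκK)

theorem integral_norm_kernelOp_le (hκ : Measurable fun p : E × E => κ p.1 p.2) (hb : Integrable b)
    (hK : Integrable K) (hκK : ∀ z y, b y ≠ 0 → |κ z y| ≤ K z) :
    ∫ x, ‖kernelOp κ b x‖ ≤ (∫ z, K z) * ∫ x, ‖b x‖ := by
  have hp := integrable_kernelOp_prod hκ hb hK hκK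
  refine (integral_norm_superposition_le (v := fun z : E => z) measurable_id
    (Ψ := fun z y => (κ z y : ℂ) * b y) hp).trans ?_
  rw [← integral_mul_const]
  refine integral_mono hp.norm.integral_prod_left (hK.mul_const _) fun z => ?_
  simp only
  rw [← integral_const_mul]
  refine integral_mono_of_nonneg (ae_of_all _ fun _ => norm_nonneg _) (hb.norm.const_mul _)
    (ae_of_all _ fun y => ?_)
  by_cases h : b y = 0
  · simp [h]
  simp only [norm_mul, Complex.norm_real, Real.norm_eq_abs]
  gcongr
  exact hκK _ _ h

theorem norm_kernelOp_le (hb : Integrable b) {K₀ : ℝ}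
    (hκK : ∀ z y, b y ≠ 0 → |κ z y| ≤ K₀) (x : E) :
    ‖kernelOp κ b x‖ ≤ K₀ * ∫ y, ‖b y‖ := by
  have hb' : Integrable fun z => b (x - z) := hb.comp_sub_left x
  have h1 : ∫ z, K₀ * ‖b (x - z)‖ = K₀ * ∫ y, ‖b y‖ := by
    rw [integral_const_mul, integral_sub_left_eq_self (fun y => ‖b y‖)]
  rw [← h1]
  refine norm_integral_le_of_norm_le (hb'.norm.const_mul _) (ae_of_all _ fun z => ?_)
  by_cases h : b (x - z) = 0
  · simp [h]
  rw [norm_mul, Complex.norm_real, Real.norm_eq_abs]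
  gcongr
  exact hκK _ _ h

theorem fourier_kernelOp (hκ : Measurable fun p : E × E => κ p.1 p.2) (hb : Integrable b)
    (hK : Integrable K) (hκK : ∀ z y, b y ≠ 0 → |κ z y| ≤ K z) (ξ : E) :
    Integrable (fun y => 𝐞 (-⟪y, ξ⟫) • (b y * ∫ z, (𝐞 (-⟪z, ξ⟫) : ℂ) * κ z y)) ∧
    𝓕 (kernelOp κ b) ξ =
      ∫ y, 𝐞 (-⟪y, ξ⟫) • (b y * ∫ z, (𝐞 (-⟪z, ξ⟫) : ℂ) * κ z y) := by
  have hp := integrable_kernelOp_prod hκ hb hK hκK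
  have h1 := fourier_superposition (v := fun z : E => z) measurable_id
    (Ψ := fun z y => (κ z y : ℂ) * b y) hp ξ
  unfold kernelOp
  rw [h1]
  simp only [Real.fourier_eq]
  have hc1 : Continuous fun p : E × E => (𝐞 (-⟪p.1, ξ⟫) : ℂ) :=
    continuous_subtype_val.comp (Real.continuous_fourierChar.comp (by fun_prop))
  have hc2 : Continuous fun p : E × E => (𝐞 (-⟪p.2, ξ⟫) : ℂ) :=
    continuous_subtype_val.comp (Real.continuous_fourierChar.comp (by fun_prop))
  have hint : Integrable (fun p : E × E => (𝐞 (-⟪p.1, ξ⟫) : ℂ) *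
      ((𝐞 (-⟪p.2, ξ⟫) : ℂ) * ((κ p.1 p.2 : ℂ) * b p.2))) (volume.prod volume) := by
    refine hp.norm.mono' (hc1.aestronglyMeasurable.mul (hc2.aestronglyMeasurable.mul
      hp.aestronglyMeasurable)) (ae_of_all _ fun p => ?_)
    rw [norm_mul, norm_mul, Circle.norm_coe, Circle.norm_coe, one_mul, one_mul]
  have hswap : ∀ y, ∫ z, (𝐞 (-⟪z, ξ⟫) : ℂ) * ((𝐞 (-⟪y, ξ⟫) : ℂ) * ((κ z y : ℂ) * b y)) =
      𝐞 (-⟪y, ξ⟫) • (b y * ∫ z, (𝐞 (-⟪z, ξ⟫) : ℂ) * κ z y) := fun y => by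
    rw [Circle.smul_def, smul_eq_mul, ← mul_assoc, ← integral_const_mul]
    congr 1 with z
    ring
  refine ⟨hint.integral_prod_right.congr (ae_of_all _ hswap), ?_⟩
  calc ∫ z, 𝐞 (-⟪z, ξ⟫) • ∫ y, 𝐞 (-⟪y, ξ⟫) • ((κ z y : ℂ) * b y)
      = ∫ z, ∫ y, (𝐞 (-⟪z, ξ⟫) : ℂ) * ((𝐞 (-⟪y, ξ⟫) : ℂ) * ((κ z y : ℂ) * b y)) := by
        congr 1 with z
        rw [Circle.smul_def, smul_eq_mul, ← integral_const_mul]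
        rfl
    _ = ∫ y, ∫ z, (𝐞 (-⟪z, ξ⟫) : ℂ) * ((𝐞 (-⟪y, ξ⟫) : ℂ) * ((κ z y : ℂ) * b y)) :=
        integral_integral_swap hint
    _ = _ := integral_congr_ae (ae_of_all _ hswap)

theorem kernelOp_ne_zero {x : E} (h : kernelOp κ b x ≠ 0) : ∃ z, κ z (x - z) ≠ 0 ∧ b (x - z) ≠ 0 := by
  by_contra! hcon
  refine h ?_
  unfold kernelOp
  rw [integral_congr_ae (g := fun _ => 0), integral_zero]
  refine ae_of_all _ fun z => ?_
  by_cases hz : κ z (x - z) = 0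
  · simp [hz]
  · simp [hcon z hz]

end

/-- The indicator of the truncated cone `S ∩ {‖z‖ ≤ 2 R}`. -/
def coneInd (S : Set E) (R : ℝ) : E → ℝ := (S ∩ closedBall 0 (2 * R)).indicator 1

theorem coneInd_nonneg (S : Set E) (R : ℝ) (z : E) : 0 ≤ coneInd S R z :=
  Set.indicator_nonneg (fun _ _ => zero_le_one) _

theorem coneInd_le_one (S : Set E) (R : ℝ) (z : E) : coneInd S R z ≤ 1 :=
  Set.indicator_le_self' (fun _ _ => zero_le_one) _

theorem coneInd_of_mem {S : Set E} {R : ℝ} {z : E} (hz : z ∈ S) (hz' : ‖z‖ ≤ 2 * R) :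
    coneInd S R z = 1 := by
  have h : z ∈ S ∩ closedBall 0 (2 * R) := ⟨hz, mem_closedBall_zero_iff.2 hz'⟩
  rw [coneInd, Set.indicator_of_mem h, Pi.one_apply]

theorem integrable_coneInd {S : Set E} (hS : MeasurableSet S) (R : ℝ) :
    Integrable (coneInd S R) :=
  (integrable_indicator_iff (hS.inter measurableSet_closedBall)).2
    (integrableOn_const
      ((measure_mono Set.inter_subset_right).trans_lt measure_closedBall_lt_top).ne)

theorem integral_coneInd {S : Set E} (hS : MeasurableSet S)
    (hom : ∀ r : ℝ, 0 < r → ∀ z, r • z ∈ S ↔ z ∈ S) {R : ℝ} (hR : 0 < R) :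
    ∫ z, coneInd S R z = R ^ finrank ℝ E * volume.real (S ∩ closedBall 0 2) := by
  unfold coneInd
  rw [integral_indicator_one (hS.inter measurableSet_closedBall)]
  have : S ∩ closedBall 0 (2 * R) = R • (S ∩ closedBall 0 2) := by
    ext z
    rw [Set.mem_smul_set_iff_inv_smul_mem₀ hR.ne']
    simp only [Set.mem_inter_iff, mem_closedBall_zero_iff, norm_smul, norm_inv, Real.norm_eq_abs,
      abs_of_pos hR, hom R⁻¹ (inv_pos.2 hR), inv_mul_le_iff₀ hR, mul_comm R 2]
  rw [this, Measure.real, Measure.addHaar_smul, ENNReal.toReal_mul,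
    ENNReal.toReal_ofReal (abs_nonneg _), abs_of_pos (by positivity), Measure.real]

end KernelOperators

section Pieces

open Module
open scoped RealInnerProductSpace FourierTransform

variable {E : Type*} [NormedAddCommGroup E] [InnerProductSpace ℝ E] [FiniteDimensional ℝ E]
  [MeasurableSpace E] [BorelSpace E]

/-- The commutator kernel `ω(z) c(z) |z| g(z) (A(y + z) - A(y))`. -/
def pieceKer (ω g A c : E → ℝ) (z y : E) : ℝ := ω z * c z * ‖z‖ * g z * (A (y + z) - A y)

/-- The kernel produced by integrating by parts with Euler's identity. -/
def eulerKer (ω g A : E → ℝ) (z y : E) : ℝ :=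
  ω z * (finrank ℝ E * (g z * (A (y + z) - A y)) + fderiv ℝ g z z * (A (y + z) - A y) +
    g z * fderiv ℝ A (y + z) z)

/-- The kernel factors of a piece of the commutator at scale `R` localised to the cone `S`. -/
structure IsConeKernel (t R : ℝ) (L : NNReal) (W D : ℝ) (e : E) (S : Set E) (ω g A : E → ℝ) :
    Prop where
  t_pos : 0 < t
  t_le_one : t ≤ 1
  R_pos : 0 < R
  norm_e : ‖e‖ = 1
  measurableSet : MeasurableSet S
  smul_mem : ∀ r : ℝ, 0 < r → ∀ z, r • z ∈ S ↔ z ∈ S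
  norm_sub_le : ∀ z ∈ S, ‖‖z‖⁻¹ • z - e‖ ≤ t ^ 4
  measurable_ω : Measurable ω
  abs_ω_le : ∀ z, |ω z| ≤ W
  ω_smul : ∀ r : ℝ, 0 < r → ∀ z, z ≠ 0 → ω (r • z) = ω z
  mem_of_ω_ne_zero : ∀ z, ω z ≠ 0 → z ∈ S
  contDiff_g : ContDiff ℝ 1 g
  norm_le_of_g_ne_zero : ∀ z, g z ≠ 0 → ‖z‖ ≤ 2 * R
  abs_g_le : ∀ z, |g z| ≤ D / R ^ (finrank ℝ E + 2)
  norm_fderiv_g_le : ∀ z, ‖fderiv ℝ g z‖ ≤ D / R ^ (finrank ℝ E + 3)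
  lipschitz_A : LipschitzWith L A

namespace IsConeKernel

variable {t R : ℝ} {L : NNReal} {W D : ℝ} {e : E} {S : Set E} {ω g A : E → ℝ}

theorem W_nonneg (h : IsConeKernel t R L W D e S ω g A) : 0 ≤ W :=
  (abs_nonneg _).trans (h.abs_ω_le 0)

theorem D_nonneg (h : IsConeKernel t R L W D e S ω g A) : 0 ≤ D := by
  have h1 := (abs_nonneg _).trans (h.abs_g_le 0)
  have := h.R_pos
  by_contra hcon
  have h2 : D / R ^ (finrank ℝ E + 2) < 0 := div_neg_of_neg_of_pos (not_le.1 hcon) (by positivity)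
  linarith

theorem measurable_pieceKer (h : IsConeKernel t R L W D e S ω g A) {c : E → ℝ}
    (hc : Measurable c) : Measurable fun p : E × E => pieceKer ω g A c p.1 p.2 := by
  have hA := h.lipschitz_A.continuous.measurable
  have hg := h.contDiff_g.continuous.measurable
  have hω := h.measurable_ω
  unfold pieceKer
  fun_prop

theorem measurable_eulerKer (h : IsConeKernel t R L W D e S ω g A) :
    Measurable fun p : E × E => eulerKer ω g A p.1 p.2 := by
  have hA := h.lipschitz_A.continuous.measurable
  have hg := h.contDiff_g.continuous.measurable
  have hω := h.measurable_ω
  have h1 : Measurable fun p : E × E => fderiv ℝ g p.1 p.1 :=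
    ContinuousLinearMap.measurable_apply₂.comp
      (((measurable_fderiv ℝ g).comp measurable_fst).prodMk measurable_fst)
  have h2 : Measurable fun p : E × E => fderiv ℝ A (p.2 + p.1) p.1 :=
    ContinuousLinearMap.measurable_apply₂.comp
      (((measurable_fderiv ℝ A).comp (measurable_snd.add measurable_fst)).prodMk measurable_fst)
  unfold eulerKer
  fun_prop

theorem abs_sub_le (h : IsConeKernel t R L W D e S ω g A) (x y : E) :
    |A x - A y| ≤ L * ‖x - y‖ := by
  simpa [dist_eq_norm, Real.dist_eq] using h.lipschitz_A.dist_le_mul x y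

theorem abs_kernel_le (h : IsConeKernel t R L W D e S ω g A) {c : E → ℝ} {c₀ : ℝ}
    (hc₀ : 0 ≤ c₀) (hc : ∀ z ∈ S, |c z| ≤ c₀) {a m : ℝ} (z : E) (hm : 0 ≤ m)
    (ha : ‖z‖ ≤ 2 * R → |a| ≤ m) :
    |ω z * c z * ‖z‖ * g z * a| ≤
      2 * c₀ * (W * D * m / R ^ (finrank ℝ E + 1)) * coneInd S R z := by
  have hW := h.W_nonneg
  have hD := h.D_nonneg
  have hR := h.R_pos
  have hrhs : 0 ≤ 2 * c₀ * (W * D * m / R ^ (finrank ℝ E + 1)) * coneInd S R z :=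
    mul_nonneg (by positivity) (coneInd_nonneg _ _ _)
  by_cases hω : ω z = 0
  · simpa [hω] using hrhs
  by_cases hg : g z = 0
  · simpa [hg] using hrhs
  have hz := h.mem_of_ω_ne_zero z hω
  have hz2 := h.norm_le_of_g_ne_zero z hg
  rw [coneInd_of_mem hz hz2, abs_mul, abs_mul, abs_mul, abs_mul, abs_norm]
  calc |ω z| * |c z| * ‖z‖ * |g z| * |a|
      ≤ W * c₀ * (2 * R) * (D / R ^ (finrank ℝ E + 2)) * m := by
        gcongr
        · exact h.abs_ω_le z
        · exact hc z hz
        · exact h.abs_g_le z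
        · exact ha hz2
    _ = _ := by
        field_simp
        ring

theorem abs_pieceKer_le (h : IsConeKernel t R L W D e S ω g A) {c : E → ℝ} {c₀ : ℝ}
    (hc₀ : 0 ≤ c₀) (hc : ∀ z ∈ S, |c z| ≤ c₀) (z y : E) :
    |pieceKer ω g A c z y| ≤ 4 * c₀ * (W * D * L / R ^ finrank ℝ E) * coneInd S R z := by
  have hR := h.R_pos
  refine (h.abs_kernel_le hc₀ hc (m := L * (2 * R)) z (by positivity) fun hz => ?_).trans_eq ?_
  · refine (h.abs_sub_le _ _).trans ?_
    rw [add_sub_cancel_left]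
    gcongr
  · congr 1
    field_simp
    ring

theorem abs_eulerKer_le (h : IsConeKernel t R L W D e S ω g A) (z y : E) :
    |eulerKer ω g A z y| ≤
      (2 * finrank ℝ E + 6) * (W * D * L / R ^ (finrank ℝ E + 1)) * coneInd S R z := by
  have hW := h.W_nonneg
  have hD := h.D_nonneg
  have hR := h.R_pos
  set n := finrank ℝ E with hn
  have hrhs : 0 ≤ (2 * n + 6) * (W * D * L / R ^ (n + 1)) * coneInd S R z :=
    mul_nonneg (by positivity) (coneInd_nonneg _ _ _)
  by_cases hω : ω z = 0
  · simpa [eulerKer, hω] using hrhs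
  have hcl : closure (Function.support g) ⊆ closedBall 0 (2 * R) :=
    closure_minimal (fun x hx => mem_closedBall_zero_iff.2 (h.norm_le_of_g_ne_zero x hx))
      isClosed_closedBall
  by_cases hz2 : ‖z‖ ≤ 2 * R
  · have hz := h.mem_of_ω_ne_zero z hω
    rw [coneInd_of_mem hz hz2, eulerKer, abs_mul]
    have ha : |A (y + z) - A y| ≤ L * (2 * R) := by
      refine (h.abs_sub_le _ _).trans ?_
      rw [add_sub_cancel_left]
      gcongr
    have h1 : |fderiv ℝ g z z| ≤ D / R ^ (n + 3) * (2 * R) :=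
      ((fderiv ℝ g z).le_opNorm z).trans (by gcongr; exact h.norm_fderiv_g_le z)
    have h2 : |fderiv ℝ A (y + z) z| ≤ L * (2 * R) :=
      ((fderiv ℝ A (y + z)).le_opNorm z).trans
        (by gcongr; exact norm_fderiv_le_of_lipschitz ℝ h.lipschitz_A)
    have h3 : |(n : ℝ) * (g z * (A (y + z) - A y)) + fderiv ℝ g z z * (A (y + z) - A y) +
        g z * fderiv ℝ A (y + z) z| ≤ n * (D / R ^ (n + 2) * (L * (2 * R))) +
        D / R ^ (n + 3) * (2 * R) * (L * (2 * R)) + D / R ^ (n + 2) * (L * (2 * R)) := by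
      refine (abs_add_three _ _ _).trans ?_
      rw [abs_mul, abs_mul, abs_mul, abs_mul, Nat.abs_cast]
      gcongr <;> exact h.abs_g_le z
    calc _ ≤ W * (n * (D / R ^ (n + 2) * (L * (2 * R))) +
        D / R ^ (n + 3) * (2 * R) * (L * (2 * R)) + D / R ^ (n + 2) * (L * (2 * R))) := by
          gcongr
          exact h.abs_ω_le z
      _ = _ := by
          field_simp
          ring
  · have hzc : z ∉ closure (Function.support g) := fun hz =>
      hz2 (mem_closedBall_zero_iff.1 (hcl hz))
    have hg0 : g =ᶠ[𝓝 z] fun _ => 0 := by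
      filter_upwards [(isClosed_closure (s := Function.support g)).isOpen_compl.mem_nhds hzc]
        with x hx
      by_contra hcon
      exact hx (subset_closure hcon)
    have : eulerKer ω g A z y = 0 := by
      rw [eulerKer, hg0.fderiv_eq, hg0.eq_of_nhds]
      simp
    simpa [this] using hrhs

theorem integral_eulerKer [Nontrivial E] (h : IsConeKernel t R L W D e S ω g A) (ξ y : E) :
    ∫ z, (𝐞 (-⟪z, ξ⟫) : ℂ) * eulerKer ω g A z y =
      ∫ z, (𝐞 (-⟪z, ξ⟫) : ℂ) * (2 * Real.pi * Complex.I * ⟪z, ξ⟫ *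
        (ω z * g z * (A (y + z) - A y) : ℝ)) := by
  have hR := h.R_pos
  set χ : E → ℂ := fun z => (𝐞 (-⟪z, ξ⟫) : ℂ) with hχ
  have hχe : χ = fun z => Complex.exp (((-2 * Real.pi * ⟪z, ξ⟫ : ℝ) : ℂ) * Complex.I) := by
    ext z
    simp only [hχ, Real.fourierChar_apply]
    congr 2
    push_cast
    ring
  have hχd : ∀ z, HasFDerivAt χ (χ z • ((-(2 * Real.pi * Complex.I : ℂ)) •
      (Complex.ofRealCLM.comp ((innerSL ℝ ξ))))) z := by
    intro z
    have h1 : HasFDerivAt (fun z : E => ((-2 * Real.pi * ⟪z, ξ⟫ : ℝ) : ℂ) * Complex.I)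
        ((-(2 * Real.pi * Complex.I : ℂ)) • (Complex.ofRealCLM.comp ((innerSL ℝ ξ)))) z := by
      have h2 := (Complex.ofRealCLM.comp (innerSL ℝ ξ)).hasFDerivAt (x := z)
      have h3 := h2.const_mul (-(2 * Real.pi * Complex.I : ℂ))
      refine h3.congr_of_eventuallyEq (Eventually.of_forall fun x => ?_)
      simp [real_inner_comm]
      ring
    have := h1.cexp
    rw [hχe]
    exact this
  have hχc : ContDiff ℝ 1 χ := by
    rw [hχe]
    exact ((Complex.ofRealCLM.contDiff.comp
      (contDiff_const.mul (contDiff_id.inner ℝ contDiff_const))).mul contDiff_const).cexp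
  have hg : ContDiff ℝ 1 fun z => (g z : ℂ) * χ z :=
    (Complex.ofRealCLM.contDiff.comp h.contDiff_g).mul hχc
  have hsupp : ∀ z, (g z : ℂ) * χ z ≠ 0 → ‖z‖ ≤ 2 * R := fun z hz =>
    h.norm_le_of_g_ne_zero z (by simpa using left_ne_zero_of_mul hz)
  have ha : LipschitzWith L fun z => A (y + z) - A y := by
    refine LipschitzWith.of_dist_le_mul fun x z => ?_
    rw [dist_sub_right]
    simpa using h.lipschitz_A.dist_le_mul (y + x) (y + z)
  have key := integral_homogeneous_mul_euler_mul h.measurable_ω h.abs_ω_le h.ω_smul hg hsupp ha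
  have hfd : ∀ z, fderiv ℝ (fun z => (g z : ℂ) * χ z) z z =
      χ z * (fderiv ℝ g z z : ℝ) - χ z * (2 * Real.pi * Complex.I * ⟪z, ξ⟫ * g z) := by
    intro z
    have h1 : HasFDerivAt (fun z => (g z : ℂ)) (Complex.ofRealCLM.comp (fderiv ℝ g z)) z :=
      Complex.ofRealCLM.hasFDerivAt.comp z
        (h.contDiff_g.differentiable (by norm_num) z).hasFDerivAt
    rw [(show HasFDerivAt (fun z => (g z : ℂ) * χ z) _ z from h1.mul (hχd z)).fderiv]
    simp [real_inner_comm]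
    ring
  have hfa : ∀ z, fderiv ℝ (fun z => A (y + z) - A y) z z = fderiv ℝ A (y + z) z := by
    intro z
    rw [fderiv_sub_const, fderiv_comp_add_left]
  simp only [hfd, hfa] at key
  have hxm : Measurable χ := hχc.continuous.measurable
  have hx1 : ∀ z, ‖χ z‖ = 1 := fun z => Circle.norm_coe _
  have hi1 : Integrable fun z => χ z * eulerKer ω g A z y := by
    refine ((integrable_coneInd h.measurableSet R).const_mul
      ((2 * finrank ℝ E + 6) * (W * D * L / R ^ (finrank ℝ E + 1)))).mono' ?_
      (ae_of_all _ fun z => ?_)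
    · exact (hxm.mul (Complex.measurable_ofReal.comp (h.measurable_eulerKer.comp
        (measurable_id.prodMk measurable_const)))).aestronglyMeasurable
    · rw [norm_mul, hx1, one_mul, Complex.norm_real]
      exact h.abs_eulerKer_le z y
  have hi2 : Integrable fun z => χ z * (2 * Real.pi * Complex.I * ⟪z, ξ⟫ *
        (ω z * g z * (A (y + z) - A y) : ℝ)) := by
    have hA := h.lipschitz_A.continuous.measurable
    have hgm := h.contDiff_g.continuous.measurable
    have hω := h.measurable_ω
    refine ((integrable_coneInd h.measurableSet R).const_mul
      (2 * Real.pi * (‖ξ‖ * (4 * 1 * (W * D * L / R ^ finrank ℝ E))))).mono' ?_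
      (ae_of_all _ fun z => ?_)
    · refine (hxm.mul ?_).aestronglyMeasurable
      fun_prop
    · have h2 := h.abs_pieceKer_le (c := fun _ => 1) (c₀ := 1) zero_le_one (fun z _ => by simp) z y
      have h3 : |⟪z, ξ⟫| * |ω z * g z * (A (y + z) - A y)| ≤
          ‖ξ‖ * |pieceKer ω g A (fun _ => 1) z y| := by
        rw [pieceKer, ← abs_mul, ← abs_norm ξ, ← abs_mul]
        calc |⟪z, ξ⟫ * (ω z * g z * (A (y + z) - A y))|
            = |⟪z, ξ⟫| * |ω z * g z * (A (y + z) - A y)| := abs_mul _ _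
          _ ≤ (‖z‖ * ‖ξ‖) * |ω z * g z * (A (y + z) - A y)| := by
              gcongr
              exact abs_real_inner_le_norm _ _
          _ = _ := by
              rw [← abs_norm z, ← abs_norm ξ, ← abs_mul, ← abs_mul]
              simp only [abs_norm]
              congr 1
              ring
      calc _ = 2 * Real.pi * (|⟪z, ξ⟫| * |ω z * g z * (A (y + z) - A y)|) := by
            rw [norm_mul, hx1, one_mul, norm_mul, norm_mul, norm_mul, norm_mul,
              Complex.norm_real, Complex.norm_real, Complex.norm_real, Complex.norm_I]
            simp only [Real.norm_eq_abs, abs_of_pos Real.pi_pos, Complex.norm_ofNat]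
            ring
        _ ≤ 2 * Real.pi * (‖ξ‖ * |pieceKer ω g A (fun _ => 1) z y|) := by gcongr
        _ ≤ 2 * Real.pi * (‖ξ‖ * (4 * 1 * (W * D * L / R ^ finrank ℝ E) * coneInd S R z)) := by
            gcongr
        _ = 2 * Real.pi * (‖ξ‖ * (4 * 1 * (W * D * L / R ^ finrank ℝ E))) * coneInd S R z := by
            ring
  rw [← sub_eq_zero, ← integral_sub hi1 hi2, ← key]
  congr 1 with z
  simp only [eulerKer]
  push_cast
  ring

theorem inner_mul_fourier_kernelOp [Nontrivial E] {ι : Type*} [Fintype ι]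
    (h : IsConeKernel t R L W D e S ω g A) (β : OrthonormalBasis ι ℝ E) {b : E → ℂ}
    (hb : Integrable b) (ξ : E) :
    (⟪e, ξ⟫ : ℂ) * 𝓕 (kernelOp (pieceKer ω g A fun _ => 1) b) ξ =
      (2 * Real.pi * Complex.I)⁻¹ * 𝓕 (kernelOp (eulerKer ω g A) b) ξ +
      ∑ i, (⟪β i, ξ⟫ : ℂ) *
        𝓕 (kernelOp (pieceKer ω g A fun z => ⟪β i, e - ‖z‖⁻¹ • z⟫) b) ξ := by
  have hc : ∀ i, Measurable fun z : E => ⟪β i, e - ‖z‖⁻¹ • z⟫ := fun i => by fun_prop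
  have hcb : ∀ i, ∀ z ∈ S, |⟪β i, e - ‖z‖⁻¹ • z⟫| ≤ t ^ 4 := fun i z hz => by
    refine (abs_real_inner_le_norm _ _).trans ?_
    rw [β.norm_eq_one, one_mul, norm_sub_rev]
    exact h.norm_sub_le z hz
  have ht : 0 ≤ t ^ 4 := by have := h.t_pos; positivity
  have hI := integrable_coneInd h.measurableSet R
  obtain ⟨i1, e1⟩ := fourier_kernelOp (h.measurable_pieceKer (c := fun _ => 1) measurable_const) hb
    (hI.const_mul _) (fun z y _ => h.abs_pieceKer_le zero_le_one (fun z _ => by simp) z y) ξ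
  obtain ⟨i2, e2⟩ := fourier_kernelOp h.measurable_eulerKer hb
    (hI.const_mul _) (fun z y _ => h.abs_eulerKer_le z y) ξ
  have h3 := fun i => fourier_kernelOp (h.measurable_pieceKer (hc i)) hb
    (hI.const_mul _) (fun z y _ => h.abs_pieceKer_le ht (hcb i) z y) ξ
  rw [e1, e2, Finset.sum_congr rfl fun i _ => by rw [(h3 i).2]]
  rw [← integral_const_mul, ← integral_const_mul,
    Finset.sum_congr rfl fun i _ => (integral_const_mul _ _).symm,
    ← integral_finsetSum _ (fun i _ => (h3 i).1.const_mul _),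
    ← integral_add (i2.const_mul _) (integrable_finsetSum _ fun i _ => (h3 i).1.const_mul _)]
  congr 1 with y
  have hχ : Measurable fun z : E => (𝐞 (-⟪z, ξ⟫) : ℂ) :=
    (continuous_subtype_val.comp (Real.continuous_fourierChar.comp (by fun_prop))).measurable
  have hint : ∀ {c : E → ℝ} {c₀ : ℝ}, Measurable c → 0 ≤ c₀ → (∀ z ∈ S, |c z| ≤ c₀) →
      Integrable fun z => (𝐞 (-⟪z, ξ⟫) : ℂ) * pieceKer ω g A c z y := by
    intro c c₀ hc hc₀ hcc
    refine (hI.const_mul (4 * c₀ * (W * D * L / R ^ finrank ℝ E))).mono' ?_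
      (ae_of_all _ fun z => ?_)
    · exact (hχ.mul (Complex.measurable_ofReal.comp ((h.measurable_pieceKer hc).comp
        (measurable_id.prodMk measurable_const)))).aestronglyMeasurable
    · rw [norm_mul, Circle.norm_coe, one_mul, Complex.norm_real]
      exact h.abs_pieceKer_le hc₀ hcc z y
  have hkey : (⟪e, ξ⟫ : ℂ) * ∫ z, (𝐞 (-⟪z, ξ⟫) : ℂ) * pieceKer ω g A (fun _ => 1) z y =
      (2 * Real.pi * Complex.I)⁻¹ * (∫ z, (𝐞 (-⟪z, ξ⟫) : ℂ) * eulerKer ω g A z y) +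
      ∑ i, (⟪β i, ξ⟫ : ℂ) *
        ∫ z, (𝐞 (-⟪z, ξ⟫) : ℂ) * pieceKer ω g A (fun z => ⟪β i, e - ‖z‖⁻¹ • z⟫) z y := by
    have hpi : (2 * Real.pi * Complex.I : ℂ) ≠ 0 := Complex.two_pi_I_ne_zero
    have hsum : ∀ z : E, ‖z‖ * ⟪e, ξ⟫ =
        ⟪z, ξ⟫ + ∑ i, ⟪β i, ξ⟫ * (⟪β i, e - ‖z‖⁻¹ • z⟫ * ‖z‖) := by
      intro z
      have h4 : ∀ i, ⟪β i, ξ⟫ * (⟪β i, e - ‖z‖⁻¹ • z⟫ * ‖z‖) =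
          ⟪‖z‖ • e - z, β i⟫ * ⟪β i, ξ⟫ := by
        intro i
        have h5 : ‖z‖ • e - z = ‖z‖ • (e - ‖z‖⁻¹ • z) := by
          rcases eq_or_ne z 0 with rfl | hz
          · simp
          · rw [smul_sub, smul_smul, mul_inv_cancel₀ (norm_ne_zero_iff.2 hz), one_smul]
        rw [h5, inner_smul_left, conj_trivial, real_inner_comm (β i)]
        ring
      rw [Finset.sum_congr rfl fun i _ => h4 i, β.sum_inner_mul_inner, inner_sub_left,
        inner_smul_left, conj_trivial]
      ring
    rw [h.integral_eulerKer, ← integral_const_mul, ← integral_const_mul,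
      Finset.sum_congr rfl fun i _ => (integral_const_mul _ _).symm,
      ← integral_finsetSum _ (fun i _ => (hint (hc i) ht (hcb i)).const_mul _)]
    have hpt : ∀ z, (⟪e, ξ⟫ : ℂ) * ((𝐞 (-⟪z, ξ⟫) : ℂ) * pieceKer ω g A (fun _ => 1) z y) =
        (2 * Real.pi * Complex.I)⁻¹ * ((𝐞 (-⟪z, ξ⟫) : ℂ) * (2 * Real.pi * Complex.I * ⟪z, ξ⟫ *
          (ω z * g z * (A (y + z) - A y) : ℝ))) +
        ∑ i, (⟪β i, ξ⟫ : ℂ) * ((𝐞 (-⟪z, ξ⟫) : ℂ) *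
          pieceKer ω g A (fun z => ⟪β i, e - ‖z‖⁻¹ • z⟫) z y) := by
      intro z
      have h6 : ∀ x : ℂ, (2 * Real.pi * Complex.I : ℂ)⁻¹ * ((𝐞 (-⟪z, ξ⟫) : ℂ) *
          (2 * Real.pi * Complex.I * ⟪z, ξ⟫ * x)) = (𝐞 (-⟪z, ξ⟫) : ℂ) * (⟪z, ξ⟫ * x) := fun x => by
        field_simp
      have h7 : ⟪e, ξ⟫ * pieceKer ω g A (fun _ => 1) z y =
          ⟪z, ξ⟫ * (ω z * g z * (A (y + z) - A y)) +
          ∑ i, ⟪β i, ξ⟫ * pieceKer ω g A (fun z => ⟪β i, e - ‖z‖⁻¹ • z⟫) z y := by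
        have h8 : ∀ i, ⟪β i, ξ⟫ * pieceKer ω g A (fun z => ⟪β i, e - ‖z‖⁻¹ • z⟫) z y =
            ω z * g z * (A (y + z) - A y) * (⟪β i, ξ⟫ * (⟪β i, e - ‖z‖⁻¹ • z⟫ * ‖z‖)) :=
          fun i => by rw [pieceKer]; ring
        rw [Finset.sum_congr rfl fun i _ => h8 i, ← Finset.mul_sum, pieceKer]
        linear_combination (ω z * g z * (A (y + z) - A y)) * hsum z
      have h9 : (𝐞 (-⟪z, ξ⟫) : ℂ) * ((⟪e, ξ⟫ * pieceKer ω g A (fun _ => 1) z y : ℝ) : ℂ) =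
        (𝐞 (-⟪z, ξ⟫) : ℂ) * ((⟪z, ξ⟫ * (ω z * g z * (A (y + z) - A y)) +
          ∑ i, ⟪β i, ξ⟫ * pieceKer ω g A (fun z => ⟪β i, e - ‖z‖⁻¹ • z⟫) z y : ℝ) : ℂ) := by
        rw [h7]
      rw [h6]
      push_cast at h9 ⊢
      rw [mul_add, Finset.mul_sum] at h9
      rw [mul_left_comm, h9]
      congr 1
      exact Finset.sum_congr rfl fun i _ => by ring
    have hi3 : Integrable fun z => ∑ i, (⟪β i, ξ⟫ : ℂ) * ((𝐞 (-⟪z, ξ⟫) : ℂ) *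
        pieceKer ω g A (fun z => ⟪β i, e - ‖z‖⁻¹ • z⟫) z y) :=
      integrable_finsetSum _ fun i _ => (hint (hc i) ht (hcb i)).const_mul _
    have hi1 := (hint (c := fun _ => 1) measurable_const zero_le_one
      (fun z _ => by simp)).const_mul (⟪e, ξ⟫ : ℂ)
    have hi2 : Integrable fun z => (2 * Real.pi * Complex.I : ℂ)⁻¹ * ((𝐞 (-⟪z, ξ⟫) : ℂ) *
        (2 * Real.pi * Complex.I * ⟪z, ξ⟫ * (ω z * g z * (A (y + z) - A y) : ℝ))) := by
      refine (hi1.sub hi3).congr (ae_of_all _ fun z => ?_)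
      simp only [Pi.sub_apply]
      rw [hpt z]
      ring
    rw [← integral_add hi2 hi3]
    exact integral_congr_ae (ae_of_all _ hpt)
  simp only [Circle.smul_def, smul_eq_mul]
  calc _ = (𝐞 (-⟪y, ξ⟫) : ℂ) * b y *
        ((⟪e, ξ⟫ : ℂ) * ∫ z, (𝐞 (-⟪z, ξ⟫) : ℂ) * pieceKer ω g A (fun _ => 1) z y) := by ring
    _ = _ := by
      rw [hkey, mul_add, Finset.mul_sum]
      congr 1
      · ring
      · exact Finset.sum_congr rfl fun i _ => by ring

end IsConeKernel

end Pieces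

section PieceEstimates

open Module
open scoped RealInnerProductSpace FourierTransform

variable {E : Type*} [NormedAddCommGroup E] [InnerProductSpace ℝ E] [FiniteDimensional ℝ E]
  [MeasurableSpace E] [BorelSpace E]

/-- A function bounded by `K R^{-n}`, with `L¹` norm at most `K σ`, living on the translate by
`y₀` of the tube of length `5 R` and width `5 h R`. -/
structure IsTubeBump (K R σ h : ℝ) (e y₀ : E) (H : E → ℂ) : Prop where
  integrable : Integrable H
  norm_le : ∀ x, ‖H x‖ ≤ K / R ^ finrank ℝ E
  integral_norm_le : ∫ x, ‖H x‖ ≤ K * σ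
  mem_tube : ∀ x, H x ≠ 0 → x - y₀ ∈ tube e h (5 * R)

theorem norm_dirAvg_le {e : E} {M τ : ℝ} {F : E → ℂ} {K : ℝ} (hF : ∀ x, ‖F x‖ ≤ K) (x : E) :
    ‖dirAvg e M τ F x‖ ≤ K := by
  have := norm_translateAvg_le (v := fun u : E => τ • stretch e M u) integrable_dirAvg_weight hF x
  rwa [integral_norm_dirAvg_weight, one_mul] at this

theorem dirAvg_ne_zero {e : E} {M τ : ℝ} {F : E → ℂ} {x : E} (h : dirAvg e M τ F x ≠ 0) :
    ∃ u : E, ‖u‖ ≤ 1 ∧ F (x - τ • stretch e M u) ≠ 0 := by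
  by_contra! hcon
  refine h ?_
  unfold dirAvg translateAvg
  rw [integral_congr_ae (g := fun _ => 0), integral_zero]
  refine ae_of_all _ fun u => ?_
  by_cases hu : ‖u‖ ≤ 1
  · simp [hcon u hu]
  · simp [capProfile_eq_zero (not_le.1 hu).le]

theorem norm_sub_inner_smul_le {e : E} (he : ‖e‖ = 1) (v : E) (s : ℝ) :
    ‖v - ⟪e, v⟫ • e‖ ≤ ‖v - s • e‖ := by
  have h1 := norm_sq_eq_inner_add_norm_sub he (v - s • e)
  have h2 : ⟪e, v - s • e⟫ = ⟪e, v⟫ - s := by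
    rw [inner_sub_right, inner_smul_right, real_inner_self_eq_norm_sq, he]; ring
  have h3 : v - s • e - ⟪e, v - s • e⟫ • e = v - ⟪e, v⟫ • e := by
    rw [h2]; module
  rw [h3] at h1
  exact le_of_sq_le_sq (by nlinarith [sq_nonneg ⟪e, v - s • e⟫]) (norm_nonneg _)

namespace IsConeKernel

variable {t R : ℝ} {L : NNReal} {W D : ℝ} {e : E} {S : Set E} {ω g A : E → ℝ}

theorem integrable_pieceOp (h : IsConeKernel t R L W D e S ω g A) {c : E → ℝ} {c₀ : ℝ}
    (hcm : Measurable c) (hc₀ : 0 ≤ c₀) (hc : ∀ z ∈ S, |c z| ≤ c₀) {b : E → ℂ}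
    (hb : Integrable b) : Integrable (kernelOp (pieceKer ω g A c) b) :=
  integrable_kernelOp (h.measurable_pieceKer hcm) hb
    ((integrable_coneInd h.measurableSet R).const_mul _)
    fun z y _ => h.abs_pieceKer_le hc₀ hc z y

theorem integral_const_mul_coneInd (h : IsConeKernel t R L W D e S ω g A) (a : ℝ) :
    ∫ z, a / R ^ finrank ℝ E * coneInd S R z = a * volume.real (S ∩ closedBall 0 2) := by
  have := h.R_pos
  rw [integral_const_mul, integral_coneInd h.measurableSet h.smul_mem h.R_pos]
  field_simp

theorem integral_norm_pieceOp_le (h : IsConeKernel t R L W D e S ω g A) {c : E → ℝ} {c₀ : ℝ}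
    (hcm : Measurable c) (hc₀ : 0 ≤ c₀) (hc : ∀ z ∈ S, |c z| ≤ c₀) {b : E → ℂ}
    (hb : Integrable b) :
    ∫ x, ‖kernelOp (pieceKer ω g A c) b x‖ ≤
      4 * c₀ * (W * D * L) * volume.real (S ∩ closedBall 0 2) * ∫ x, ‖b x‖ := by
  refine (integral_norm_kernelOp_le (h.measurable_pieceKer hcm) hb
    ((integrable_coneInd h.measurableSet R).const_mul _)
    fun z y _ => h.abs_pieceKer_le hc₀ hc z y).trans_eq ?_
  rw [← h.integral_const_mul_coneInd]
  congr 2 with z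
  ring

theorem norm_pieceOp_le (h : IsConeKernel t R L W D e S ω g A) {c : E → ℝ} {c₀ : ℝ}
    (hc₀ : 0 ≤ c₀) (hc : ∀ z ∈ S, |c z| ≤ c₀) {b : E → ℂ} (hb : Integrable b) (x : E) :
    ‖kernelOp (pieceKer ω g A c) b x‖ ≤
      4 * c₀ * (W * D * L) * (∫ x, ‖b x‖) / R ^ finrank ℝ E := by
  have hW := h.W_nonneg
  have hD := h.D_nonneg
  have hR := h.R_pos
  refine (norm_kernelOp_le hb (K₀ := 4 * c₀ * (W * D * L / R ^ finrank ℝ E))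
    (fun z y _ => (h.abs_pieceKer_le hc₀ hc z y).trans
      (mul_le_of_le_one_right (by positivity) (coneInd_le_one _ _ _))) x).trans_eq ?_
  ring

theorem integral_norm_dirAvg_pieceOp_le (h : IsConeKernel t R L W D e S ω g A) {c : E → ℝ}
    {c₀ : ℝ} (hcm : Measurable c) (hc₀ : 0 ≤ c₀) (hc : ∀ z ∈ S, |c z| ≤ c₀) {b : E → ℂ}
    (hb : Integrable b) {y₀ : E} {r : ℝ} (hrR : r ≤ t ^ 8 * R)
    (hsupp : ∀ y, b y ≠ 0 → ‖y - y₀‖ ≤ r) (hmean : ∫ y, b y = 0) :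
    ∫ x, ‖dirAvg e (t ^ 2)⁻¹ (t ^ 4 * R) (kernelOp (pieceKer ω g A c) b) x‖ ≤
      4 * (capConst E + 1) * t ^ 4 * c₀ * (W * D * L) * volume.real (S ∩ closedBall 0 2) *
        ∫ x, ‖b x‖ := by
  have hW := h.W_nonneg
  have hD := h.D_nonneg
  have hR := h.R_pos
  have ht := h.t_pos
  have hcap := capConst_nonneg (E := E)
  have hb0 : 0 ≤ ∫ x, ‖b x‖ := integral_nonneg fun _ => norm_nonneg _
  have hσ : 0 ≤ volume.real (S ∩ closedBall 0 2) := measureReal_nonneg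
  set n := finrank ℝ E with hn
  set κ := pieceKer ω g A c with hκ
  have hκm := h.measurable_pieceKer hcm
  have hI := integrable_coneInd h.measurableSet R
  have hκb := h.abs_pieceKer_le hc₀ hc
  set κ₀ : E → ℝ := fun z => κ z y₀ with hκ₀
  have hκ₀m : Measurable κ₀ := hκm.comp (measurable_id.prodMk measurable_const)
  have hκ₀i : Integrable fun z => (κ₀ z : ℂ) := by
    refine (hI.const_mul (4 * c₀ * (W * D * L / R ^ n))).mono'
      (Complex.measurable_ofReal.comp hκ₀m).aestronglyMeasurable (ae_of_all _ fun z => ?_)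
    rw [Complex.norm_real]
    exact hκb z y₀
  set Fa : E → ℂ := translateAvg volume (fun z => (κ₀ z : ℂ)) id b with hFa
  set Fb : E → ℂ := kernelOp (fun z y => κ z y - κ₀ z) b with hFb
  have hdm : Measurable fun p : E × E => κ p.1 p.2 - κ₀ p.1 := hκm.sub (hκ₀m.comp measurable_fst)
  have hdb : ∀ z y, b y ≠ 0 → |κ z y - κ₀ z| ≤
      4 * c₀ * (W * D * L * t ^ 4) / R ^ n * coneInd S R z := by
    intro z y hy
    have h1 : κ z y - κ₀ z =
        ω z * c z * ‖z‖ * g z * ((A (y + z) - A y) - (A (y₀ + z) - A y₀)) := by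
      simp only [hκ, hκ₀, pieceKer]; ring
    rw [h1]
    refine (h.abs_kernel_le hc₀ hc (m := 2 * (L * (t ^ 4 * R))) z (by positivity)
      fun _ => ?_).trans_eq ?_
    · have h2 := h.abs_sub_le (y + z) (y₀ + z)
      have h3 := h.abs_sub_le y y₀
      rw [add_sub_add_right_eq_sub] at h2
      have h4 : ‖y - y₀‖ ≤ t ^ 4 * R := (hsupp y hy).trans (hrR.trans (by
        gcongr ?_ * R
        exact pow_le_pow_of_le_one ht.le h.t_le_one (by norm_num)))
      have h5 : (L : ℝ) * ‖y - y₀‖ ≤ L * (t ^ 4 * R) := by gcongr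
      rw [show A (y + z) - A y - (A (y₀ + z) - A y₀) =
        (A (y + z) - A (y₀ + z)) - (A y - A y₀) by ring]
      refine (abs_sub _ _).trans ?_
      linarith
    · rw [← hn]
      congr 1
      field_simp
      ring
  have hsum : kernelOp κ b = fun x => Fa x + Fb x := by
    ext x
    have hbx : Integrable fun z => b (x - z) := hb.comp_sub_left x
    have hbd : ∀ z y, |κ z y| ≤ 4 * c₀ * (W * D * L / R ^ n) := fun z y =>
      (hκb z y).trans (mul_le_of_le_one_right (by positivity) (coneInd_le_one _ _ _))
    have hi1 : Integrable fun z => (κ₀ z : ℂ) * b (x - z) := by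
      refine hbx.bdd_mul (c := 4 * c₀ * (W * D * L / R ^ n))
        (Complex.measurable_ofReal.comp hκ₀m).aestronglyMeasurable (ae_of_all _ fun z => ?_)
      rw [Complex.norm_real]
      exact hbd _ _
    have hi2 : Integrable fun z => (κ z (x - z) : ℂ) * b (x - z) := by
      refine hbx.bdd_mul (c := 4 * c₀ * (W * D * L / R ^ n))
        (Complex.measurable_ofReal.comp (hκm.comp (measurable_id.prodMk
          (measurable_const.sub measurable_id)))).aestronglyMeasurable (ae_of_all _ fun z => ?_)
      rw [Complex.norm_real]
      exact hbd _ _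
    have hi3 : Integrable fun z => ((κ z (x - z) - κ₀ z : ℝ) : ℂ) * b (x - z) := by
      refine (hi2.sub hi1).congr (ae_of_all _ fun z => ?_)
      simp only [Pi.sub_apply]
      push_cast
      ring
    simp only [hFa, hFb, translateAvg, kernelOp, id]
    rw [← integral_add hi1 hi3]
    congr 1 with z
    push_cast
    ring
  have hFai : Integrable Fa := integrable_translateAvg measurable_id hκ₀i hb
  have hFbi : Integrable Fb := integrable_kernelOp hdm hb (hI.const_mul _) hdb
  have e1 : dirAvg e (t ^ 2)⁻¹ (t ^ 4 * R) (kernelOp κ b) =ᵐ[volume]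
      fun x => translateAvg volume (fun z => (κ₀ z : ℂ)) id (dirAvg e (t ^ 2)⁻¹ (t ^ 4 * R) b) x +
        dirAvg e (t ^ 2)⁻¹ (t ^ 4 * R) Fb x := by
    rw [hsum]
    filter_upwards [translateAvg_add (measurable_dirAvg_shift (e := e) (M := (t ^ 2)⁻¹)
      (τ := t ^ 4 * R)) integrable_dirAvg_weight hFai hFbi,
      translateAvg_comm (measurable_dirAvg_shift (e := e) (M := (t ^ 2)⁻¹)
      (τ := t ^ 4 * R)) integrable_dirAvg_weight measurable_id hκ₀i hb] with x h1 h2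
    rw [dirAvg, h1, h2]
    rfl
  have hGb : Integrable (dirAvg e (t ^ 2)⁻¹ (t ^ 4 * R) b) := integrable_dirAvg hb
  have b1 : ∫ x, ‖translateAvg volume (fun z => (κ₀ z : ℂ)) id
      (dirAvg e (t ^ 2)⁻¹ (t ^ 4 * R) b) x‖ ≤
      4 * c₀ * (W * D * L) * volume.real (S ∩ closedBall 0 2) *
        (capConst E * t ^ 4 * ∫ x, ‖b x‖) := by
    refine (integral_norm_translateAvg_le measurable_id hκ₀i hGb).trans ?_
    gcongr
    · rw [← h.integral_const_mul_coneInd]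
      refine integral_mono_of_nonneg (ae_of_all _ fun _ => norm_nonneg _) (hI.const_mul _)
        (ae_of_all _ fun z => ?_)
      simp only [Complex.norm_real, Real.norm_eq_abs]
      refine (hκb z y₀).trans_eq ?_
      rw [← hn]
      ring
    · refine (integral_norm_dirAvg_le_of_integral_eq_zero h.norm_e (by positivity)
        (by positivity) hb hsupp hmean).trans ?_
      gcongr
      rw [div_le_iff₀ (by positivity)]
      exact hrR.trans_eq (by ring)
  have b2 : ∫ x, ‖dirAvg e (t ^ 2)⁻¹ (t ^ 4 * R) Fb x‖ ≤
      4 * c₀ * (W * D * L * t ^ 4) * volume.real (S ∩ closedBall 0 2) * ∫ x, ‖b x‖ := by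
    refine (integral_norm_dirAvg_le hFbi).trans
      ((integral_norm_kernelOp_le hdm hb (hI.const_mul _) hdb).trans_eq ?_)
    rw [h.integral_const_mul_coneInd]
  have i1 : Integrable (translateAvg volume (fun z => (κ₀ z : ℂ)) id
      (dirAvg e (t ^ 2)⁻¹ (t ^ 4 * R) b)) := integrable_translateAvg measurable_id hκ₀i hGb
  have i2 : Integrable (dirAvg e (t ^ 2)⁻¹ (t ^ 4 * R) Fb) := integrable_dirAvg hFbi
  calc _ ≤ ∫ x, (‖translateAvg volume (fun z => (κ₀ z : ℂ)) id
          (dirAvg e (t ^ 2)⁻¹ (t ^ 4 * R) b) x‖ + ‖dirAvg e (t ^ 2)⁻¹ (t ^ 4 * R) Fb x‖) := by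
        refine integral_mono_of_nonneg (ae_of_all _ fun _ => norm_nonneg _) (i1.norm.add i2.norm) ?_
        filter_upwards [e1] with x hx
        rw [hx]
        exact norm_add_le _ _
    _ ≤ _ := by
        rw [integral_add i1.norm i2.norm]
        refine (add_le_add b1 b2).trans_eq ?_
        ring

theorem isTubeBump (h : IsConeKernel t R L W D e S ω g A) {c : E → ℝ}
    {c₀ : ℝ} (hcm : Measurable c) (hc₀ : 0 ≤ c₀) (hc : ∀ z ∈ S, |c z| ≤ c₀) {b : E → ℂ}
    (hb : Integrable b) {y₀ : E} {r : ℝ} (hrR : r ≤ t ^ 8 * R)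
    (hsupp : ∀ y, b y ≠ 0 → ‖y - y₀‖ ≤ r) :
    IsTubeBump (8 * c₀ * (W * D * L) * ∫ x, ‖b x‖) R (volume.real (S ∩ closedBall 0 2)) (t ^ 4)
      e y₀ (fun x => kernelOp (pieceKer ω g A c) b x -
        dirAvg e (t ^ 2)⁻¹ (t ^ 4 * R) (kernelOp (pieceKer ω g A c) b) x) := by
  have hR := h.R_pos
  have ht := h.t_pos
  have ht1 := h.t_le_one
  have hFi := h.integrable_pieceOp hcm hc₀ hc hb
  have hFn := h.norm_pieceOp_le hc₀ hc hb
  have hF1 := h.integral_norm_pieceOp_le hcm hc₀ hc hb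
  set F := kernelOp (pieceKer ω g A c) b with hF
  have hGi : Integrable (dirAvg e (t ^ 2)⁻¹ (t ^ 4 * R) F) := integrable_dirAvg hFi
  have hx : ∀ x, F x ≠ 0 → ∃ y z, x = y + z ∧ ‖y - y₀‖ ≤ t ^ 4 * R ∧ ‖z‖ ≤ 2 * R ∧
      ‖‖z‖⁻¹ • z - e‖ ≤ t ^ 4 := by
    intro x hx
    obtain ⟨z, hz, hz'⟩ := kernelOp_ne_zero hx
    have hωz : ω z ≠ 0 := fun hcon => hz (by simp [pieceKer, hcon])
    have hgz : g z ≠ 0 := fun hcon => hz (by simp [pieceKer, hcon])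
    refine ⟨x - z, z, by abel, (hsupp _ hz').trans (hrR.trans ?_), h.norm_le_of_g_ne_zero z hgz,
      h.norm_sub_le z (h.mem_of_ω_ne_zero z hωz)⟩
    gcongr ?_ * R
    exact pow_le_pow_of_le_one ht.le ht1 (by norm_num)
  have htube : ∀ x u : E, ‖u‖ ≤ 1 → F (x - (t ^ 4 * R) • stretch e (t ^ 2)⁻¹ u) ≠ 0 →
      x - y₀ ∈ tube e (t ^ 4) (5 * R) := by
    intro x u hu hxu
    obtain ⟨y, z, hyz, hy, hz, hze⟩ := hx _ hxu
    have ht4 : t ^ 4 ≤ 1 := pow_le_one₀ ht.le ht1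
    have ht2 : t ^ 2 ≤ 1 := pow_le_one₀ ht.le ht1
    have hin : |⟪e, u⟫| ≤ 1 := (abs_real_inner_le_norm e u).trans (by rw [h.norm_e, one_mul]; exact hu)
    have hdec : x - y₀ = (y - y₀) + z + (t ^ 4 * R) • u + (t ^ 2 * R * ⟪e, u⟫) • e := by
      have h1 : x = y + z + (t ^ 4 * R) • stretch e (t ^ 2)⁻¹ u := by rw [← hyz]; abel
      have h2 : t ^ 2 * R * ⟪e, u⟫ = t ^ 4 * R * ((t ^ 2)⁻¹ * ⟪e, u⟫) := by field_simp
      rw [h1, stretch_apply, h2]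
      module
    have hτu : ‖(t ^ 4 * R) • u‖ ≤ t ^ 4 * R := by
      rw [norm_smul, Real.norm_of_nonneg (by positivity)]
      exact mul_le_of_le_one_right (by positivity) hu
    have hzz : ‖z - ‖z‖ • e‖ ≤ 2 * R * t ^ 4 := by
      by_cases hz0 : z = 0
      · simp only [hz0, norm_zero, zero_smul, sub_zero]; positivity
      have h1 : z - ‖z‖ • e = ‖z‖ • (‖z‖⁻¹ • z - e) := by
        rw [smul_sub, smul_inv_smul₀ (norm_ne_zero_iff.2 hz0)]
      rw [h1, norm_smul, norm_norm]
      gcongr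
    constructor
    · refine (abs_real_inner_le_norm e _).trans ?_
      rw [h.norm_e, one_mul, hdec]
      have h3 : ‖(t ^ 2 * R * ⟪e, u⟫) • e‖ ≤ R := by
        rw [norm_smul, h.norm_e, mul_one, Real.norm_eq_abs, abs_mul, abs_of_pos (by positivity)]
        calc t ^ 2 * R * |⟪e, u⟫| ≤ 1 * R * 1 := by gcongr
          _ = R := by ring
      have h4 : t ^ 4 * R ≤ 1 * R := by gcongr
      refine (norm_add_le _ _).trans ?_
      have h5 := norm_add₃_le (a := y - y₀) (b := z) (c := (t ^ 4 * R) • u)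
      linarith
    · refine (norm_sub_inner_smul_le h.norm_e _ (‖z‖ + t ^ 2 * R * ⟪e, u⟫)).trans ?_
      have h6 : x - y₀ - (‖z‖ + t ^ 2 * R * ⟪e, u⟫) • e =
          (y - y₀) + (z - ‖z‖ • e) + (t ^ 4 * R) • u := by
        rw [hdec]; module
      rw [h6]
      have h5 := norm_add₃_le (a := y - y₀) (b := z - ‖z‖ • e) (c := (t ^ 4 * R) • u)
      have h7 : 0 ≤ t ^ 4 * R := by positivity
      linarith
  refine ⟨hFi.sub hGi, fun x => ?_, ?_, fun x hxn => ?_⟩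
  · refine (_root_.norm_sub_le _ _).trans ((add_le_add (hFn x) (norm_dirAvg_le hFn x)).trans_eq ?_)
    ring
  · calc _ ≤ ∫ x, (‖F x‖ + ‖dirAvg e (t ^ 2)⁻¹ (t ^ 4 * R) F x‖) :=
          integral_mono_of_nonneg (ae_of_all _ fun _ => norm_nonneg _) (hFi.norm.add hGi.norm)
            (ae_of_all _ fun x => _root_.norm_sub_le _ _)
      _ ≤ _ := by
          rw [integral_add hFi.norm hGi.norm]
          refine (add_le_add hF1 ((integral_norm_dirAvg_le hFi).trans hF1)).trans_eq ?_
          ring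
  · by_cases hFx : F x = 0
    · have : dirAvg e (t ^ 2)⁻¹ (t ^ 4 * R) F x ≠ 0 := by
        intro hcon
        exact hxn (by simp [hFx, hcon])
      obtain ⟨u, hu, hu'⟩ := dirAvg_ne_zero this
      exact htube x u hu hu'
    · exact htube x 0 (by simp) (by simpa using hFx)

end IsConeKernel

end PieceEstimates

section PieceDecomposition

open Module
open scoped RealInnerProductSpace FourierTransform

variable {E : Type*} [NormedAddCommGroup E] [InnerProductSpace ℝ E] [FiniteDimensional ℝ E]
  [MeasurableSpace E] [BorelSpace E]

theorem memLp_two_of_integrable_of_norm_le {f : E → ℂ} (hf : Integrable f) {K : ℝ}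
    (hK : ∀ x, ‖f x‖ ≤ K) : MemLp f 2 := by
  rw [memLp_two_iff_integrable_sq_norm hf.1]
  refine (hf.norm.const_mul K).mono' (hf.1.norm.pow 2) (ae_of_all _ fun x => ?_)
  rw [Real.norm_of_nonneg (by positivity), sq]
  gcongr
  exact hK x

theorem IsTubeBump.memLp_two {K R σ h : ℝ} {e y₀ : E} {H : E → ℂ}
    (hH : IsTubeBump K R σ h e y₀ H) : MemLp H 2 :=
  memLp_two_of_integrable_of_norm_le hH.integrable hH.norm_le

/-- A kernel piece splits into an `L¹`-small part and a part which is, on the Fourier side, a sum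
of multipliers applied to tube bumps. -/
theorem IsConeKernel.exists_split [Nontrivial E] {ι : Type*} [Fintype ι]
    {t R : ℝ} {L : NNReal} {W D : ℝ} {e : E} {S : Set E} {ω g A : E → ℝ}
    (h : IsConeKernel t R L W D e S ω g A) (β : OrthonormalBasis ι ℝ E) {b : E → ℂ}
    (hb : Integrable b) {y₀ : E} {r : ℝ} (hrR : r ≤ t ^ 8 * R)
    (hsupp : ∀ y, b y ≠ 0 → ‖y - y₀‖ ≤ r) (hmean : ∫ y, b y = 0) :
    ∃ (F₁ F₂ H : E → ℂ) (G : ι → E → ℂ),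
      (∀ x, kernelOp (pieceKer ω g A fun _ => 1) b x = F₁ x + F₂ x) ∧
      Integrable F₁ ∧
      ∫ x, ‖F₁ x‖ ≤ (4 * capConst E + 4 * finrank ℝ E + 16) * (W * D * L) *
        volume.real (S ∩ closedBall 0 2) * t ^ 2 * ∫ x, ‖b x‖ ∧
      Integrable F₂ ∧ MemLp F₂ 2 ∧
      IsTubeBump (8 * (W * D * L) * ∫ x, ‖b x‖) R (volume.real (S ∩ closedBall 0 2)) (t ^ 4)
        e y₀ H ∧
      (∀ i, IsTubeBump (8 * t ^ 4 * (W * D * L) * ∫ x, ‖b x‖) R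
        (volume.real (S ∩ closedBall 0 2)) (t ^ 4) e y₀ (G i)) ∧
      ∀ ξ, 𝓕 F₂ ξ = ((‖ξ‖ ^ 2 / ‖stretch e (t ^ 2)⁻¹ ξ‖ ^ 2 : ℝ) : ℂ) * 𝓕 H ξ +
        ∑ i, ((((t ^ 2)⁻¹ ^ 2 + 2 * (t ^ 2)⁻¹) * ⟪e, ξ⟫ * ⟪β i, ξ⟫ /
          ‖stretch e (t ^ 2)⁻¹ ξ‖ ^ 2 : ℝ) : ℂ) * 𝓕 (G i) ξ := by
  have hW := h.W_nonneg
  have hD := h.D_nonneg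
  have hR := h.R_pos
  have ht := h.t_pos
  have ht1 := h.t_le_one
  have hcap := capConst_nonneg (E := E)
  have hb0 : 0 ≤ ∫ x, ‖b x‖ := integral_nonneg fun _ => norm_nonneg _
  have hσ : 0 ≤ volume.real (S ∩ closedBall 0 2) := measureReal_nonneg
  have hM : 1 ≤ (t ^ 2)⁻¹ := (one_le_inv₀ (by positivity)).2 (pow_le_one₀ ht.le ht1)
  have hτ : 0 ≤ t ^ 4 * R := by positivity
  have hc : ∀ i, Measurable fun z : E => ⟪β i, e - ‖z‖⁻¹ • z⟫ := fun i => by fun_prop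
  have hcb : ∀ i, ∀ z ∈ S, |⟪β i, e - ‖z‖⁻¹ • z⟫| ≤ t ^ 4 := fun i z hz => by
    refine (abs_real_inner_le_norm _ _).trans ?_
    rw [β.norm_eq_one, one_mul, norm_sub_rev]
    exact h.norm_sub_le z hz
  have h1b : ∀ z ∈ S, |(fun _ : E => (1 : ℝ)) z| ≤ 1 := fun z _ => by simp
  have hI := integrable_coneInd h.measurableSet R
  have hF := h.integrable_pieceOp (c := fun _ => 1) measurable_const zero_le_one h1b hb
  have hG := fun i => h.integrable_pieceOp (hc i) (by positivity) (hcb i) hb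
  have hF' : Integrable (kernelOp (eulerKer ω g A) b) :=
    integrable_kernelOp h.measurable_eulerKer hb (hI.const_mul _) fun z y _ => h.abs_eulerKer_le z y
  have hF'1 : ∫ x, ‖kernelOp (eulerKer ω g A) b x‖ ≤
      (2 * finrank ℝ E + 6) * (W * D * L) / R * volume.real (S ∩ closedBall 0 2) *
        ∫ x, ‖b x‖ := by
    refine (integral_norm_kernelOp_le h.measurable_eulerKer hb (hI.const_mul _)
      fun z y _ => h.abs_eulerKer_le z y).trans_eq ?_
    rw [← h.integral_const_mul_coneInd]
    congr 2 with z
    rw [pow_succ]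
    field_simp
  have hF'b : ∀ x, ‖kernelOp (eulerKer ω g A) b x‖ ≤
      (2 * finrank ℝ E + 6) * (W * D * L / R ^ (finrank ℝ E + 1)) * ∫ x, ‖b x‖ :=
    norm_kernelOp_le hb fun z y _ => (h.abs_eulerKer_le z y).trans
      (mul_le_of_le_one_right (by positivity) (coneInd_le_one _ _ _))
  have hA := h.integral_norm_dirAvg_pieceOp_le (c := fun _ => 1) measurable_const zero_le_one h1b hb
    hrR hsupp hmean
  have hC := integral_norm_dirCorr_le h.norm_e hM hτ hF'
  have hH := h.isTubeBump (c := fun _ => 1) measurable_const zero_le_one h1b hb hrR hsupp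
  have hFb := h.norm_pieceOp_le (c := fun _ => 1) zero_le_one h1b hb
  have hFour := fun ξ => fourier_sub_dirAvg_sub_dirCorr h.norm_e
    (zero_le_one.trans hM) hτ
    (fun i => β i) hF hF' hG ξ (h.inner_mul_fourier_kernelOp β hb ξ)
  set F := kernelOp (pieceKer ω g A fun _ => 1) b with hFdef
  set F' := kernelOp (eulerKer ω g A) b with hF'def
  have i1 : Integrable (dirAvg e (t ^ 2)⁻¹ (t ^ 4 * R) F) := integrable_dirAvg hF
  have i2 : Integrable (dirCorr e (t ^ 2)⁻¹ (t ^ 4 * R) F') := integrable_dirCorr hF'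
  refine ⟨fun x => dirAvg e (t ^ 2)⁻¹ (t ^ 4 * R) F x + dirCorr e (t ^ 2)⁻¹ (t ^ 4 * R) F' x,
    fun x => F x - dirAvg e (t ^ 2)⁻¹ (t ^ 4 * R) F x - dirCorr e (t ^ 2)⁻¹ (t ^ 4 * R) F' x,
    _, _, fun x => by ring, i1.add i2, ?_, (hF.sub i1).sub i2, ?_, ?_, fun i => ?_, hFour⟩
  · calc _ ≤ ∫ x, (‖dirAvg e (t ^ 2)⁻¹ (t ^ 4 * R) F x‖ +
          ‖dirCorr e (t ^ 2)⁻¹ (t ^ 4 * R) F' x‖) :=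
          integral_mono_of_nonneg (ae_of_all _ fun _ => norm_nonneg _) (i1.norm.add i2.norm)
            (ae_of_all _ fun x => norm_add_le _ _)
      _ ≤ 4 * (capConst E + 1) * t ^ 4 * 1 * (W * D * L) * volume.real (S ∩ closedBall 0 2) *
            (∫ x, ‖b x‖) + 2 * (t ^ 2)⁻¹ * (t ^ 4 * R) *
            ((2 * finrank ℝ E + 6) * (W * D * L) / R * volume.real (S ∩ closedBall 0 2) *
            ∫ x, ‖b x‖) := by
          rw [integral_add i1.norm i2.norm]
          refine add_le_add hA (hC.trans ?_)
          gcongr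
      _ ≤ 4 * (capConst E + 1) * t ^ 2 * 1 * (W * D * L) * volume.real (S ∩ closedBall 0 2) *
            (∫ x, ‖b x‖) + 2 * (t ^ 2)⁻¹ * (t ^ 4 * R) *
            ((2 * finrank ℝ E + 6) * (W * D * L) / R * volume.real (S ∩ closedBall 0 2) *
            ∫ x, ‖b x‖) := by
          have : t ^ 4 ≤ t ^ 2 := pow_le_pow_of_le_one ht.le ht1 (by norm_num)
          gcongr
      _ = _ := by field_simp; ring
  · have hbd : ∃ K, ∀ x, ‖F x - dirAvg e (t ^ 2)⁻¹ (t ^ 4 * R) F x -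
        dirCorr e (t ^ 2)⁻¹ (t ^ 4 * R) F' x‖ ≤ K :=
      ⟨_, fun x => (_root_.norm_sub_le _ _).trans (add_le_add ((_root_.norm_sub_le _ _).trans
        (add_le_add (hFb x) (norm_dirAvg_le hFb x)))
        (norm_translateAvg_le integrable_dirCorr_weight hF'b x))⟩
    obtain ⟨K, hK⟩ := hbd
    exact memLp_two_of_integrable_of_norm_le ((hF.sub i1).sub i2) hK
  · simpa only [mul_one] using hH
  · exact h.isTubeBump (hc i) (by positivity) (hcb i) hb hrR hsupp

end PieceDecomposition

section Packing

open Module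
open scoped RealInnerProductSpace FourierTransform

variable {E : Type*} [NormedAddCommGroup E] [InnerProductSpace ℝ E] [FiniteDimensional ℝ E]
  [MeasurableSpace E] [BorelSpace E]

theorem add_mem_tube {e v w : E} {h ρ ρ' : ℝ} (hv : v ∈ tube e h ρ) (hw : w ∈ tube e h ρ') :
    v + w ∈ tube e h (ρ + ρ') := by
  refine ⟨?_, ?_⟩
  · rw [inner_add_right]
    exact (abs_add_le _ _).trans (add_le_add hv.1 hw.1)
  · rw [inner_add_right, show v + w - (⟪e, v⟫ + ⟪e, w⟫) • e =
      (v - ⟪e, v⟫ • e) + (w - ⟪e, w⟫ • e) by module, mul_add]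
    exact (norm_add_le _ _).trans (add_le_add hv.2 hw.2)

theorem neg_mem_tube {e v : E} {h ρ : ℝ} (hv : v ∈ tube e h ρ) : -v ∈ tube e h ρ := by
  refine ⟨by rw [inner_neg_right, abs_neg]; exact hv.1, ?_⟩
  rw [inner_neg_right, show -v - (-⟪e, v⟫) • e = -(v - ⟪e, v⟫ • e) by module, norm_neg]
  exact hv.2

theorem mem_tube_of_norm_le {e v : E} (he : ‖e‖ = 1) {h ρ : ℝ} (hh1 : h ≤ 1) (hρ : 0 ≤ ρ)
    (hv : ‖v‖ ≤ h * ρ) : v ∈ tube e h ρ := by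
  refine ⟨(abs_real_inner_le_norm e v).trans ?_, ?_⟩
  · rw [he, one_mul]
    exact hv.trans (mul_le_of_le_one_left hρ hh1)
  · simpa using (norm_sub_inner_smul_le he v 0).trans (by simpa using hv)

theorem tube_subset_tube {e : E} {h ρ ρ' : ℝ} (hh : 0 ≤ h) (hρ : ρ ≤ ρ') :
    tube e h ρ ⊆ tube e h ρ' := fun _ hv =>
  ⟨hv.1.trans hρ, hv.2.trans (by gcongr)⟩

theorem isClosed_tube (e : E) (h ρ : ℝ) : IsClosed (tube e h ρ) :=
  IsClosed.inter (s₁ := {v : E | |⟪e, v⟫| ≤ ρ}) (s₂ := {v : E | ‖v - ⟪e, v⟫ • e‖ ≤ h * ρ})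
    (isClosed_le (by fun_prop) continuous_const) (isClosed_le (by fun_prop) continuous_const)

theorem isBounded_tube (e : E) (h ρ : ℝ) : Bornology.IsBounded (tube e h ρ) := by
  refine isBounded_iff_forall_norm_le.2 ⟨h * ρ + ρ * ‖e‖, fun v hv => ?_⟩
  calc ‖v‖ = ‖(v - ⟪e, v⟫ • e) + ⟪e, v⟫ • e‖ := by rw [sub_add_cancel]
    _ ≤ h * ρ + ρ * ‖e‖ := by
        refine (norm_add_le _ _).trans (add_le_add hv.2 ?_)
        rw [norm_smul, Real.norm_eq_abs]
        gcongr
        exact hv.1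

theorem IsTubeBump.nonneg {K R σ h : ℝ} {e y₀ : E} {H : E → ℂ}
    (hR : 0 < R) (hH : IsTubeBump K R σ h e y₀ H) : 0 ≤ K := by
  have := (norm_nonneg _).trans (hH.norm_le 0)
  by_contra hcon
  exact absurd this (not_le.2 (div_neg_of_neg_of_pos (not_le.1 hcon) (by positivity)))

theorem IsTubeBump.integrable_mul {K R σ h : ℝ} {e y₀ : E} {H : E → ℂ}
    (hH : IsTubeBump K R σ h e y₀ H) {F : E → ℂ} (hF : Integrable F) :
    Integrable fun x => ‖H x‖ * ‖F x‖ := by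
  refine (hF.norm.const_mul (K / R ^ finrank ℝ E)).mono' (hH.integrable.1.norm.mul hF.1.norm)
    (ae_of_all _ fun x => ?_)
  rw [Real.norm_of_nonneg (by positivity)]
  gcongr
  exact hH.norm_le x

/-- Almost orthogonality of bumps living on parallel tubes attached to disjoint sets. -/
theorem integral_norm_sum_sq_le [Nontrivial E] {ι : Type*} [Fintype ι] {e : E} (he : ‖e‖ = 1)
    {h K σ α : ℝ} (hh : 0 < h) (hh1 : h ≤ 1) (hK : 0 ≤ K) (hσ : 0 ≤ σ) (hα : 0 ≤ α)
    {R m : ι → ℝ} (hR : ∀ i, 0 < R i) (hm : ∀ i, 0 ≤ m i) {y : ι → E} {Q : ι → Set E}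
    {H : ι → E → ℂ} (hQm : ∀ i, MeasurableSet (Q i))
    (hQd : Pairwise fun i j => Disjoint (Q i) (Q j))
    (hQs : ∀ i, Q i ⊆ closedBall (y i) (h * R i)) (hmQ : ∀ i, m i ≤ α * volume.real (Q i))
    (hH : ∀ i, IsTubeBump (K * m i) (R i) σ h e (y i) (H i)) :
    ∫ x, ‖∑ i, H i x‖ ^ 2 ≤ 2 * 22 ^ finrank ℝ E * volume.real (ball (0 : E) 1) *
      (K ^ 2 * σ * α * h ^ (finrank ℝ E - 1)) * ∑ i, m i := by
  classical
  set n := finrank ℝ E with hn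
  set B := volume.real (ball (0 : E) 1) with hB
  have hB0 : 0 ≤ B := measureReal_nonneg
  set a : ι → ι → ℝ := fun i j => ∫ x, ‖H i x‖ * ‖H j x‖ with ha
  have ha0 : ∀ i j, 0 ≤ a i j := fun i j => integral_nonneg fun _ => by positivity
  have hai : ∀ i j, Integrable fun x => ‖H i x‖ * ‖H j x‖ := fun i j =>
    (hH i).integrable_mul (hH j).integrable
  have hsymm : ∀ i j, a i j = a j i := fun i j => by simp only [ha, mul_comm]
  have hrow : ∀ i, ∑ j with R j ≤ R i, a i j ≤
      22 ^ n * B * (K ^ 2 * σ * α * h ^ (n - 1)) * m i := by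
    intro i
    have hRi := hR i
    set J : Finset ι := {j | R j ≤ R i ∧ a i j ≠ 0} with hJ
    have hsub : ∀ j ∈ J, Q j ⊆ (fun x => x - y i) ⁻¹' tube e h (11 * R i) := by
      intro j hj q hq
      obtain ⟨hji, haij⟩ := (Finset.mem_filter.1 hj).2
      obtain ⟨x, hx⟩ : ∃ x, ‖H i x‖ * ‖H j x‖ ≠ 0 := by
        by_contra! hcon
        exact haij (by simp [ha, hcon])
      have hxi : H i x ≠ 0 := fun hc => hx (by simp [hc])
      have hxj : H j x ≠ 0 := fun hc => hx (by simp [hc])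
      have h1 := (hH i).mem_tube x hxi
      have h2 := neg_mem_tube ((hH j).mem_tube x hxj)
      have h3 : q - y j ∈ tube e h (R j) := mem_tube_of_norm_le he hh1 (hR j).le
        (by simpa [dist_eq_norm] using hQs j hq)
      have h4 := add_mem_tube (add_mem_tube h1 h2) h3
      rw [show x - y i + -(x - y j) + (q - y j) = q - y i by abel] at h4
      exact tube_subset_tube hh.le (by linarith) h4
    have hvol : ∑ j ∈ J, volume.real (Q j) ≤ h ^ (n - 1) * ((2 * (11 * R i)) ^ n * B) := by
      have hfin : volume (tube e h (11 * R i)) ≠ ⊤ := (isBounded_tube e h _).measure_lt_top.ne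
      have hpre : volume ((fun x => x - y i) ⁻¹' tube e h (11 * R i)) =
          volume (tube e h (11 * R i)) :=
        (measurePreserving_sub_right volume (y i)).measure_preimage
          (isClosed_tube e h _).measurableSet.nullMeasurableSet
      rw [← measureReal_biUnion_finset (fun j _ k _ hjk => hQd hjk) (fun j _ => hQm j)
        (fun j hj => ((measure_mono (hsub j hj)).trans_lt (by rw [hpre]; exact hfin.lt_top)).ne)]
      refine (measureReal_mono (Set.iUnion₂_subset hsub) (by rw [hpre]; exact hfin)).trans ?_
      rw [measureReal_def, hpre, ← measureReal_def]
      exact volume_real_tube_le he hh (by positivity)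
    have hterm : ∀ j, a i j ≤ K * m i / R i ^ n * (K * m j * σ) := by
      intro j
      have hKi := (hH i).nonneg (hR i)
      calc a i j ≤ ∫ x, K * m i / R i ^ n * ‖H j x‖ :=
            integral_mono (hai i j) ((hH j).integrable.norm.const_mul _) fun x => by
              dsimp only
              gcongr
              exact (hH i).norm_le x
        _ ≤ _ := by
            rw [integral_const_mul]
            gcongr
            exact (hH j).integral_norm_le
    calc ∑ j with R j ≤ R i, a i j = ∑ j ∈ J, a i j := by
          rw [hJ, ← Finset.filter_filter, Finset.sum_filter_ne_zero]
      _ ≤ ∑ j ∈ J, K * m i / R i ^ n * (K * (α * volume.real (Q j)) * σ) := by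
          refine Finset.sum_le_sum fun j _ => (hterm j).trans ?_
          have := hm i
          gcongr
          exact hmQ j
      _ = K * m i / R i ^ n * (K * α * σ) * ∑ j ∈ J, volume.real (Q j) := by
          rw [Finset.mul_sum]
          exact Finset.sum_congr rfl fun j _ => by ring
      _ ≤ K * m i / R i ^ n * (K * α * σ) * (h ^ (n - 1) * ((2 * (11 * R i)) ^ n * B)) := by
          have := hm i
          gcongr
      _ = _ := by
          rw [show 2 * (11 * R i) = 22 * R i by ring, mul_pow]
          field_simp
  have hle : ∀ i j, a i j ≤ (if R j ≤ R i then a i j else 0) + (if R i ≤ R j then a j i else 0) := by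
    intro i j
    rcases le_total (R j) (R i) with h1 | h1
    · rw [if_pos h1]
      have : 0 ≤ (if R i ≤ R j then a j i else 0) := by split_ifs <;> simp [ha0]
      linarith
    · rw [if_pos h1, hsymm i j]
      have : 0 ≤ (if R j ≤ R i then a j i else 0) := by split_ifs <;> simp [ha0]
      linarith
  calc ∫ x, ‖∑ i, H i x‖ ^ 2 ≤ ∫ x, ∑ i, ∑ j, ‖H i x‖ * ‖H j x‖ := by
        refine integral_mono_of_nonneg (ae_of_all _ fun x => by positivity)
          (integrable_finsetSum _ fun i _ => integrable_finsetSum _ fun j _ => hai i j)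
          (ae_of_all _ fun x => ?_)
        dsimp only
        rw [← Finset.sum_mul_sum, ← sq]
        gcongr
        exact norm_sum_le _ _
    _ = ∑ i, ∑ j, a i j := by
        rw [integral_finsetSum _ fun i _ => integrable_finsetSum _ fun j _ => hai i j]
        exact Finset.sum_congr rfl fun i _ => integral_finsetSum _ fun j _ => hai i j
    _ ≤ ∑ i, ∑ j, ((if R j ≤ R i then a i j else 0) + (if R i ≤ R j then a j i else 0)) :=
        Finset.sum_le_sum fun i _ => Finset.sum_le_sum fun j _ => hle i j
    _ = 2 * ∑ i, ∑ j with R j ≤ R i, a i j := by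
        simp only [Finset.sum_add_distrib, Finset.sum_filter]
        rw [Finset.sum_comm (f := fun i j => if R i ≤ R j then a j i else 0)]
        ring
    _ ≤ 2 * ∑ i, 22 ^ n * B * (K ^ 2 * σ * α * h ^ (n - 1)) * m i := by
        gcongr with i
        exact hrow i
    _ = _ := by
        rw [← Finset.mul_sum]
        ring

end Packing

section FourierSide

open Module
open scoped RealInnerProductSpace FourierTransform

variable {E : Type*} [NormedAddCommGroup E] [InnerProductSpace ℝ E] [FiniteDimensional ℝ E]
  [MeasurableSpace E] [BorelSpace E]

theorem continuous_fourier {f : E → ℂ} (hf : Integrable f) : Continuous (𝓕 f) :=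
  VectorFourier.fourierIntegral_continuous Real.continuous_fourierChar
    (L := innerₗ E) (by exact continuous_inner) hf

theorem memLp_two_fourier {f : E → ℂ} (h1 : Integrable f) (h2 : MemLp f 2) : MemLp (𝓕 f) 2 :=
  ⟨(continuous_fourier h1).aestronglyMeasurable, by
    rw [eLpNorm_fourier_eq_of_integrable h1 h2]; exact h2.2⟩

theorem integral_norm_fourier_sq {f : E → ℂ} (h1 : Integrable f) (h2 : MemLp f 2) :
    ∫ ξ, ‖𝓕 f ξ‖ ^ 2 = ∫ x, ‖f x‖ ^ 2 := by
  have h := eLpNorm_fourier_eq_of_integrable h1 h2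
  rw [h2.eLpNorm_eq_integral_rpow_norm (by norm_num) (by norm_num),
    (memLp_two_fourier h1 h2).eLpNorm_eq_integral_rpow_norm (by norm_num) (by norm_num)] at h
  simp only [ENNReal.toReal_ofNat, Real.rpow_ofNat, ← one_div, ← Real.sqrt_eq_rpow] at h
  rw [ENNReal.ofReal_eq_ofReal_iff (Real.sqrt_nonneg _) (Real.sqrt_nonneg _)] at h
  exact (Real.sqrt_inj (integral_nonneg fun _ => by positivity)
    (integral_nonneg fun _ => by positivity)).1 h

theorem fourier_finset_sum {ι : Type*} (s : Finset ι) {f : ι → E → ℂ}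
    (hf : ∀ i ∈ s, Integrable (f i)) (ξ : E) :
    𝓕 (fun x => ∑ i ∈ s, f i x) ξ = ∑ i ∈ s, 𝓕 (f i) ξ := by
  simp only [Real.fourier_eq, Finset.smul_sum]
  exact integral_finsetSum _ fun i hi => (Real.fourierIntegral_convergent_iff ξ).2 (hf i hi)

/-- Cauchy-Schwarz with weights. -/
theorem norm_sum_mul_sq_le {N : ℕ} {σ m : Fin N → ℝ} {a : Fin N → ℂ} {P : ℝ}
    (hσ : ∀ ν, 0 ≤ σ ν) (ha : ∀ ν, σ ν = 0 → a ν = 0) (hP : ∑ ν, m ν ^ 2 * σ ν ≤ P) :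
    ‖∑ ν, (m ν : ℂ) * a ν‖ ^ 2 ≤ P * ∑ ν, ‖a ν‖ ^ 2 / σ ν := by
  have hpt : ∀ ν, ‖(m ν : ℂ) * a ν‖ = (|m ν| * √(σ ν)) * (‖a ν‖ / √(σ ν)) := by
    intro ν
    rw [norm_mul, Complex.norm_real, Real.norm_eq_abs]
    rcases eq_or_ne (σ ν) 0 with h0 | h0
    · simp [ha ν h0]
    · have := Real.sqrt_pos.2 ((hσ ν).lt_of_ne' h0)
      field_simp
  calc ‖∑ ν, (m ν : ℂ) * a ν‖ ^ 2
      ≤ (∑ ν, (|m ν| * √(σ ν)) * (‖a ν‖ / √(σ ν))) ^ 2 := by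
        gcongr
        exact (norm_sum_le _ _).trans_eq (Finset.sum_congr rfl fun ν _ => hpt ν)
    _ ≤ (∑ ν, (|m ν| * √(σ ν)) ^ 2) * ∑ ν, (‖a ν‖ / √(σ ν)) ^ 2 :=
        Finset.sum_mul_sq_le_sq_mul_sq _ _ _
    _ = (∑ ν, m ν ^ 2 * σ ν) * ∑ ν, ‖a ν‖ ^ 2 / σ ν := by
        simp only [mul_pow, div_pow, Real.sq_sqrt (hσ _), sq_abs]
    _ ≤ _ := by
        gcongr
        exact Finset.sum_nonneg fun ν _ => div_nonneg (by positivity) (hσ ν)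

/-- A sum of multipliers acting on functions with small `L²` norm. -/
theorem exists_integrable_majorant {N : ℕ} {σ : Fin N → ℝ} {m : Fin N → E → ℝ}
    {G : Fin N → E → ℂ} {P c : ℝ} (hσ : ∀ ν, 0 ≤ σ ν) (hc : 0 ≤ c)
    (hG1 : ∀ ν, Integrable (G ν)) (hG2 : ∀ ν, MemLp (G ν) 2) (hP0 : 0 ≤ P)
    (hP : ∀ ξ, ∑ ν, m ν ξ ^ 2 * σ ν ≤ P) (hGc : ∀ ν, ∫ x, ‖G ν x‖ ^ 2 ≤ c * σ ν) :
    ∃ Φ : E → ℝ, Integrable Φ ∧ (∀ ξ, ‖∑ ν, (m ν ξ : ℂ) * 𝓕 (G ν) ξ‖ ^ 2 ≤ Φ ξ) ∧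
      ∫ ξ, Φ ξ ≤ P * (N * c) := by
  have hi : ∀ ν, Integrable fun ξ => ‖𝓕 (G ν) ξ‖ ^ 2 := fun ν =>
    (memLp_two_iff_integrable_sq_norm (memLp_two_fourier (hG1 ν) (hG2 ν)).1).1
      (memLp_two_fourier (hG1 ν) (hG2 ν))
  have hsum : Integrable fun ξ => ∑ ν, ‖𝓕 (G ν) ξ‖ ^ 2 / σ ν :=
    integrable_finsetSum _ fun ν _ => (hi ν).div_const _
  refine ⟨fun ξ => P * ∑ ν, ‖𝓕 (G ν) ξ‖ ^ 2 / σ ν, hsum.const_mul P,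
    fun ξ => norm_sum_mul_sq_le hσ (fun ν hν => ?_) (hP ξ), ?_⟩
  · have h0 : ∫ x, ‖G ν x‖ ^ 2 = 0 :=
      le_antisymm (by simpa [hν] using hGc ν) (integral_nonneg fun _ => by positivity)
    rw [integral_eq_zero_iff_of_nonneg (fun _ => by positivity)
      ((memLp_two_iff_integrable_sq_norm (hG2 ν).1).1 (hG2 ν))] at h0
    have h1 : G ν =ᵐ[volume] fun _ => 0 := by
      filter_upwards [h0] with x hx
      simpa using hx
    rw [Real.fourier_eq, integral_congr_ae (g := fun _ => 0), integral_zero]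
    filter_upwards [h1] with x hx
    simp [hx]
  · rw [integral_const_mul, integral_finsetSum _ fun ν _ => (hi ν).div_const _]
    gcongr
    calc ∑ ν, ∫ ξ, ‖𝓕 (G ν) ξ‖ ^ 2 / σ ν ≤ ∑ _ν : Fin N, c := by
          refine Finset.sum_le_sum fun ν _ => ?_
          rw [integral_div, integral_norm_fourier_sq (hG1 ν) (hG2 ν)]
          exact div_le_of_le_mul₀ (hσ ν) hc (hGc ν)
      _ = N * c := by simp

theorem sq_multiplier_le {e : E} (he : ‖e‖ = 1) {v : E} (hv : ‖v‖ = 1) {M : ℝ} (hM : 1 ≤ M)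
    (ξ : E) :
    ((M ^ 2 + 2 * M) * ⟪e, ξ⟫ * ⟪v, ξ⟫ / ‖stretch e M ξ‖ ^ 2) ^ 2 ≤ M ^ 2 := by
  rw [norm_stretch_sq he]
  have hs : |⟪v, ξ⟫| ≤ ‖ξ‖ := (abs_real_inner_le_norm v ξ).trans (by rw [hv, one_mul])
  have hs2 : ⟪v, ξ⟫ ^ 2 ≤ ‖ξ‖ ^ 2 := sq_le_sq' (abs_le.1 hs).1 (abs_le.1 hs).2
  set s := ⟪e, ξ⟫
  set b := ⟪v, ξ⟫
  set x := ‖ξ‖ ^ 2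
  have hK : M ^ 2 + 2 * M ≤ 4 * M ^ 2 := by nlinarith
  have hK0 : 0 ≤ M ^ 2 + 2 * M := by positivity
  set K := M ^ 2 + 2 * M
  have hx : 0 ≤ x := by positivity
  rw [div_pow]
  refine div_le_of_le_mul₀ (by positivity) (by positivity) ?_
  calc (K * s * b) ^ 2 = K * (K * s ^ 2 * b ^ 2) := by ring
    _ ≤ (4 * M ^ 2) * (K * s ^ 2 * x) := by gcongr
    _ ≤ M ^ 2 * (x + K * s ^ 2) ^ 2 := by
        have : 4 * (K * s ^ 2 * x) ≤ (x + K * s ^ 2) ^ 2 := by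
          nlinarith [sq_nonneg (x - K * s ^ 2)]
        nlinarith [sq_nonneg M]

end FourierSide

section ScaleEstimate

open Module
open scoped RealInnerProductSpace FourierTransform

variable {E : Type*} [NormedAddCommGroup E] [InnerProductSpace ℝ E] [FiniteDimensional ℝ E]
  [MeasurableSpace E] [BorelSpace E]

/-- A finite family of atoms `b i` of radius at most `t⁸ R i`, adapted to disjoint sets `Q i` of
density at most `α`. -/
structure IsAtomFamily {ι : Type} (α t : ℝ) (R : ι → ℝ) (y : ι → E) (Q : ι → Set E)
    (b : ι → E → ℂ) : Prop where
  R_pos : ∀ i, 0 < R i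
  integrable : ∀ i, Integrable (b i)
  norm_sub_le : ∀ i x, b i x ≠ 0 → ‖x - y i‖ ≤ t ^ 8 * R i
  integral_eq_zero : ∀ i, ∫ x, b i x = 0
  measurableSet : ∀ i, MeasurableSet (Q i)
  disjoint : Pairwise fun i j => Disjoint (Q i) (Q j)
  subset : ∀ i, Q i ⊆ closedBall (y i) (t ^ 8 * R i)
  integral_norm_le : ∀ i, ∫ x, ‖b i x‖ ≤ α * volume.real (Q i)

/-- The kernel cutoffs at the scale `R`. -/
structure IsScaleCutoff (D R : ℝ) (g : E → ℝ) : Prop where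
  contDiff : ContDiff ℝ 1 g
  norm_le : ∀ z, g z ≠ 0 → ‖z‖ ≤ 2 * R
  abs_le : ∀ z, |g z| ≤ D / R ^ (finrank ℝ E + 2)
  norm_fderiv_le : ∀ z, ‖fderiv ℝ g z‖ ≤ D / R ^ (finrank ℝ E + 3)

/-- A bounded homogeneous symbol. -/
structure IsBoundedSymbol (W : ℝ) (ω : E → ℝ) : Prop where
  measurable : Measurable ω
  abs_le : ∀ z, |ω z| ≤ W
  smul : ∀ r : ℝ, 0 < r → ∀ z, z ≠ 0 → ω (r • z) = ω z

theorem IsConePartition.isConeKernel {t R : ℝ} {L : NNReal} {W D : ℝ} {N : ℕ} {e : Fin N → E}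
    {S : Fin N → Set E} {ω g A : E → ℝ} (hS : IsConePartition (t ^ 4) e S) (ht : 0 < t)
    (ht1 : t ≤ 1) (hR : 0 < R) (hω : IsBoundedSymbol W ω) (hg : IsScaleCutoff D R g)
    (hA : LipschitzWith L A) (ν : Fin N) :
    IsConeKernel t R L W D (e ν) (S ν) ((S ν).indicator ω) g A where
  t_pos := ht
  t_le_one := ht1
  R_pos := hR
  norm_e := hS.norm_eq_one ν
  measurableSet := hS.measurableSet ν
  smul_mem := hS.smul_mem ν
  norm_sub_le := hS.norm_sub_le ν
  measurable_ω := hω.measurable.indicator (hS.measurableSet ν)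
  abs_ω_le z := by
    by_cases hz : z ∈ S ν
    · rw [Set.indicator_of_mem hz]; exact hω.abs_le z
    · rw [Set.indicator_of_notMem hz, abs_zero]; exact (abs_nonneg _).trans (hω.abs_le z)
  ω_smul r hr z hz := by
    by_cases h : z ∈ S ν
    · rw [Set.indicator_of_mem h, Set.indicator_of_mem ((hS.smul_mem ν r hr z).2 h),
        hω.smul r hr z hz]
    · rw [Set.indicator_of_notMem h, Set.indicator_of_notMem
        (fun hc => h ((hS.smul_mem ν r hr z).1 hc))]
  mem_of_ω_ne_zero z hz := by
    by_contra hc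
    exact hz (Set.indicator_of_notMem hc _)
  contDiff_g := hg.contDiff
  norm_le_of_g_ne_zero := hg.norm_le
  abs_g_le := hg.abs_le
  norm_fderiv_g_le := hg.norm_fderiv_le
  lipschitz_A := hA

theorem IsConePartition.sum_indicator {h : ℝ} {N : ℕ} {e : Fin N → E} {S : Fin N → Set E}
    (hS : IsConePartition h e S) {z : E} (hz : z ≠ 0) (ω : E → ℝ) :
    ∑ ν, (S ν).indicator ω z = ω z := by
  obtain ⟨ν, hν⟩ := hS.exists_mem z hz
  rw [Finset.sum_eq_single ν, Set.indicator_of_mem hν]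
  · intro μ _ hμ
    exact Set.indicator_of_notMem (fun hc => Set.disjoint_left.1 (hS.disjoint hμ) hc hν) _
  · simp

theorem IsConePartition.kernelOp_eq_sum {t R : ℝ} {L : NNReal} {W D : ℝ} {N : ℕ} {e : Fin N → E}
    {S : Fin N → Set E} {ω g A : E → ℝ} (hS : IsConePartition (t ^ 4) e S) (ht : 0 < t)
    (ht1 : t ≤ 1) (hR : 0 < R) (hω : IsBoundedSymbol W ω) (hg : IsScaleCutoff D R g)
    (hA : LipschitzWith L A) {b : E → ℂ} (hb : Integrable b) (x : E) :
    kernelOp (pieceKer ω g A fun _ => 1) b x =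
      ∑ ν, kernelOp (pieceKer ((S ν).indicator ω) g A fun _ => 1) b x := by
  have hbx : Integrable fun z => b (x - z) := hb.comp_sub_left x
  have hint : ∀ ν, Integrable fun z =>
      (pieceKer ((S ν).indicator ω) g A (fun _ => 1) z (x - z) : ℂ) * b (x - z) := by
    intro ν
    have h := hS.isConeKernel ht ht1 hR hω hg hA ν
    have hW := h.W_nonneg
    have hD := h.D_nonneg
    refine hbx.bdd_mul (c := 4 * 1 * (W * D * L / R ^ finrank ℝ E))
      (Complex.measurable_ofReal.comp ((h.measurable_pieceKer (c := fun _ => 1)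
        measurable_const).comp (measurable_id.prodMk
        (measurable_const.sub measurable_id)))).aestronglyMeasurable (ae_of_all _ fun z => ?_)
    rw [Complex.norm_real]
    exact (h.abs_pieceKer_le zero_le_one (fun _ _ => by simp) z _).trans
      (mul_le_of_le_one_right (by positivity) (coneInd_le_one _ _ _))
  simp only [kernelOp]
  rw [← integral_finsetSum _ fun ν _ => hint ν]
  congr 1 with z
  rw [← Finset.sum_mul, ← Complex.ofReal_sum]
  congr 2
  by_cases hz : z = 0
  · simp [pieceKer, hz]
  · simp only [pieceKer, ← Finset.sum_mul, hS.sum_indicator hz]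

/-- The scale estimate: at relative scale `t⁻⁸` the operator splits into a part that is small
in `L¹` and a part that is small in `L²`. -/
theorem exists_scale_split (E : Type*) [NormedAddCommGroup E] [InnerProductSpace ℝ E]
    [FiniteDimensional ℝ E] [MeasurableSpace E] [BorelSpace E] [Nontrivial E] :
    ∃ C : ℝ, 0 ≤ C ∧ ∀ {ι : Type} [Fintype ι] {α t : ℝ} {R : ι → ℝ} {y : ι → E} {Q : ι → Set E}
      {b : ι → E → ℂ} {L : NNReal} {W D : ℝ} {ω A : E → ℝ} {g : ι → E → ℝ}, 0 ≤ α → 0 < t → t ≤ 1 →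
      0 ≤ W → 0 ≤ D →
      IsAtomFamily α t R y Q b → IsBoundedSymbol W ω → (∀ i, IsScaleCutoff D (R i) (g i)) →
      LipschitzWith L A →
      ∃ u₁ u₂ : E → ℂ,
        (∀ x, ∑ i, kernelOp (pieceKer ω (g i) A fun _ => 1) (b i) x = u₁ x + u₂ x) ∧
        Integrable u₁ ∧ ∫ x, ‖u₁ x‖ ≤ C * (W * D * L) * t ^ 2 * ∑ i, ∫ x, ‖b i x‖ ∧
        MemLp u₂ 2 ∧ ∫ x, ‖u₂ x‖ ^ 2 ≤ C * (W * D * L) ^ 2 * α * t * ∑ i, ∫ x, ‖b i x‖ := by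
  set n := finrank ℝ E with hn
  set B := volume.real (ball (0 : E) 1) with hB
  have hB0 : 0 ≤ B := measureReal_nonneg
  have hcap := capConst_nonneg (E := E)
  set C₁ : ℝ := (4 * capConst E + 4 * n + 16) * (2 ^ n * B) with hC₁
  set C₂ : ℝ := (n + 1) * ((10 * 4 ^ n * B + n * (2 ^ n * B)) * (n * 4 ^ n) *
    (2 * 22 ^ n * B * 64)) with hC₂
  have hC₁0 : 0 ≤ C₁ := by positivity
  have hC₂0 : 0 ≤ C₂ := by positivity
  refine ⟨C₁ + C₂, by positivity, ?_⟩
  intro ι _ α t R y Q b L W D ω A g hα ht ht1 hW hD hb hω hg hA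
  obtain ⟨N, e, S, hS, hN⟩ := exists_isConePartition (E := E) (h := t ^ 4) (by positivity)
    (pow_le_one₀ ht.le ht1)
  have hker := fun i ν => hS.isConeKernel ht ht1 (hb.R_pos i) hω (hg i) hA ν
  have hsplit := fun i ν => (hker i ν).exists_split (stdOrthonormalBasis ℝ E) (hb.integrable i)
    le_rfl (hb.norm_sub_le i) (hb.integral_eq_zero i)
  choose F₁ F₂ H G hsum hF₁ hF₁n hF₂ hF₂2 hH hG hFour using hsplit
  set m : ι → ℝ := fun i => ∫ x, ‖b i x‖ with hm
  have hm0 : ∀ i, 0 ≤ m i := fun i => integral_nonneg fun _ => norm_nonneg _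
  have hms : 0 ≤ ∑ i, m i := Finset.sum_nonneg fun i _ => hm0 i
  set σ : Fin N → ℝ := fun ν => volume.real (S ν ∩ closedBall 0 2) with hσ
  have hσ0 : ∀ ν, 0 ≤ σ ν := fun ν => measureReal_nonneg
  have hσs : ∑ ν, σ ν ≤ 2 ^ n * B := (sum_volume_real_cone_le hS measurableSet_closedBall
    measure_closedBall_lt_top.ne).trans_eq (volume_real_closedBall_le _ (by norm_num))
  have hM : 1 ≤ (t ^ 2)⁻¹ := (one_le_inv₀ (by positivity)).2 (pow_le_one₀ ht.le ht1)
  have hQs : ∀ i, Q i ⊆ closedBall (y i) (t ^ 4 * R i) := fun i =>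
    (hb.subset i).trans (closedBall_subset_closedBall (by
      have := (hb.R_pos i).le
      gcongr ?_ * _
      exact pow_le_pow_of_le_one ht.le ht1 (by norm_num)))
  refine ⟨fun x => ∑ i, ∑ ν, F₁ i ν x, fun x => ∑ i, ∑ ν, F₂ i ν x, fun x => ?_,
    integrable_finsetSum _ fun i _ => integrable_finsetSum _ fun ν _ => hF₁ i ν, ?_, ?_, ?_⟩
  · rw [← Finset.sum_add_distrib]
    refine Finset.sum_congr rfl fun i _ => ?_
    rw [hS.kernelOp_eq_sum ht ht1 (hb.R_pos i) hω (hg i) hA (hb.integrable i),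
      ← Finset.sum_add_distrib]
    exact Finset.sum_congr rfl fun ν _ => hsum i ν x
  · calc ∫ x, ‖∑ i, ∑ ν, F₁ i ν x‖ ≤ ∫ x, ∑ i, ∑ ν, ‖F₁ i ν x‖ :=
          integral_mono_of_nonneg (ae_of_all _ fun _ => norm_nonneg _)
            (integrable_finsetSum _ fun i _ => integrable_finsetSum _ fun ν _ => (hF₁ i ν).norm)
            (ae_of_all _ fun x => (norm_sum_le _ _).trans
              (Finset.sum_le_sum fun i _ => norm_sum_le _ _))
      _ = ∑ i, ∑ ν, ∫ x, ‖F₁ i ν x‖ := by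
          rw [integral_finsetSum _ fun i _ => integrable_finsetSum _ fun ν _ => (hF₁ i ν).norm]
          exact Finset.sum_congr rfl fun i _ => integral_finsetSum _ fun ν _ => (hF₁ i ν).norm
      _ ≤ ∑ i, ∑ ν, (4 * capConst E + 4 * n + 16) * (W * D * L) * σ ν * t ^ 2 * m i :=
          Finset.sum_le_sum fun i _ => Finset.sum_le_sum fun ν _ => hF₁n i ν
      _ = (4 * capConst E + 4 * n + 16) * (W * D * L) * (∑ ν, σ ν) * t ^ 2 * ∑ i, m i := by
          rw [Finset.mul_sum]
          refine Finset.sum_congr rfl fun i _ => ?_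
          rw [Finset.mul_sum, Finset.sum_mul, Finset.sum_mul]
      _ ≤ (4 * capConst E + 4 * n + 16) * (W * D * L) * (2 ^ n * B) * t ^ 2 * ∑ i, m i := by
          gcongr
      _ = C₁ * (W * D * L) * t ^ 2 * ∑ i, m i := by rw [hC₁]; ring
      _ ≤ (C₁ + C₂) * (W * D * L) * t ^ 2 * ∑ i, m i := by
          gcongr
          linarith
  · exact memLp_finsetSum _ fun i _ => memLp_finsetSum _ fun ν _ => hF₂2 i ν
  · have hF₂i : Integrable fun x => ∑ i, ∑ ν, F₂ i ν x :=
      integrable_finsetSum _ fun i _ => integrable_finsetSum _ fun ν _ => hF₂ i ν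
    have hF₂m : MemLp (fun x => ∑ i, ∑ ν, F₂ i ν x) 2 :=
      memLp_finsetSum _ fun i _ => memLp_finsetSum _ fun ν _ => hF₂2 i ν
    rw [← integral_norm_fourier_sq hF₂i hF₂m]
    set T₄ : ℝ := 2 * 22 ^ n * B * (64 * (W * D * L) ^ 2 * α * (t ^ 4) ^ (n - 1)) * ∑ i, m i
      with hT₄
    have hT₄0 : 0 ≤ T₄ := by positivity
    have hHp : ∀ ν, ∫ x, ‖∑ i, H i ν x‖ ^ 2 ≤ T₄ * σ ν := fun ν => by
      refine (integral_norm_sum_sq_le (hS.norm_eq_one ν) (by positivity) (pow_le_one₀ ht.le ht1)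
        (K := 8 * (W * D * L)) (by positivity) (hσ0 ν) hα hb.R_pos hm0 hb.measurableSet
        hb.disjoint hQs hb.integral_norm_le fun i => hH i ν).trans_eq ?_
      rw [hT₄]
      ring
    have hGp : ∀ k ν, ∫ x, ‖∑ i, G i ν k x‖ ^ 2 ≤ t ^ 8 * T₄ * σ ν := fun k ν => by
      refine (integral_norm_sum_sq_le (hS.norm_eq_one ν) (by positivity) (pow_le_one₀ ht.le ht1)
        (K := 8 * t ^ 4 * (W * D * L)) (by positivity) (hσ0 ν) hα hb.R_pos hm0 hb.measurableSet
        hb.disjoint hQs hb.integral_norm_le fun i => hG i ν k).trans_eq ?_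
      rw [hT₄]
      ring
    obtain ⟨Φ, hΦi, hΦ, hΦn⟩ := exists_integrable_majorant
      (m := fun ν ξ => ‖ξ‖ ^ 2 / ‖stretch (e ν) (t ^ 2)⁻¹ ξ‖ ^ 2)
      (G := fun ν x => ∑ i, H i ν x) hσ0 hT₄0
      (fun ν => integrable_finsetSum _ fun i _ => (hH i ν).integrable)
      (fun ν => memLp_finsetSum _ fun i _ => (hH i ν).memLp_two)
      (P := 10 * 4 ^ n * B * t) (by positivity)
      (fun ξ => sum_sq_mul_volume_cone_le ht ht1 hS ξ) hHp
    have hΨ := fun k => exists_integrable_majorant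
      (m := fun ν ξ => ((t ^ 2)⁻¹ ^ 2 + 2 * (t ^ 2)⁻¹) * ⟪e ν, ξ⟫ *
        ⟪stdOrthonormalBasis ℝ E k, ξ⟫ / ‖stretch (e ν) (t ^ 2)⁻¹ ξ‖ ^ 2)
      (G := fun ν x => ∑ i, G i ν k x) hσ0 (c := t ^ 8 * T₄) (by positivity)
      (fun ν => integrable_finsetSum _ fun i _ => (hG i ν k).integrable)
      (fun ν => memLp_finsetSum _ fun i _ => (hG i ν k).memLp_two)
      (P := (t ^ 2)⁻¹ ^ 2 * (2 ^ n * B)) (by positivity)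
      (fun ξ => by
        calc _ ≤ ∑ ν, (t ^ 2)⁻¹ ^ 2 * σ ν := by
              refine Finset.sum_le_sum fun ν _ => ?_
              have := sq_multiplier_le (hS.norm_eq_one ν)
                ((stdOrthonormalBasis ℝ E).norm_eq_one k) hM ξ
              have h' := hσ0 ν
              gcongr
          _ ≤ _ := by
              rw [← Finset.mul_sum]
              gcongr) (hGp k)
    choose Ψ hΨi hΨ hΨn using hΨ
    have hfin : ∀ ξ, 𝓕 (fun x => ∑ i, ∑ ν, F₂ i ν x) ξ =
        ∑ ν, ((‖ξ‖ ^ 2 / ‖stretch (e ν) (t ^ 2)⁻¹ ξ‖ ^ 2 : ℝ) : ℂ) *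
          𝓕 (fun x => ∑ i, H i ν x) ξ +
        ∑ k, ∑ ν, ((((t ^ 2)⁻¹ ^ 2 + 2 * (t ^ 2)⁻¹) * ⟪e ν, ξ⟫ *
          ⟪stdOrthonormalBasis ℝ E k, ξ⟫ / ‖stretch (e ν) (t ^ 2)⁻¹ ξ‖ ^ 2 : ℝ) : ℂ) *
          𝓕 (fun x => ∑ i, G i ν k x) ξ := by
      intro ξ
      rw [fourier_finset_sum _ fun i _ => integrable_finsetSum _ fun ν _ => hF₂ i ν]
      simp_rw [fourier_finset_sum _ fun ν _ => hF₂ _ ν, hFour, Finset.sum_add_distrib]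
      congr 1
      · rw [Finset.sum_comm]
        refine Finset.sum_congr rfl fun ν _ => ?_
        rw [fourier_finset_sum _ fun i _ => (hH i ν).integrable, Finset.mul_sum]
      · rw [Finset.sum_comm]
        simp_rw [Finset.sum_comm (s := (Finset.univ : Finset ι))]
        rw [Finset.sum_comm]
        refine Finset.sum_congr rfl fun k _ => Finset.sum_congr rfl fun ν _ => ?_
        rw [fourier_finset_sum _ fun i _ => (hG i ν k).integrable, Finset.mul_sum]
    have hcs : ∀ (a : ℂ) (c : Fin n → ℂ),
        ‖a + ∑ k, c k‖ ^ 2 ≤ (n + 1) * (‖a‖ ^ 2 + ∑ k, ‖c k‖ ^ 2) := by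
      intro a c
      have h1 := sq_sum_le_card_mul_sum_sq (s := Finset.univ)
        (f := fun o : Option (Fin n) => ‖o.elim a c‖)
      have h2 : ‖a + ∑ k, c k‖ ≤ ∑ o : Option (Fin n), ‖o.elim a c‖ := by
        rw [Fintype.sum_option]
        exact (norm_add_le _ _).trans (add_le_add le_rfl (norm_sum_le _ _))
      have h3 : ‖a + ∑ k, c k‖ ^ 2 ≤ (∑ o : Option (Fin n), ‖o.elim a c‖) ^ 2 := by gcongr
      refine h3.trans (h1.trans_eq ?_)
      rw [Fintype.sum_option]
      simp
    calc ∫ ξ, ‖𝓕 (fun x => ∑ i, ∑ ν, F₂ i ν x) ξ‖ ^ 2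
        ≤ ∫ ξ, (n + 1) * (Φ ξ + ∑ k, Ψ k ξ) := by
          refine integral_mono_of_nonneg (ae_of_all _ fun _ => by positivity)
            ((hΦi.add (integrable_finsetSum _ fun k _ => hΨi k)).const_mul _)
            (ae_of_all _ fun ξ => ?_)
          dsimp only
          rw [hfin ξ]
          refine (hcs _ _).trans ?_
          gcongr with k
          · exact hΦ ξ
          · exact hΨ k ξ
      _ = (n + 1) * ((∫ ξ, Φ ξ) + ∑ k, ∫ ξ, Ψ k ξ) := by
          rw [integral_const_mul, integral_add hΦi (integrable_finsetSum _ fun k _ => hΨi k),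
            integral_finsetSum _ fun k _ => hΨi k]
      _ ≤ (n + 1) * (10 * 4 ^ n * B * t * (N * T₄) +
            ∑ _k : Fin n, (t ^ 2)⁻¹ ^ 2 * (2 ^ n * B) * (N * (t ^ 8 * T₄))) := by
          refine mul_le_mul_of_nonneg_left (add_le_add hΦn ?_) (by positivity)
          exact Finset.sum_le_sum fun k _ => hΨn k
      _ = (n + 1) * ((10 * 4 ^ n * B * t + n * (2 ^ n * B) * t ^ 4) * (N * T₄)) := by
          rw [Finset.sum_const, Finset.card_univ, Fintype.card_fin, nsmul_eq_mul]
          field_simp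
      _ ≤ (n + 1) * ((10 * 4 ^ n * B * t + n * (2 ^ n * B) * t) * (n * 4 ^ n *
            (2 * 22 ^ n * B * (64 * (W * D * L) ^ 2 * α) * ∑ i, m i))) := by
          have h4 : t ^ 4 ≤ t := pow_le_of_le_one ht.le ht1 (by norm_num)
          have h5 : N * T₄ ≤ n * 4 ^ n *
              (2 * 22 ^ n * B * (64 * (W * D * L) ^ 2 * α) * ∑ i, m i) := by
            calc N * T₄ = (N * (t ^ 4) ^ (n - 1)) *
                  (2 * 22 ^ n * B * (64 * (W * D * L) ^ 2 * α) * ∑ i, m i) := by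
                  rw [hT₄]; ring
              _ ≤ _ := by gcongr
          gcongr
      _ = C₂ * (W * D * L) ^ 2 * α * t * ∑ i, m i := by rw [hC₂]; ring
      _ ≤ (C₁ + C₂) * (W * D * L) ^ 2 * α * t * ∑ i, m i := by
          gcongr
          linarith

end ScaleEstimate

section Grid

variable {d : ℕ}

/-- The index of the cell of the grid of side length `s` that contains `x`. -/
def gridIndex (s : ℝ) (x : EuclideanSpace ℝ (Fin d)) : Fin d → ℤ := fun i => ⌊x i / s⌋

/-- The half-open cubes of side length `s`. -/
def gridCell (s : ℝ) (k : Fin d → ℤ) : Set (EuclideanSpace ℝ (Fin d)) := {x | gridIndex s x = k}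

theorem measurable_gridIndex (s : ℝ) :
    Measurable (gridIndex s : EuclideanSpace ℝ (Fin d) → Fin d → ℤ) := by
  refine measurable_pi_lambda _ fun i => Int.measurable_floor.comp (Measurable.div_const ?_ s)
  exact (EuclideanSpace.proj (𝕜 := ℝ) i).continuous.measurable

theorem measurableSet_gridCell (s : ℝ) (k : Fin d → ℤ) : MeasurableSet (gridCell s k) :=
  measurable_gridIndex s (measurableSet_singleton k)

theorem volume_real_gridCell {s : ℝ} (hs : 0 < s) (k : Fin d → ℤ) :
    volume.real (gridCell s k) = s ^ d := by
  have h : gridCell s k = (WithLp.ofLp : EuclideanSpace ℝ (Fin d) → Fin d → ℝ) ⁻¹'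
      Set.pi Set.univ fun i => Set.Ico (k i * s) (k i * s + s) := by
    ext x
    simp only [gridCell, gridIndex, Set.mem_preimage, Set.mem_univ_pi, Set.mem_ofPred_eq,
      funext_iff, Int.floor_eq_iff, Set.mem_Ico, le_div_iff₀ hs, div_lt_iff₀ hs, add_mul, one_mul]
  rw [measureReal_def, h, (PiLp.volume_preserving_ofLp (Fin d)).measure_preimage
    (MeasurableSet.univ_pi fun i => measurableSet_Ico).nullMeasurableSet, Real.volume_pi_Ico]
  simp [ENNReal.toReal_ofReal hs.le]

theorem norm_sub_le_of_gridIndex_eq {s : ℝ} (hs : 0 < s) {x y : EuclideanSpace ℝ (Fin d)}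
    (h : gridIndex s x = gridIndex s y) : ‖x - y‖ ≤ d * s := by
  have h1 : ∀ i, ‖(x - y) i‖ ≤ s := by
    intro i
    have h2 := Int.abs_sub_lt_one_of_floor_eq_floor (congr_fun h i)
    rw [← sub_div, abs_div, abs_of_pos hs, div_lt_one hs] at h2
    simpa using h2.le
  calc ‖x - y‖ ≤ ∑ i, ‖(x - y) i‖ := by
        rw [EuclideanSpace.norm_eq]
        refine Real.sqrt_le_iff.2 ⟨Finset.sum_nonneg fun _ _ => norm_nonneg _, ?_⟩
        exact Finset.sum_sq_le_sq_sum_of_nonneg fun _ _ => norm_nonneg _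
    _ ≤ ∑ _i : Fin d, s := Finset.sum_le_sum fun i _ => h1 i
    _ = d * s := by simp

theorem gridIndex_two_mul {s : ℝ} {x y : EuclideanSpace ℝ (Fin d)}
    (h : gridIndex s x = gridIndex s y) : gridIndex (2 * s) x = gridIndex (2 * s) y := by
  funext i
  have key : ∀ z : EuclideanSpace ℝ (Fin d), gridIndex (2 * s) z i = gridIndex s z i / 2 := by
    intro z
    have := Int.floor_div_natCast (z i / s) 2
    simp only [gridIndex]
    rw [show z i / (2 * s) = z i / s / ((2 : ℕ) : ℝ) by rw [div_div]; congr 1; push_cast; ring]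
    simpa using this
  rw [key, key, h]

theorem gridIndex_dyadic {δ : ℝ} {x y : EuclideanSpace ℝ (Fin d)} {m m' : ℕ} (hm : m ≤ m')
    (h : gridIndex (δ * 2 ^ m) x = gridIndex (δ * 2 ^ m) y) :
    gridIndex (δ * 2 ^ m') x = gridIndex (δ * 2 ^ m') y := by
  induction m', hm using Nat.le_induction with
  | base => exact h
  | succ k _ ih =>
    have := gridIndex_two_mul ih
    rwa [show 2 * (δ * 2 ^ k) = δ * 2 ^ (k + 1) by ring] at this

theorem finite_image_gridIndex {s B : ℝ} (hs : 0 < s) :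
    (gridIndex s '' (closedBall (0 : EuclideanSpace ℝ (Fin d)) B)).Finite := by
  refine (Set.finite_Icc (fun _ : Fin d => ⌊-B / s⌋) (fun _ => ⌊B / s⌋)).subset ?_
  rintro _ ⟨x, hx, rfl⟩
  have h : ∀ i, |x i| ≤ B := fun i =>
    (PiLp.norm_apply_le x i).trans (by simpa using hx)
  refine ⟨fun i => Int.floor_le_floor ?_, fun i => Int.floor_le_floor ?_⟩
  · exact div_le_div_of_nonneg_right (neg_le_of_abs_le (h i)) hs.le
  · exact div_le_div_of_nonneg_right (le_of_abs_le (h i)) hs.le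

end Grid

section Stopping

variable {d : ℕ}

/-- The dyadic cell of level `m` through `x` carries a large part of the mass of `f`. -/
def IsHeavy (α δ : ℝ) (f : EuclideanSpace ℝ (Fin d) → ℂ) (m : ℕ)
    (x : EuclideanSpace ℝ (Fin d)) : Prop :=
  α * (δ * 2 ^ m) ^ d < ∫ y in gridCell (δ * 2 ^ m) (gridIndex (δ * 2 ^ m) x), ‖f y‖

/-- The cell of level `m` through `x` is the largest heavy cell that contains `x`. -/
def IsMaxHeavy (α δ : ℝ) (f : EuclideanSpace ℝ (Fin d) → ℂ) (m : ℕ)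
    (x : EuclideanSpace ℝ (Fin d)) : Prop :=
  IsHeavy α δ f m x ∧ ∀ m', m < m' → ¬ IsHeavy α δ f m' x

/-- The points of the cell `p.2` of level `p.1`, provided it is a maximal heavy cell. -/
def heavyCell (α δ : ℝ) (f : EuclideanSpace ℝ (Fin d) → ℂ) (p : ℕ × (Fin d → ℤ)) :
    Set (EuclideanSpace ℝ (Fin d)) :=
  {x | gridIndex (δ * 2 ^ p.1) x = p.2 ∧ IsMaxHeavy α δ f p.1 x}

variable {α δ : ℝ} {f : EuclideanSpace ℝ (Fin d) → ℂ} {m : ℕ} {x y : EuclideanSpace ℝ (Fin d)}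
  {p : ℕ × (Fin d → ℤ)}

theorem isHeavy_congr {m' : ℕ} (hm : m ≤ m')
    (h : gridIndex (δ * 2 ^ m) x = gridIndex (δ * 2 ^ m) y) :
    IsHeavy α δ f m' x ↔ IsHeavy α δ f m' y := by
  rw [IsHeavy, IsHeavy, gridIndex_dyadic hm h]

theorem isMaxHeavy_congr (h : gridIndex (δ * 2 ^ m) x = gridIndex (δ * 2 ^ m) y) :
    IsMaxHeavy α δ f m x ↔ IsMaxHeavy α δ f m y := by
  rw [IsMaxHeavy, IsMaxHeavy, isHeavy_congr le_rfl h]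
  refine and_congr_right fun _ => forall_congr' fun m' => imp_congr_right fun hm => ?_
  rw [isHeavy_congr hm.le h]

theorem heavyCell_eq_gridCell (h : (heavyCell α δ f p).Nonempty) :
    heavyCell α δ f p = gridCell (δ * 2 ^ p.1) p.2 := by
  obtain ⟨y, hy1, hy2⟩ := h
  ext x
  refine ⟨fun hx => hx.1, fun hx => ⟨hx, (isMaxHeavy_congr (y := y) ?_).2 hy2⟩⟩
  rw [hy1]; exact hx

theorem disjoint_heavyCell {q : ℕ × (Fin d → ℤ)} (hpq : p ≠ q) :
    Disjoint (heavyCell α δ f p) (heavyCell α δ f q) := by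
  rw [Set.disjoint_left]
  rintro x ⟨h1, h2⟩ ⟨h3, h4⟩
  have : p.1 = q.1 := by
    rcases lt_trichotomy p.1 q.1 with h | h | h
    · exact absurd h4.1 (h2.2 _ h)
    · exact h
    · exact absurd h2.1 (h4.2 _ h)
  exact hpq (Prod.ext this (by rw [← h1, ← h3, this]))

theorem measurableSet_heavyCell : MeasurableSet (heavyCell α δ f p) := by
  rcases (heavyCell α δ f p).eq_empty_or_nonempty with h | h
  · rw [h]; exact .empty
  · rw [heavyCell_eq_gridCell h]; exact measurableSet_gridCell _ _

theorem volume_real_heavyCell (hδ : 0 < δ) (h : (heavyCell α δ f p).Nonempty) :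
    volume.real (heavyCell α δ f p) = (δ * 2 ^ p.1) ^ d := by
  rw [heavyCell_eq_gridCell h, volume_real_gridCell (by positivity)]

theorem lt_setIntegral_heavyCell (hδ : 0 < δ) (h : (heavyCell α δ f p).Nonempty) :
    α * volume.real (heavyCell α δ f p) < ∫ y in heavyCell α δ f p, ‖f y‖ := by
  rw [volume_real_heavyCell hδ h, heavyCell_eq_gridCell h]
  obtain ⟨x, hx1, hx2⟩ := h
  have := hx2.1
  rwa [IsHeavy, hx1] at this

theorem setIntegral_heavyCell_le (hδ : 0 < δ) (hf : Integrable f)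
    (h : (heavyCell α δ f p).Nonempty) :
    ∫ y in heavyCell α δ f p, ‖f y‖ ≤ 2 ^ d * α * volume.real (heavyCell α δ f p) := by
  rw [volume_real_heavyCell hδ h]
  obtain ⟨x, hx1, hx2⟩ := h
  have h1 := hx2.2 (p.1 + 1) (Nat.lt_succ_self _)
  rw [IsHeavy, not_lt] at h1
  calc ∫ y in heavyCell α δ f p, ‖f y‖
      ≤ ∫ y in gridCell (δ * 2 ^ (p.1 + 1)) (gridIndex (δ * 2 ^ (p.1 + 1)) x), ‖f y‖ := by
        refine setIntegral_mono_set hf.norm.integrableOn (ae_of_all _ fun _ => norm_nonneg _)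
          (LE.le.eventuallyLE ?_)
        intro y hy
        exact gridIndex_dyadic (Nat.le_succ _) (hy.1.trans hx1.symm)
    _ ≤ α * (δ * 2 ^ (p.1 + 1)) ^ d := h1
    _ = 2 ^ d * α * (δ * 2 ^ p.1) ^ d := by rw [pow_succ]; rw [← mul_assoc, mul_pow]; ring

theorem exists_forall_not_isHeavy (hd : 0 < d) (hα : 0 < α) (hδ : 0 < δ) (hf : Integrable f) :
    ∃ N, ∀ m, N ≤ m → ∀ x, ¬ IsHeavy α δ f m x := by
  have h1 : Tendsto (fun m : ℕ => α * (δ * (2 : ℝ) ^ m) ^ d) atTop atTop :=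
    ((tendsto_pow_atTop (α := ℝ) hd.ne').comp
      ((tendsto_pow_atTop_atTop_of_one_lt (one_lt_two (α := ℝ))).const_mul_atTop hδ)).const_mul_atTop hα
  obtain ⟨N, hN⟩ := (h1.eventually_ge_atTop (∫ x, ‖f x‖)).exists_forall_of_atTop
  refine ⟨N, fun m hm x => not_lt.2 ((setIntegral_le_integral hf.norm
    (ae_of_all _ fun _ => norm_nonneg _)).trans (hN m hm))⟩

theorem IsHeavy.exists_isMaxHeavy (hd : 0 < d) (hα : 0 < α) (hδ : 0 < δ) (hf : Integrable f)
    (h : IsHeavy α δ f m x) : ∃ m, IsMaxHeavy α δ f m x := by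
  classical
  obtain ⟨N, hN⟩ := exists_forall_not_isHeavy hd hα hδ hf
  have hm : m ≤ N := by
    by_contra hc
    exact hN m (by omega) x h
  refine ⟨Nat.findGreatest (fun k => IsHeavy α δ f k x) N,
    Nat.findGreatest_spec (P := fun k => IsHeavy α δ f k x) hm h, fun m' hm' hc => ?_⟩
  rcases le_or_gt m' N with h' | h'
  · exact Nat.findGreatest_is_greatest (P := fun k => IsHeavy α δ f k x) hm' h' hc
  · exact hN m' h'.le x hc

theorem finite_heavyCell (hd : 0 < d) (hα : 0 < α) (hδ : 0 < δ) (hf : Integrable f)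
    (hs : HasCompactSupport f) : {p | (heavyCell α δ f p).Nonempty}.Finite := by
  obtain ⟨N, hN⟩ := exists_forall_not_isHeavy hd hα hδ hf
  obtain ⟨B, hB⟩ := hs.isCompact.isBounded.subset_closedBall 0
  have hfin : (⋃ m ∈ Finset.range N, ({m} : Set ℕ) ×ˢ
      (gridIndex (δ * 2 ^ m) '' (closedBall (0 : EuclideanSpace ℝ (Fin d)) B))).Finite :=
    Set.Finite.biUnion (Finset.finite_toSet _) fun m _ =>
      (Set.finite_singleton m).prod (finite_image_gridIndex (by positivity))
  refine hfin.subset fun p hp => ?_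
  have h1 := lt_setIntegral_heavyCell hδ hp
  have h2 : 0 < ∫ y in heavyCell α δ f p, ‖f y‖ := lt_of_le_of_lt (by positivity) h1
  have h3 : ∃ y ∈ heavyCell α δ f p, f y ≠ 0 := by
    by_contra! hc
    rw [setIntegral_congr_fun (g := fun _ => (0 : ℝ)) measurableSet_heavyCell
      (fun y hy => by simp [hc y hy])] at h2
    simp at h2
  obtain ⟨y, hy, hy0⟩ := h3
  refine Set.mem_biUnion (x := p.1) ?_ ⟨rfl, y, hB (subset_tsupport f hy0), hy.1⟩
  rw [Finset.mem_coe, Finset.mem_range]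
  by_contra hc
  exact hN p.1 (by omega) y hy.2.1

end Stopping

section Mollify

open Module
open scoped Convolution

variable {E : Type*} [NormedAddCommGroup E] [InnerProductSpace ℝ E] [FiniteDimensional ℝ E]
  [MeasurableSpace E] [BorelSpace E] {φ : ContDiffBump (0 : E)} {f g : E → ℂ}

/-- The convolution with an approximate identity. -/
def mollify (φ : ContDiffBump (0 : E)) (f : E → ℂ) : E → ℂ :=
  φ.normed volume ⋆[ContinuousLinearMap.lsmul ℝ ℝ, volume] f

theorem mollify_eq_translateAvg (φ : ContDiffBump (0 : E)) (f : E → ℂ) :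
    mollify φ f = translateAvg volume (fun z => (φ.normed volume z : ℂ)) id f := by
  funext x
  simp [mollify, translateAvg, convolution_lsmul]

theorem integrable_ofReal_normed (φ : ContDiffBump (0 : E)) :
    Integrable (fun z => (φ.normed volume z : ℂ)) :=
  φ.integrable_normed.ofReal

theorem integral_norm_normed (φ : ContDiffBump (0 : E)) :
    ∫ z, ‖(φ.normed volume z : ℂ)‖ = 1 := by
  simp only [Complex.norm_real, Real.norm_of_nonneg (φ.nonneg_normed _)]
  exact φ.integral_normed

theorem integrable_mollify (hf : Integrable f) : Integrable (mollify φ f) := by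
  rw [mollify_eq_translateAvg]
  exact integrable_translateAvg measurable_id (integrable_ofReal_normed φ) hf

theorem integral_norm_mollify_le (hf : Integrable f) : ∫ x, ‖mollify φ f x‖ ≤ ∫ x, ‖f x‖ := by
  rw [mollify_eq_translateAvg]
  refine (integral_norm_translateAvg_le measurable_id (integrable_ofReal_normed φ) hf).trans_eq ?_
  rw [integral_norm_normed, one_mul]

theorem integral_mollify (hf : Integrable f) : ∫ x, mollify φ f x = ∫ x, f x := by
  rw [mollify, integral_convolution _ φ.integrable_normed hf, φ.integral_normed]
  simp

theorem norm_mollify_le {K : ℝ} (hf : ∀ x, ‖f x‖ ≤ K) (x : E) : ‖mollify φ f x‖ ≤ K := by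
  rw [mollify_eq_translateAvg]
  refine (norm_translateAvg_le (integrable_ofReal_normed φ) hf x).trans_eq ?_
  rw [integral_norm_normed, one_mul]

theorem exists_ne_zero_of_mollify_ne_zero {x : E} (h : mollify φ f x ≠ 0) :
    ∃ y, ‖x - y‖ ≤ φ.rOut ∧ f y ≠ 0 := by
  by_contra! hc
  apply h
  rw [mollify, convolution_lsmul]
  refine integral_eq_zero_of_ae (ae_of_all _ fun t => ?_)
  by_cases ht : t ∈ ball (0 : E) φ.rOut
  · have : ‖x - (x - t)‖ ≤ φ.rOut := by
      rw [show x - (x - t) = t by abel]; simpa using (mem_ball_zero_iff.1 ht).le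
    simp [hc _ this]
  · rw [← φ.support_normed_eq (μ := volume), Function.notMem_support] at ht
    simp [ht]

theorem contDiff_mollify (hf : Integrable f) : ContDiff ℝ (⊤ : ℕ∞) (mollify φ f) :=
  φ.hasCompactSupport_normed.contDiff_convolution_left _ φ.contDiff_normed hf.locallyIntegrable

theorem integrable_mollify_integrand (hf : Integrable f) (x : E) :
    Integrable fun t => φ.normed volume t • f (x - t) :=
  φ.hasCompactSupport_normed.convolutionExists_left (ContinuousLinearMap.lsmul ℝ ℝ)
    (φ.contDiff_normed (n := 0)).continuous hf.locallyIntegrable x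

theorem mollify_sub_sum {ι : Type} [Fintype ι] {b : ι → E → ℂ} (hf : Integrable f)
    (hb : ∀ i, Integrable (b i)) (x : E) :
    mollify φ (fun x => f x - ∑ i, b i x) x = mollify φ f x - ∑ i, mollify φ (b i) x := by
  simp only [mollify, convolution_lsmul, smul_sub, Finset.smul_sum]
  rw [integral_sub (integrable_mollify_integrand hf x)
    (integrable_finsetSum _ fun i _ => integrable_mollify_integrand (hb i) x),
    integral_finsetSum _ fun i _ => integrable_mollify_integrand (hb i) x]

end Mollify

section Atom

variable {E : Type*} [NormedAddCommGroup E] [InnerProductSpace ℝ E] [FiniteDimensional ℝ E]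
  [MeasurableSpace E] [BorelSpace E] {f : E → ℂ} {Q : Set E}

/-- The part of `f` on `Q`, with its mean removed. -/
def meanFree (f : E → ℂ) (Q : Set E) : E → ℂ :=
  Q.indicator fun x => f x - ⨍ y in Q, f y

theorem meanFree_of_notMem {x : E} (hx : x ∉ Q) : meanFree f Q x = 0 :=
  Set.indicator_of_notMem hx _

theorem integrable_meanFree (hf : Integrable f) (hQ : MeasurableSet Q) (hQ' : volume Q ≠ ∞) :
    Integrable (meanFree f Q) := by
  rw [meanFree, integrable_indicator_iff hQ]
  exact hf.integrableOn.sub (integrableOn_const hQ')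

theorem integral_meanFree (hf : Integrable f) (hQ : MeasurableSet Q) (hQ' : volume Q ≠ ∞) :
    ∫ x, meanFree f Q x = 0 := by
  rw [meanFree, integral_indicator hQ, integral_sub hf.integrableOn (integrableOn_const hQ'),
    setIntegral_const, measure_smul_setAverage f hQ', sub_self]

theorem measureReal_mul_norm_setAverage_le (hQ' : volume Q ≠ ∞) :
    volume.real Q * ‖⨍ y in Q, f y‖ ≤ ∫ y in Q, ‖f y‖ := by
  have := norm_integral_le_integral_norm (μ := volume.restrict Q) f
  rwa [← measure_smul_setAverage f hQ', norm_smul, Real.norm_of_nonneg measureReal_nonneg] at this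

theorem integral_norm_meanFree_le (hf : Integrable f) (hQ : MeasurableSet Q)
    (hQ' : volume Q ≠ ∞) : ∫ x, ‖meanFree f Q x‖ ≤ 2 * ∫ y in Q, ‖f y‖ := by
  simp only [meanFree, norm_indicator_eq_indicator_norm]
  rw [integral_indicator hQ]
  calc ∫ x in Q, ‖f x - ⨍ y in Q, f y‖
      ≤ ∫ x in Q, (‖f x‖ + ‖⨍ y in Q, f y‖) :=
        integral_mono (hf.integrableOn.sub (integrableOn_const hQ')).norm
          (hf.norm.integrableOn.add (integrableOn_const hQ')) fun x => norm_sub_le _ _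
    _ = (∫ x in Q, ‖f x‖) + volume.real Q * ‖⨍ y in Q, f y‖ := by
        rw [integral_add hf.norm.integrableOn (integrableOn_const hQ'), setIntegral_const,
          smul_eq_mul]
    _ ≤ 2 * ∫ y in Q, ‖f y‖ := by
        linarith [measureReal_mul_norm_setAverage_le (f := f) hQ']

end Atom

section Decomposition

variable {d : ℕ} {α δ : ℝ} {f : EuclideanSpace ℝ (Fin d) → ℂ}

theorem norm_le_of_not_isHeavy {x : EuclideanSpace ℝ (Fin d)} (hδ : 0 < δ)
    (hf : Integrable f)
    (hosc : ∀ x y, ‖x - y‖ ≤ d * δ → ‖f x - f y‖ ≤ α) (hx : ¬ IsHeavy α δ f 0 x) :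
    ‖f x‖ ≤ 2 * α := by
  rw [IsHeavy, not_lt, pow_zero, mul_one] at hx
  set Q := gridCell δ (gridIndex δ x)
  have hv : volume.real Q = δ ^ d := volume_real_gridCell hδ _
  have hfin : volume Q ≠ ∞ := by
    intro hc
    rw [measureReal_def, hc, ENNReal.toReal_top] at hv
    exact (pow_pos hδ d).ne hv
  have h1 : ∫ _y in Q, ‖f x‖ ≤ ∫ y in Q, (‖f y‖ + α) := by
    refine setIntegral_mono_on (integrableOn_const hfin)
      (hf.norm.integrableOn.add (integrableOn_const hfin)) (measurableSet_gridCell _ _)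
      fun y hy => ?_
    have := hosc x y (norm_sub_le_of_gridIndex_eq hδ hy.symm)
    linarith [norm_sub_norm_le (f x) (f y)]
  rw [integral_add hf.norm.integrableOn (integrableOn_const hfin), setIntegral_const,
    setIntegral_const, hv, smul_eq_mul, smul_eq_mul] at h1
  have h2 : δ ^ d * ‖f x‖ ≤ δ ^ d * (2 * α) := by linarith
  exact le_of_mul_le_mul_left h2 (by positivity)

/-- A Calderón–Zygmund decomposition with smooth pieces. -/
theorem exists_smooth_decomposition (hd : 0 < d) (hα : 0 < α) (hf : Continuous f)
    (hs : HasCompactSupport f) :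
    ∃ (ι : Type) (_ : Fintype ι) (r : ι → ℝ) (y : ι → EuclideanSpace ℝ (Fin d))
      (Q : ι → Set (EuclideanSpace ℝ (Fin d))) (b : ι → EuclideanSpace ℝ (Fin d) → ℂ),
      IsAtomFamily (2 ^ (d + 1) * α) 1 r y Q b ∧
      (∀ i, ContDiff ℝ (⊤ : ℕ∞) (b i)) ∧
      ∑ i, ∫ x, ‖b i x‖ ≤ 2 * ∫ x, ‖f x‖ ∧
      (∀ i, r i ^ d = (2 * d) ^ d * volume.real (Q i)) ∧
      α * ∑ i, volume.real (Q i) ≤ ∫ x, ‖f x‖ ∧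
      ∀ x, ‖f x - ∑ i, b i x‖ ≤ 2 ^ (d + 2) * α := by
  have hfi : Integrable f := hf.integrable_of_hasCompactSupport hs
  have hd' : (1 : ℝ) ≤ d := by exact_mod_cast hd
  obtain ⟨η, hη, hfη⟩ := Metric.uniformContinuous_iff.1
    (hs.uniformContinuous_of_continuous hf) α hα
  obtain ⟨δ, hδ, hδη⟩ : ∃ δ : ℝ, 0 < δ ∧ d * δ < η := by
    refine ⟨η / (2 * d), by positivity, ?_⟩
    rw [show (d : ℝ) * (η / (2 * d)) = η / 2 by field_simp]
    exact half_lt_self hη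
  have hosc : ∀ x y, ‖x - y‖ ≤ d * δ → ‖f x - f y‖ ≤ α := by
    intro x y hxy
    rw [← dist_eq_norm]
    exact (hfη (by rw [dist_eq_norm]; exact hxy.trans_lt hδη)).le
  let φ : ContDiffBump (0 : EuclideanSpace ℝ (Fin d)) := ⟨δ / 2, δ, by positivity, by linarith⟩
  have hφ : φ.rOut = δ := rfl
  let ι : Type := {p : ℕ × (Fin d → ℤ) // (heavyCell α δ f p).Nonempty}
  have hι : Finite ι := (finite_heavyCell hd hα hδ hfi hs).to_subtype
  let hι' : Fintype ι := Fintype.ofFinite ι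
  let Q : ι → Set (EuclideanSpace ℝ (Fin d)) := fun i => heavyCell α δ f i.1
  let r : ι → ℝ := fun i => 2 * d * (δ * 2 ^ i.1.1)
  let y : ι → EuclideanSpace ℝ (Fin d) := fun i => i.2.some
  have hy : ∀ i, y i ∈ Q i := fun i => i.2.some_mem
  have hQm : ∀ i, MeasurableSet (Q i) := fun i => measurableSet_heavyCell
  have hQv : ∀ i, volume.real (Q i) = (δ * 2 ^ i.1.1) ^ d := fun i => volume_real_heavyCell hδ i.2
  have hQv0 : ∀ i, 0 < volume.real (Q i) := fun i => by rw [hQv]; positivity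
  have hQf : ∀ i, volume (Q i) ≠ ∞ := fun i hc => by
    have := hQv0 i
    rw [measureReal_def, hc, ENNReal.toReal_top] at this
    exact this.ne rfl
  have hQd : Pairwise fun i j => Disjoint (Q i) (Q j) :=
    fun i j hij => disjoint_heavyCell fun hc => hij (Subtype.ext hc)
  have hsum : ∑ i, ∫ x in Q i, ‖f x‖ ≤ ∫ x, ‖f x‖ := by
    rw [← integral_iUnion_fintype hQm hQd fun i => hfi.norm.integrableOn]
    exact setIntegral_le_integral hfi.norm (ae_of_all _ fun _ => norm_nonneg _)
  have hQdiam : ∀ i x, x ∈ Q i → ‖x - y i‖ ≤ d * (δ * 2 ^ i.1.1) := fun i x hx =>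
    norm_sub_le_of_gridIndex_eq (by positivity) (hx.1.trans (hy i).1.symm)
  have hb0i : ∀ i, Integrable (meanFree f (Q i)) := fun i =>
    integrable_meanFree hfi (hQm i) (hQf i)
  have hb0n : ∀ i, ∫ x, ‖mollify φ (meanFree f (Q i)) x‖ ≤ 2 * ∫ x in Q i, ‖f x‖ := fun i =>
    (integral_norm_mollify_le (hb0i i)).trans (integral_norm_meanFree_le hfi (hQm i) (hQf i))
  have hQle : ∀ i, ∫ x in Q i, ‖f x‖ ≤ 2 ^ d * α * volume.real (Q i) := fun i =>
    setIntegral_heavyCell_le hδ hfi i.2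
  have hgood : ∀ x, ‖f x - ∑ i, meanFree f (Q i) x‖ ≤ 2 ^ (d + 1) * α := by
    intro x
    by_cases hx : ∃ i, x ∈ Q i
    · obtain ⟨i, hi⟩ := hx
      rw [Finset.sum_eq_single i (fun j _ hj => meanFree_of_notMem
        fun hc => Set.disjoint_left.1 (hQd hj) hc hi) (by simp), meanFree,
        Set.indicator_of_mem hi, _root_.sub_sub_cancel]
      have h1 := (measureReal_mul_norm_setAverage_le (f := f) (hQf i)).trans (hQle i)
      have h2 : volume.real (Q i) * ‖⨍ y in Q i, f y‖ ≤ volume.real (Q i) * (2 ^ d * α) := by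
        linarith
      refine (le_of_mul_le_mul_left h2 (hQv0 i)).trans ?_
      gcongr <;> simp
    · push Not at hx
      rw [Finset.sum_eq_zero fun i _ => meanFree_of_notMem (hx i), sub_zero]
      have h1 : ¬ IsHeavy α δ f 0 x := by
        intro hc
        obtain ⟨m, hm⟩ := hc.exists_isMaxHeavy hd hα hδ hfi
        exact hx ⟨(m, gridIndex (δ * 2 ^ m) x), x, rfl, hm⟩ ⟨rfl, hm⟩
      refine (norm_le_of_not_isHeavy hδ hfi hosc h1).trans ?_
      gcongr
      exact le_self_pow₀ one_le_two (Nat.succ_ne_zero d)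
  refine ⟨ι, hι', r, y, Q, fun i => mollify φ (meanFree f (Q i)), ⟨?_, ?_, ?_, ?_, hQm, hQd, ?_, ?_⟩,
    ?_, ?_, ?_, ?_, ?_⟩
  · intro i
    positivity
  · exact fun i => integrable_mollify (hb0i i)
  · intro i x hx
    obtain ⟨z, hz, hz0⟩ := exists_ne_zero_of_mollify_ne_zero hx
    have h1 := hQdiam i z (by by_contra hc; exact hz0 (meanFree_of_notMem hc))
    have h2 : δ ≤ d * (δ * 2 ^ i.1.1) := by
      calc δ = 1 * (δ * 1) := by ring
        _ ≤ d * (δ * 2 ^ i.1.1) := by gcongr; exact one_le_pow₀ one_le_two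
    have h3 : ‖x - y i‖ ≤ ‖x - z‖ + ‖z - y i‖ := norm_sub_le_norm_sub_add_norm_sub _ _ _
    simp only [r]
    rw [hφ] at hz
    linarith
  · intro i
    rw [integral_mollify (hb0i i), integral_meanFree hfi (hQm i) (hQf i)]
  · intro i x hx
    rw [mem_closedBall, dist_eq_norm]
    have h1 := hQdiam i x hx
    have h2 : 0 ≤ d * (δ * 2 ^ i.1.1) := by positivity
    simp only [r]
    linarith
  · intro i
    refine (hb0n i).trans ?_
    have := hQle i
    rw [pow_succ]
    linarith
  · exact fun i => contDiff_mollify (hb0i i)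
  · refine (Finset.sum_le_sum fun i _ => hb0n i).trans ?_
    rw [← Finset.mul_sum]
    linarith
  · intro i
    rw [hQv, ← mul_pow]
  · rw [Finset.mul_sum]
    exact (Finset.sum_le_sum fun i _ => (lt_setIntegral_heavyCell hδ i.2).le).trans hsum
  · intro x
    have h1 : f x - ∑ i, mollify φ (meanFree f (Q i)) x =
        mollify φ (fun x => f x - ∑ i, meanFree f (Q i) x) x - (mollify φ f x - f x) := by
      rw [mollify_sub_sum hfi hb0i]; ring
    have h2 : ‖mollify φ f x - f x‖ ≤ α := by
      rw [← dist_eq_norm]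
      refine ContDiffBump.dist_normed_convolution_le hfi.aestronglyMeasurable fun z hz => ?_
      rw [dist_eq_norm]
      refine hosc z x ?_
      rw [mem_ball, dist_eq_norm, hφ] at hz
      nlinarith
    have h3 := norm_mollify_le (φ := φ) hgood x
    rw [h1]
    refine (norm_sub_le _ _).trans ?_
    have h4 : (1 : ℝ) ≤ 2 ^ (d + 1) := one_le_pow₀ one_le_two
    rw [pow_succ 2 (d + 1)]
    nlinarith

end Decomposition

section ScaleCutoff

open Module

variable {E : Type*} [NormedAddCommGroup E] [InnerProductSpace ℝ E] [FiniteDimensional ℝ E]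

/-- A smooth cutoff that equals `1` on the unit ball and vanishes outside the ball of radius `2`. -/
def unitBump (E : Type*) [NormedAddCommGroup E] [InnerProductSpace ℝ E] [FiniteDimensional ℝ E] :
    ContDiffBump (0 : E) := ⟨1, 2, one_pos, one_lt_two⟩

/-- The kernel `‖z‖^{-(n+2)}` localized to the annulus `1/2 ≤ ‖z‖ ≤ 2`. -/
def annulusKernel (z : E) : ℝ :=
  (unitBump E z - unitBump E ((2 : ℝ) • z)) * (‖z‖ ^ (finrank ℝ E + 2))⁻¹

/-- The kernel `‖z‖^{-(n+2)}` localized to the annulus `R/2 ≤ ‖z‖ ≤ 2 R`. -/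
def scaleCutoff (R : ℝ) (z : E) : ℝ := (R ^ (finrank ℝ E + 2))⁻¹ * annulusKernel (R⁻¹ • z)

theorem unitBump_eq_one {z : E} (hz : ‖z‖ ≤ 1) : unitBump E z = 1 :=
  (unitBump E).one_of_mem_closedBall (by simpa [unitBump] using hz)

theorem unitBump_eq_zero {z : E} (hz : 2 ≤ ‖z‖) : unitBump E z = 0 :=
  (unitBump E).zero_of_le_dist (by simpa [unitBump] using hz)

theorem annulusKernel_eq_zero_of_norm_le {z : E} (hz : ‖z‖ ≤ 1 / 2) : annulusKernel z = 0 := by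
  rw [annulusKernel, unitBump_eq_one (by linarith), unitBump_eq_one, sub_self, zero_mul]
  rw [norm_smul, Real.norm_ofNat]
  linarith

theorem annulusKernel_eq_zero_of_le_norm {z : E} (hz : 2 ≤ ‖z‖) : annulusKernel z = 0 := by
  rw [annulusKernel, unitBump_eq_zero hz, unitBump_eq_zero, sub_self, zero_mul]
  rw [norm_smul, Real.norm_ofNat]
  linarith

theorem contDiff_annulusKernel : ContDiff ℝ 1 (annulusKernel : E → ℝ) := by
  rw [contDiff_iff_contDiffAt]
  intro z
  by_cases hz : z = 0
  · subst hz
    have h : (annulusKernel : E → ℝ) =ᶠ[𝓝 0] fun _ => 0 := by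
      filter_upwards [ball_mem_nhds (0 : E) (ε := 1 / 2) (by norm_num)] with w hw
      exact annulusKernel_eq_zero_of_norm_le (mem_ball_zero_iff.1 hw).le
    exact contDiffAt_const.congr_of_eventuallyEq h
  · refine ContDiffAt.mul ?_ (ContDiffAt.inv ((contDiffAt_norm ℝ hz).pow _)
      (pow_ne_zero _ (norm_ne_zero_iff.2 hz)))
    exact (unitBump E).contDiffAt.sub
      ((unitBump E).contDiff.contDiffAt.comp z (contDiffAt_id.const_smul (2 : ℝ)))

theorem hasCompactSupport_annulusKernel : HasCompactSupport (annulusKernel : E → ℝ) :=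
  HasCompactSupport.intro (isCompact_closedBall (0 : E) 2) fun z hz =>
    annulusKernel_eq_zero_of_le_norm (by simpa using (not_le.1 (fun h => hz (by simpa using h))).le)

theorem contDiff_scaleCutoff (R : ℝ) : ContDiff ℝ 1 (scaleCutoff R : E → ℝ) := by
  have h : ContDiff ℝ 1 fun z : E => annulusKernel (R⁻¹ • z) :=
    contDiff_annulusKernel.comp (contDiff_const_smul (R⁻¹))
  exact h.const_smul (R ^ (finrank ℝ E + 2))⁻¹

theorem fderiv_scaleCutoff (R : ℝ) (z : E) :
    fderiv ℝ (scaleCutoff R : E → ℝ) z =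
      (R ^ (finrank ℝ E + 2))⁻¹ • R⁻¹ • fderiv ℝ annulusKernel (R⁻¹ • z) := by
  have h : DifferentiableAt ℝ (fun z : E => annulusKernel (R⁻¹ • z)) z :=
    (contDiff_annulusKernel.comp (contDiff_const_smul (R⁻¹))).differentiable one_ne_zero z
  rw [← fderiv_comp_smul, ← fderiv_const_smul h]
  rfl

theorem isScaleCutoff_scaleCutoff {E : Type*} [NormedAddCommGroup E] [InnerProductSpace ℝ E]
    [FiniteDimensional ℝ E] [MeasurableSpace E] [BorelSpace E] {D₁ D₂ : ℝ}
    (hD₁ : ∀ z : E, |annulusKernel z| ≤ D₁)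
    (hD₂ : ∀ z : E, ‖fderiv ℝ annulusKernel z‖ ≤ D₂) {R : ℝ} (hR : 0 < R) :
    IsScaleCutoff (D₁ + D₂) R (scaleCutoff R : E → ℝ) where
  contDiff := contDiff_scaleCutoff R
  norm_le z hz := by
    by_contra! hc
    apply hz
    rw [scaleCutoff, annulusKernel_eq_zero_of_le_norm, mul_zero]
    rw [norm_smul, norm_inv, Real.norm_of_nonneg hR.le, inv_mul_eq_div, le_div_iff₀ hR]
    exact hc.le
  abs_le z := by
    have h1 := hD₁ (R⁻¹ • z)
    have h2 := (norm_nonneg _).trans (hD₂ 0)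
    rw [scaleCutoff, abs_mul, abs_of_pos (by positivity), inv_mul_eq_div]
    gcongr
    linarith
  norm_fderiv_le z := by
    have h1 := (abs_nonneg _).trans (hD₁ 0)
    have h2 := hD₂ (R⁻¹ • z)
    rw [fderiv_scaleCutoff, norm_smul, norm_smul, Real.norm_of_nonneg (by positivity),
      Real.norm_of_nonneg (by positivity), ← mul_assoc, ← mul_inv, ← pow_succ, inv_mul_eq_div]
    gcongr
    linarith

theorem exists_isScaleCutoff (E : Type*) [NormedAddCommGroup E] [InnerProductSpace ℝ E]
    [FiniteDimensional ℝ E] [MeasurableSpace E] [BorelSpace E] :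
    ∃ D : ℝ, 0 ≤ D ∧ ∀ R : ℝ, 0 < R → IsScaleCutoff D R (scaleCutoff R : E → ℝ) := by
  obtain ⟨D₁, hD₁⟩ := (hasCompactSupport_annulusKernel (E := E)).exists_bound_of_continuous
    contDiff_annulusKernel.continuous
  obtain ⟨D₂, hD₂⟩ := ((hasCompactSupport_annulusKernel (E := E)).fderiv
    (𝕜 := ℝ)).exists_bound_of_continuous (contDiff_annulusKernel.continuous_fderiv one_ne_zero)
  exact ⟨D₁ + D₂, add_nonneg ((norm_nonneg _).trans (hD₁ 0)) ((norm_nonneg _).trans (hD₂ 0)),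
    fun R hR => isScaleCutoff_scaleCutoff hD₁ hD₂ hR⟩

theorem scaleCutoff_eq {R : ℝ} (hR : 0 < R) (z : E) :
    scaleCutoff R z = (unitBump E (R⁻¹ • z) - unitBump E ((2 : ℝ) • R⁻¹ • z)) *
      (‖z‖ ^ (finrank ℝ E + 2))⁻¹ := by
  rw [scaleCutoff, annulusKernel, norm_smul, norm_inv, Real.norm_of_nonneg hR.le, mul_pow, inv_pow,
    mul_inv, inv_inv]
  have : (R ^ (finrank ℝ E + 2)) ≠ 0 := by positivity
  field_simp

theorem sum_scaleCutoff {r : ℝ} (hr : 0 < r) {S : ℕ} {z : E} (h1 : r ≤ ‖z‖)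
    (h2 : ‖z‖ ≤ 2 ^ S * r) :
    ∑ s ∈ Finset.range (S + 1), scaleCutoff (2 ^ s * r) z = (‖z‖ ^ (finrank ℝ E + 2))⁻¹ := by
  have key : ∀ N : ℕ, ∑ s ∈ Finset.range (N + 1), scaleCutoff (2 ^ s * r) z =
      unitBump E ((2 ^ N * r)⁻¹ • z) * (‖z‖ ^ (finrank ℝ E + 2))⁻¹ := by
    intro N
    induction N with
    | zero =>
      rw [Finset.sum_range_one, scaleCutoff_eq (by positivity), pow_zero, one_mul,
        unitBump_eq_zero (z := (2 : ℝ) • r⁻¹ • z), sub_zero]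
      rw [norm_smul, norm_smul, norm_inv, Real.norm_ofNat, Real.norm_of_nonneg hr.le,
        inv_mul_eq_div]
      have := (one_le_div hr).2 h1
      linarith
    | succ N ih =>
      rw [Finset.sum_range_succ, ih, scaleCutoff_eq (by positivity)]
      have : (2 : ℝ) • (2 ^ (N + 1) * r)⁻¹ • z = (2 ^ N * r)⁻¹ • z := by
        rw [smul_smul]; congr 1; rw [pow_succ]; field_simp
      rw [this]
      ring
  rw [key, unitBump_eq_one, one_mul]
  rw [norm_smul, norm_inv, Real.norm_of_nonneg (by positivity), inv_mul_eq_div,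
    div_le_one (by positivity)]
  exact h2

end ScaleCutoff

section Polar

open Module
open scoped Pointwise

variable {E : Type*} [NormedAddCommGroup E] [InnerProductSpace ℝ E] [FiniteDimensional ℝ E]
  [MeasurableSpace E] [BorelSpace E] {h : E → ℝ} {R : ℝ}

theorem measurable_normalize : Measurable fun z : E => ‖z‖⁻¹ • z :=
  measurable_norm.inv.smul measurable_id

theorem map_coe_toSphere :
    (volume : Measure E).toSphere.map (Subtype.val : sphere (0 : E) 1 → E) =
      (finrank ℝ E : ℝ≥0∞) • ((volume : Measure E).restrict (ball 0 1 \ {0})).map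
        fun z => ‖z‖⁻¹ • z := by
  ext B hB
  rw [Measure.map_apply measurable_subtype_coe hB, Measure.smul_apply,
    Measure.map_apply measurable_normalize hB, Measure.restrict_apply (measurable_normalize hB),
    Measure.toSphere_apply' _ (measurable_subtype_coe hB), smul_eq_mul]
  congr 2
  ext z
  simp only [Set.mem_smul, Set.mem_Ioo, Set.mem_image, Set.mem_preimage, Set.mem_inter_iff,
    Set.mem_sdiff, mem_ball_zero_iff, Set.mem_singleton_iff]
  constructor
  · rintro ⟨c, ⟨hc0, hc1⟩, _, ⟨⟨w, hw⟩, hwB, rfl⟩, rfl⟩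
    have hw1 : ‖w‖ = 1 := by simpa using hw
    have hw0 : w ≠ 0 := norm_ne_zero_iff.1 (by rw [hw1]; exact one_ne_zero)
    have hn : ‖c • w‖ = c := by rw [norm_smul, hw1, Real.norm_of_nonneg hc0.le, mul_one]
    simp only at hwB ⊢
    rw [hn, smul_smul, inv_mul_cancel₀ hc0.ne', one_smul]
    exact ⟨hwB, hc1, smul_ne_zero hc0.ne' hw0⟩
  · rintro ⟨hzB, hz1, hz0⟩
    have hn : 0 < ‖z‖ := norm_pos_iff.2 hz0
    refine ⟨‖z‖, ⟨hn, hz1⟩, ‖z‖⁻¹ • z, ⟨⟨‖z‖⁻¹ • z, ?_⟩, hzB, rfl⟩, ?_⟩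
    · rw [mem_sphere_zero_iff_norm, norm_smul, norm_inv, norm_norm, inv_mul_cancel₀ hn.ne']
    · rw [smul_smul, mul_inv_cancel₀ hn.ne', one_smul]

theorem restrict_ball_sdiff_zero [Nontrivial E] :
    (volume : Measure E).restrict (ball 0 1 \ {0}) = volume.restrict (ball 0 1) :=
  Measure.restrict_congr_set (sdiff_null_ae_eq_self (measure_singleton _))

theorem normalize_ae_eq [Nontrivial E] (hh : ∀ r : ℝ, 0 < r → ∀ z, z ≠ 0 → h (r • z) = h z) :
    (fun z : E => h (‖z‖⁻¹ • z)) =ᵐ[volume.restrict (ball 0 1)] h := by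
  refine ae_restrict_of_ae ?_
  filter_upwards [compl_mem_ae_iff.2 (measure_singleton (0 : E))] with z hz
  exact hh _ (inv_pos.2 (norm_pos_iff.2 hz)) z hz

theorem integrableOn_unitBall_of_homogeneous [Nontrivial E] (hm : Measurable h)
    (hh : ∀ r : ℝ, 0 < r → ∀ z, z ≠ 0 → h (r • z) = h z)
    (hi : Integrable (fun θ : sphere (0 : E) 1 => h θ) (volume : Measure E).toSphere) :
    IntegrableOn h (ball 0 1) := by
  have h1 : Integrable h ((volume : Measure E).toSphere.map
      (Subtype.val : sphere (0 : E) 1 → E)) :=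
    (integrable_map_measure hm.aestronglyMeasurable measurable_subtype_coe.aemeasurable).2 hi
  rw [map_coe_toSphere, integrable_smul_measure (by simp [finrank_pos.ne']) (by simp),
    integrable_map_measure hm.aestronglyMeasurable measurable_normalize.aemeasurable,
    restrict_ball_sdiff_zero] at h1
  exact h1.congr (normalize_ae_eq hh)

theorem finrank_mul_setIntegral_unitBall [Nontrivial E] (hm : Measurable h)
    (hh : ∀ r : ℝ, 0 < r → ∀ z, z ≠ 0 → h (r • z) = h z) :
    finrank ℝ E * ∫ z in ball 0 1, h z =
      ∫ θ : sphere (0 : E) 1, h θ ∂(volume : Measure E).toSphere := by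
  have h1 : ∫ θ : sphere (0 : E) 1, h θ ∂(volume : Measure E).toSphere =
      ∫ z, h z ∂((volume : Measure E).toSphere.map (Subtype.val : sphere (0 : E) 1 → E)) :=
    (integral_map measurable_subtype_coe.aemeasurable hm.aestronglyMeasurable).symm
  rw [h1, map_coe_toSphere, integral_smul_measure, integral_map measurable_normalize.aemeasurable
    hm.aestronglyMeasurable, restrict_ball_sdiff_zero, integral_congr_ae (normalize_ae_eq hh)]
  simp

theorem comp_smul_ae_eq [Nontrivial E] (hh : ∀ r : ℝ, 0 < r → ∀ z, z ≠ 0 → h (r • z) = h z)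
    (hR : 0 < R) : (fun z : E => h (R • z)) =ᵐ[volume] h := by
  filter_upwards [compl_mem_ae_iff.2 (measure_singleton (0 : E))] with z hz
  exact hh _ hR z hz

theorem integrableOn_ball_of_homogeneous [Nontrivial E] (hm : Measurable h)
    (hh : ∀ r : ℝ, 0 < r → ∀ z, z ≠ 0 → h (r • z) = h z)
    (hi : Integrable (fun θ : sphere (0 : E) 1 => h θ) (volume : Measure E).toSphere)
    (hR : 0 < R) : IntegrableOn h (ball 0 R) := by
  rw [← integrable_indicator_iff measurableSet_ball, ← integrable_comp_smul_iff _ _ hR.ne']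
  have h1 := integrableOn_unitBall_of_homogeneous hm hh hi
  rw [← integrable_indicator_iff measurableSet_ball] at h1
  refine h1.congr ?_
  filter_upwards [comp_smul_ae_eq hh hR] with z hz
  have h2 : R • z ∈ ball (0 : E) R ↔ z ∈ ball (0 : E) 1 := by
    rw [mem_ball_zero_iff, mem_ball_zero_iff, norm_smul, Real.norm_of_nonneg hR.le]
    exact ⟨fun h => by nlinarith, fun h => by nlinarith⟩
  by_cases hz1 : z ∈ ball (0 : E) 1
  · rw [Set.indicator_of_mem hz1, Set.indicator_of_mem (h2.2 hz1), hz]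
  · rw [Set.indicator_of_notMem hz1, Set.indicator_of_notMem (mt h2.1 hz1)]

theorem finrank_mul_setIntegral_ball [Nontrivial E] (hm : Measurable h)
    (hh : ∀ r : ℝ, 0 < r → ∀ z, z ≠ 0 → h (r • z) = h z) (hR : 0 < R) :
    finrank ℝ E * ∫ z in ball 0 R, h z =
      R ^ finrank ℝ E * ∫ θ : sphere (0 : E) 1, h θ ∂(volume : Measure E).toSphere := by
  have h1 := Measure.setIntegral_comp_smul_of_pos volume h (ball (0 : E) 1) hR
  rw [smul_unitBall_of_pos hR, integral_congr_ae (ae_restrict_of_ae (comp_smul_ae_eq hh hR)),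
    smul_eq_mul] at h1
  rw [← finrank_mul_setIntegral_unitBall hm hh, h1]
  field_simp

end Polar

section RoughPiece

open Module

variable {E : Type*} [NormedAddCommGroup E] [InnerProductSpace ℝ E] [FiniteDimensional ℝ E]
  [MeasurableSpace E] [BorelSpace E] {ω ω' g A : E → ℝ} {D R : ℝ} {L : NNReal} {b : E → ℂ}

/-- A homogeneous symbol that is integrable over the sphere. -/
structure IsIntegrableSymbol (ω : E → ℝ) : Prop where
  measurable : Measurable ω
  smul : ∀ r : ℝ, 0 < r → ∀ z, z ≠ 0 → ω (r • z) = ω z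
  integrable : Integrable (fun θ : sphere (0 : E) 1 => |ω θ|) (volume : Measure E).toSphere

/-- The `L¹` norm over the sphere. -/
def sphereNorm (ω : E → ℝ) : ℝ := ∫ θ : sphere (0 : E) 1, |ω θ| ∂(volume : Measure E).toSphere

theorem sphereNorm_nonneg (ω : E → ℝ) : 0 ≤ sphereNorm ω := integral_nonneg fun _ => abs_nonneg _

/-- The integrable majorant of a kernel at the scale `R`. -/
def roughMajorant (D R : ℝ) (L : NNReal) (ω : E → ℝ) : E → ℝ :=
  (ball 0 (3 * R)).indicator fun z => 4 * (D * L / R ^ finrank ℝ E) * |ω z|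

theorem measurable_pieceKer_one (hω : Measurable ω) (hg : IsScaleCutoff D R g)
    (hA : LipschitzWith L A) :
    Measurable fun p : E × E => pieceKer ω g A (fun _ => 1) p.1 p.2 := by
  have hA := hA.continuous.measurable
  have hg := hg.contDiff.continuous.measurable
  unfold pieceKer
  fun_prop

theorem abs_pieceKer_one_le (hg : IsScaleCutoff D R g) (hR : 0 < R) (hA : LipschitzWith L A)
    (z y : E) : |pieceKer ω g A (fun _ => 1) z y| ≤ roughMajorant D R L ω z := by
  have hD : 0 ≤ D / R ^ (finrank ℝ E + 2) := (abs_nonneg _).trans (hg.abs_le 0)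
  have hD0 : 0 ≤ D := by
    have := (div_nonneg_iff.1 hD)
    rcases this with h | h
    · exact h.1
    · exact absurd h.2 (not_le.2 (by positivity))
  by_cases h0 : g z = 0
  · have h2 : 0 ≤ roughMajorant D R L ω z := Set.indicator_nonneg (fun _ _ => by positivity) _
    simpa [pieceKer, h0] using h2
  have hz := hg.norm_le z h0
  have hzb : z ∈ ball (0 : E) (3 * R) := by rw [mem_ball_zero_iff]; linarith
  rw [roughMajorant, Set.indicator_of_mem hzb, pieceKer, mul_one, abs_mul, abs_mul, abs_mul,
    abs_of_nonneg (norm_nonneg z)]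
  have h1 : |A (y + z) - A y| ≤ L * ‖z‖ := by
    have := hA.dist_le_mul (y + z) y
    rwa [Real.dist_eq, dist_eq_norm, add_sub_cancel_left] at this
  calc |ω z| * ‖z‖ * |g z| * |A (y + z) - A y|
      ≤ |ω z| * (2 * R) * (D / R ^ (finrank ℝ E + 2)) * (L * (2 * R)) := by
        gcongr
        · exact hg.abs_le z
        · exact h1.trans (by gcongr)
    _ = 4 * (D * L / R ^ finrank ℝ E) * |ω z| := by
        rw [pow_add]; field_simp; ring

theorem integrable_roughMajorant [Nontrivial E] (hω : IsIntegrableSymbol ω) (hR : 0 < R) :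
    Integrable (roughMajorant D R L ω) := by
  rw [roughMajorant, integrable_indicator_iff measurableSet_ball]
  refine Integrable.const_mul ?_ _
  exact integrableOn_ball_of_homogeneous hω.measurable.abs
    (fun r hr z hz => by rw [hω.smul r hr z hz]) hω.integrable (by positivity)

theorem integral_roughMajorant_le [Nontrivial E] (hω : IsIntegrableSymbol ω) (hR : 0 < R)
    (hD : 0 ≤ D) :
    ∫ z, roughMajorant D R L ω z ≤ 4 * 3 ^ finrank ℝ E * (D * L * sphereNorm ω) := by
  have h1 := finrank_mul_setIntegral_ball (h := fun z => |ω z|) hω.measurable.abs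
    (fun r hr z hz => by rw [hω.smul r hr z hz]) (R := 3 * R) (by positivity)
  have h2 : (1 : ℝ) ≤ finrank ℝ E := by exact_mod_cast finrank_pos (R := ℝ) (M := E)
  have h3 : 0 ≤ ∫ z in ball (0 : E) (3 * R), |ω z| := integral_nonneg fun _ => abs_nonneg _
  have h4 : ∫ z in ball (0 : E) (3 * R), |ω z| ≤ (3 * R) ^ finrank ℝ E * sphereNorm ω := by
    rw [sphereNorm, ← h1]
    exact le_mul_of_one_le_left h3 h2
  rw [roughMajorant, integral_indicator measurableSet_ball, integral_const_mul]
  calc 4 * (D * L / R ^ finrank ℝ E) * ∫ z in ball (0 : E) (3 * R), |ω z|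
      ≤ 4 * (D * L / R ^ finrank ℝ E) * ((3 * R) ^ finrank ℝ E * sphereNorm ω) := by gcongr
    _ = 4 * 3 ^ finrank ℝ E * (D * L * sphereNorm ω) := by
        rw [mul_pow]; field_simp

theorem integrable_kernelOp_pieceKer [Nontrivial E] (hω : IsIntegrableSymbol ω)
    (hg : IsScaleCutoff D R g) (hR : 0 < R) (hA : LipschitzWith L A) (hb : Integrable b) :
    Integrable (kernelOp (pieceKer ω g A fun _ => 1) b) :=
  integrable_kernelOp (measurable_pieceKer_one hω.measurable hg hA) hb
    (integrable_roughMajorant hω hR) fun z y _ => abs_pieceKer_one_le hg hR hA z y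

theorem integral_norm_kernelOp_pieceKer_le [Nontrivial E] (hω : IsIntegrableSymbol ω)
    (hg : IsScaleCutoff D R g) (hR : 0 < R) (hD : 0 ≤ D) (hA : LipschitzWith L A)
    (hb : Integrable b) :
    ∫ x, ‖kernelOp (pieceKer ω g A fun _ => 1) b x‖ ≤
      4 * 3 ^ finrank ℝ E * (D * L * sphereNorm ω) * ∫ x, ‖b x‖ :=
  (integral_norm_kernelOp_le (measurable_pieceKer_one hω.measurable hg hA) hb
    (integrable_roughMajorant hω hR) fun z y _ => abs_pieceKer_one_le hg hR hA z y).trans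
    (mul_le_mul_of_nonneg_right (integral_roughMajorant_le hω hR hD)
      (integral_nonneg fun _ => norm_nonneg _))

theorem integrable_pieceKer_mul [Nontrivial E] (hω : IsIntegrableSymbol ω)
    (hg : IsScaleCutoff D R g) (hR : 0 < R) (hA : LipschitzWith L A) (hb : Integrable b) {M : ℝ}
    (hM : ∀ x, ‖b x‖ ≤ M) (x : E) :
    Integrable fun z => (pieceKer ω g A (fun _ => 1) z (x - z) : ℂ) * b (x - z) := by
  refine ((integrable_roughMajorant (D := D) (L := L) hω hR).mul_const M).mono' ?_
    (ae_of_all _ fun z => ?_)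
  · refine AEStronglyMeasurable.mul ?_ (hb.comp_sub_left x).aestronglyMeasurable
    exact (Complex.measurable_ofReal.comp ((measurable_pieceKer_one hω.measurable hg hA).comp
      (measurable_id.prodMk (measurable_const.sub measurable_id)))).aestronglyMeasurable
  · rw [norm_mul, Complex.norm_real, Real.norm_eq_abs]
    have h1 := abs_pieceKer_one_le (ω := ω) hg hR hA z (x - z)
    exact mul_le_mul h1 (hM _) (norm_nonneg _) ((abs_nonneg _).trans h1)

theorem kernelOp_pieceKer_add [Nontrivial E] (hω : IsIntegrableSymbol ω)
    (hω' : IsIntegrableSymbol ω') (hg : IsScaleCutoff D R g) (hR : 0 < R)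
    (hA : LipschitzWith L A) (hb : Integrable b) {M : ℝ} (hM : ∀ x, ‖b x‖ ≤ M) (x : E) :
    kernelOp (pieceKer (fun z => ω z + ω' z) g A fun _ => 1) b x =
      kernelOp (pieceKer ω g A fun _ => 1) b x + kernelOp (pieceKer ω' g A fun _ => 1) b x := by
  unfold kernelOp
  rw [← integral_add (integrable_pieceKer_mul hω hg hR hA hb hM x)
    (integrable_pieceKer_mul hω' hg hR hA hb hM x)]
  congr 1 with z
  simp only [pieceKer]
  push_cast
  ring

end RoughPiece

section Truncation

variable {E : Type*} [NormedAddCommGroup E] [InnerProductSpace ℝ E] [FiniteDimensional ℝ E]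
  [MeasurableSpace E] [BorelSpace E] {ω : E → ℝ} {W : ℝ}

/-- The part of a symbol that is at most `W` in absolute value. -/
def lowPart (W : ℝ) (ω : E → ℝ) : E → ℝ := {z | |ω z| ≤ W}.indicator ω

/-- The part of a symbol that is larger than `W` in absolute value. -/
def highPart (W : ℝ) (ω : E → ℝ) : E → ℝ := {z | W < |ω z|}.indicator ω

theorem lowPart_add_highPart (W : ℝ) (ω : E → ℝ) (z : E) :
    lowPart W ω z + highPart W ω z = ω z := by
  by_cases h : |ω z| ≤ W
  · rw [lowPart, highPart, Set.indicator_of_mem (show z ∈ {z | |ω z| ≤ W} from h),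
      Set.indicator_of_notMem (show z ∉ {z | W < |ω z|} from not_lt.2 h), add_zero]
  · rw [lowPart, highPart, Set.indicator_of_notMem (show z ∉ {z | |ω z| ≤ W} from h),
      Set.indicator_of_mem (show z ∈ {z | W < |ω z|} from not_le.1 h), zero_add]

theorem abs_lowPart_le_abs (W : ℝ) (ω : E → ℝ) (z : E) : |lowPart W ω z| ≤ |ω z| := by
  by_cases h : z ∈ {z | |ω z| ≤ W}
  · rw [lowPart, Set.indicator_of_mem h]
  · rw [lowPart, Set.indicator_of_notMem h, abs_zero]; exact abs_nonneg _

theorem abs_highPart_le_abs (W : ℝ) (ω : E → ℝ) (z : E) : |highPart W ω z| ≤ |ω z| := by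
  by_cases h : z ∈ {z | W < |ω z|}
  · rw [highPart, Set.indicator_of_mem h]
  · rw [highPart, Set.indicator_of_notMem h, abs_zero]; exact abs_nonneg _

theorem IsIntegrableSymbol.mono {ω' : E → ℝ} (hω : IsIntegrableSymbol ω) (hm : Measurable ω')
    (hs : ∀ r : ℝ, 0 < r → ∀ z, z ≠ 0 → ω' (r • z) = ω' z) (h : ∀ z, |ω' z| ≤ |ω z|) :
    IsIntegrableSymbol ω' where
  measurable := hm
  smul := hs
  integrable := hω.integrable.mono' (hm.abs.comp measurable_subtype_coe).aestronglyMeasurable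
    (ae_of_all _ fun θ => by simpa using h θ)

theorem IsIntegrableSymbol.lowPart (hω : IsIntegrableSymbol ω) (W : ℝ) :
    IsIntegrableSymbol (lowPart W ω) := by
  refine hω.mono (hω.measurable.indicator (measurableSet_le hω.measurable.abs measurable_const))
    (fun r hr z hz => ?_) (abs_lowPart_le_abs W ω)
  have := hω.smul r hr z hz
  simp only [_root_.lowPart, Set.indicator_apply, Set.mem_ofPred_eq, this]

theorem IsIntegrableSymbol.highPart (hω : IsIntegrableSymbol ω) (W : ℝ) :
    IsIntegrableSymbol (highPart W ω) := by
  refine hω.mono (hω.measurable.indicator (measurableSet_lt measurable_const hω.measurable.abs))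
    (fun r hr z hz => ?_) (abs_highPart_le_abs W ω)
  have := hω.smul r hr z hz
  simp only [_root_.highPart, Set.indicator_apply, Set.mem_ofPred_eq, this]

theorem IsIntegrableSymbol.isBoundedSymbol_lowPart (hω : IsIntegrableSymbol ω) (hW : 0 ≤ W) :
    IsBoundedSymbol W (_root_.lowPart W ω) where
  measurable := (hω.lowPart W).measurable
  smul := (hω.lowPart W).smul
  abs_le z := by
    by_cases h : z ∈ {z | |ω z| ≤ W}
    · rw [_root_.lowPart, Set.indicator_of_mem h]; exact h
    · rw [_root_.lowPart, Set.indicator_of_notMem h, abs_zero]; exact hW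

end Truncation

section LogSum

theorem sum_ite_le_log {γ N x : ℝ} (hγ : 1 < γ) (hN : 0 < N) (hx : 0 ≤ x) (S : ℕ) :
    ∑ s ∈ Finset.range S, (if N * γ ^ s < x then x else 0) ≤
      (1 + (Real.log γ)⁻¹) * (x * (1 + max (Real.log (x / N)) 0)) := by
  have hl : 0 < Real.log γ := Real.log_pos hγ
  set ℓ := max (Real.log (x / N)) 0 / Real.log γ with hℓ
  have hℓ0 : 0 ≤ ℓ := div_nonneg (le_max_right _ _) hl.le
  have h1 : ∑ s ∈ Finset.range S, (if N * γ ^ s < x then x else 0) ≤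
      ∑ s ∈ Finset.range ⌈ℓ⌉₊, x := by
    rw [← Finset.sum_filter]
    refine Finset.sum_le_sum_of_subset_of_nonneg (fun s hs => ?_) fun _ _ _ => hx
    rw [Finset.mem_filter] at hs
    rw [Finset.mem_range, Nat.lt_ceil, hℓ, lt_div_iff₀ hl, ← Real.log_pow]
    refine (Real.log_lt_log (by positivity) ?_).trans_le (le_max_left _ _)
    rw [lt_div_iff₀ hN, mul_comm]
    exact hs.2
  have h2 : (⌈ℓ⌉₊ : ℝ) ≤ ℓ + 1 := (Nat.ceil_lt_add_one hℓ0).le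
  have h3 : ℓ + 1 ≤ (1 + (Real.log γ)⁻¹) * (1 + max (Real.log (x / N)) 0) := by
    have h4 : 0 ≤ max (Real.log (x / N)) 0 := le_max_right _ _
    have h5 : 0 ≤ (Real.log γ)⁻¹ := by positivity
    rw [hℓ, div_eq_mul_inv]
    nlinarith
  refine h1.trans ?_
  rw [Finset.sum_const, Finset.card_range, nsmul_eq_mul]
  calc (⌈ℓ⌉₊ : ℝ) * x ≤ (1 + (Real.log γ)⁻¹) * (1 + max (Real.log (x / N)) 0) * x := by
        gcongr; exact h2.trans h3
    _ = _ := by ring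

theorem sum_range_inv_pow_le {γ : ℝ} (hγ : 1 < γ) (S : ℕ) :
    ∑ s ∈ Finset.range S, (γ⁻¹) ^ s ≤ (1 - γ⁻¹)⁻¹ :=
  (summable_geometric_of_lt_one (by positivity) (inv_lt_one_of_one_lt₀ hγ)).sum_le_tsum _
    (fun _ _ => by positivity) |>.trans_eq
    (tsum_geometric_of_lt_one (by positivity) (inv_lt_one_of_one_lt₀ hγ))

end LogSum

section MultiScale

open Module

variable {E : Type*} [NormedAddCommGroup E] [InnerProductSpace ℝ E] [FiniteDimensional ℝ E]
  [MeasurableSpace E] [BorelSpace E]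

/-- The size of a symbol in `L log L` over the sphere. -/
def sphereLogNorm (ω : E → ℝ) : ℝ :=
  ∫ θ : sphere (0 : E) 1, |ω θ| * (1 + max (Real.log (|ω θ| / sphereNorm ω)) 0)
    ∂(volume : Measure E).toSphere

/-- The contribution of the scales at most `2^S` times the radii of the atoms. -/
def scaleSum {ι : Type} [Fintype ι] (ω A : E → ℝ) (r : ι → ℝ) (b : ι → E → ℂ) (S : ℕ) (x : E) :
    ℂ :=
  ∑ s ∈ Finset.range (S + 1), ∑ i,
    kernelOp (pieceKer ω (scaleCutoff (2 ^ s * r i)) A fun _ => 1) (b i) x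

theorem sphereNorm_le_sphereLogNorm {ω : E → ℝ} (hω : IsIntegrableSymbol ω)
    (hlog : Integrable (fun θ : sphere (0 : E) 1 =>
      |ω θ| * (1 + max (Real.log (|ω θ| / sphereNorm ω)) 0)) (volume : Measure E).toSphere) :
    sphereNorm ω ≤ sphereLogNorm ω := by
  refine integral_mono hω.integrable hlog fun θ => ?_
  have : 0 ≤ max (Real.log (|ω θ| / sphereNorm ω)) 0 := le_max_right _ _
  exact le_mul_of_one_le_right (abs_nonneg _) (by linarith)

theorem sum_sphereNorm_highPart_le {ω : E → ℝ} (hω : IsIntegrableSymbol ω)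
    (hlog : Integrable (fun θ : sphere (0 : E) 1 =>
      |ω θ| * (1 + max (Real.log (|ω θ| / sphereNorm ω)) 0)) (volume : Measure E).toSphere)
    (hN : 0 < sphereNorm ω) {γ : ℝ} (hγ : 1 < γ) (S : ℕ) :
    ∑ s ∈ Finset.range S, sphereNorm (highPart (sphereNorm ω * γ ^ s) ω) ≤
      (1 + (Real.log γ)⁻¹) * sphereLogNorm ω := by
  have e : ∀ s : ℕ, sphereNorm (highPart (sphereNorm ω * γ ^ s) ω) =
      ∫ θ : sphere (0 : E) 1, |highPart (sphereNorm ω * γ ^ s) ω θ|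
        ∂(volume : Measure E).toSphere := fun s => rfl
  simp only [e]
  rw [sphereLogNorm, ← integral_finsetSum _ fun s _ => (hω.highPart _).integrable,
    ← integral_const_mul]
  refine integral_mono (integrable_finsetSum _ fun s _ => (hω.highPart _).integrable)
    (hlog.const_mul _) fun θ => ?_
  refine (Finset.sum_congr rfl fun s _ => ?_).trans_le
    (sum_ite_le_log hγ hN (abs_nonneg (ω θ)) S)
  simp only [highPart, Set.indicator_apply, Set.mem_ofPred_eq]
  split_ifs <;> simp

theorem IsAtomFamily.rescale {ι : Type} {α t : ℝ} {R r : ι → ℝ} {y : ι → E} {Q : ι → Set E}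
    {b : ι → E → ℂ} (h : IsAtomFamily α 1 r y Q b) (hR : ∀ i, 0 < R i)
    (ht : ∀ i, t ^ 8 * R i = r i) : IsAtomFamily α t R y Q b where
  R_pos := hR
  integrable := h.integrable
  norm_sub_le i x hx := by simpa [ht i] using h.norm_sub_le i x hx
  integral_eq_zero := h.integral_eq_zero
  measurableSet := h.measurableSet
  disjoint := h.disjoint
  subset i := by simpa [ht i] using h.subset i
  integral_norm_le := h.integral_norm_le

theorem norm_sum_sq_le {γ : ℝ} (hγ : 1 < γ) (S : ℕ) (u : ℕ → ℂ) :
    ‖∑ s ∈ Finset.range S, u s‖ ^ 2 ≤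
      (1 - γ⁻¹)⁻¹ * ∑ s ∈ Finset.range S, γ ^ s * ‖u s‖ ^ 2 := by
  have hγ0 : 0 < γ := one_pos.trans hγ
  calc ‖∑ s ∈ Finset.range S, u s‖ ^ 2 ≤ (∑ s ∈ Finset.range S, ‖u s‖) ^ 2 := by
        gcongr; exact norm_sum_le _ _
    _ ≤ (∑ s ∈ Finset.range S, (γ⁻¹) ^ s) * ∑ s ∈ Finset.range S, γ ^ s * ‖u s‖ ^ 2 := by
        refine Finset.sum_sq_le_sum_mul_sum_of_sq_le_mul _ (fun _ _ => by positivity)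
          (fun _ _ => by positivity) fun s _ => le_of_eq ?_
        rw [← mul_assoc, ← mul_pow, inv_mul_cancel₀ hγ0.ne', one_pow, one_mul]
    _ ≤ _ := by
        gcongr
        exact sum_range_inv_pow_le hγ S

theorem exists_multiscale_split (E : Type*) [NormedAddCommGroup E] [InnerProductSpace ℝ E]
    [FiniteDimensional ℝ E] [MeasurableSpace E] [BorelSpace E] [Nontrivial E] :
    ∃ C : ℝ, 0 ≤ C ∧ ∀ {ι : Type} [Fintype ι] {α M : ℝ} {r : ι → ℝ} {y : ι → E} {Q : ι → Set E}
      {b : ι → E → ℂ} {L : NNReal} {ω A : E → ℝ}, 0 ≤ α → IsAtomFamily α 1 r y Q b →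
      (∀ i x, ‖b i x‖ ≤ M) → IsIntegrableSymbol ω →
      Integrable (fun θ : sphere (0 : E) 1 =>
        |ω θ| * (1 + max (Real.log (|ω θ| / sphereNorm ω)) 0)) (volume : Measure E).toSphere →
      0 < sphereNorm ω → LipschitzWith L A → ∀ S : ℕ, ∃ u₁ u₂ : E → ℂ,
        (∀ x, scaleSum ω A r b S x = u₁ x + u₂ x) ∧ Integrable u₁ ∧
        ∫ x, ‖u₁ x‖ ≤ C * (sphereLogNorm ω * L) * ∑ i, ∫ x, ‖b i x‖ ∧
        MemLp u₂ 2 ∧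
        ∫ x, ‖u₂ x‖ ^ 2 ≤ C * (sphereLogNorm ω * L) ^ 2 * α * ∑ i, ∫ x, ‖b i x‖ := by
  obtain ⟨C₁, hC₁, hsplit⟩ := exists_scale_split E
  obtain ⟨D, hD, hcut⟩ := exists_isScaleCutoff E
  obtain ⟨γ, hγ, hγ32⟩ : ∃ γ : ℝ, 1 < γ ∧ γ ^ 32 = 2 := by
    refine ⟨2 ^ ((1 : ℝ) / 32), Real.one_lt_rpow one_lt_two (by norm_num), ?_⟩
    rw [← Real.rpow_natCast, ← Real.rpow_mul zero_le_two]
    norm_num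
  have hγ0 : 0 < γ := one_pos.trans hγ
  set G := (1 - γ⁻¹)⁻¹ with hG
  have hG0 : 0 ≤ G := inv_nonneg.2 (sub_nonneg.2 (inv_lt_one_of_one_lt₀ hγ).le)
  have hlog0 : 0 ≤ (Real.log γ)⁻¹ := inv_nonneg.2 (Real.log_pos hγ).le
  set n := finrank ℝ E
  refine ⟨C₁ * D * G + 4 * 3 ^ n * D * (1 + (Real.log γ)⁻¹) + G ^ 2 * C₁ * D ^ 2, by positivity,
    ?_⟩
  intro ι _ α M r y Q b L ω A hα hfam hM hω hlog hN hA S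
  set N := sphereNorm ω
  have hNH : N ≤ sphereLogNorm ω := sphereNorm_le_sphereLogNorm hω hlog
  set H := sphereLogNorm ω
  have hH : 0 ≤ H := hN.le.trans hNH
  set B := ∑ i, ∫ x, ‖b i x‖
  have hB : 0 ≤ B := Finset.sum_nonneg fun _ _ => integral_nonneg fun _ => norm_nonneg _
  have hR : ∀ (s : ℕ) i, 0 < 2 ^ s * r i := fun s i => mul_pos (by positivity) (hfam.R_pos i)
  have ht : ∀ (s : ℕ) i, ((γ⁻¹) ^ (4 * s)) ^ 8 * (2 ^ s * r i) = r i := by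
    intro s i
    rw [← mul_assoc, ← pow_mul, show 4 * s * 8 = 32 * s by ring, pow_mul, inv_pow, hγ32, ← mul_pow]
    norm_num
  have hW : ∀ s : ℕ, 0 ≤ N * γ ^ s := fun s => by positivity
  have hex := fun s : ℕ => hsplit (g := fun i => scaleCutoff (2 ^ s * r i)) hα
    (show 0 < (γ⁻¹) ^ (4 * s) by positivity)
    (pow_le_one₀ (by positivity) (inv_lt_one_of_one_lt₀ hγ).le) (hW s) hD
    (hfam.rescale (hR s) (ht s)) (hω.isBoundedSymbol_lowPart (hW s))
    (fun i => hcut _ (hR s i)) hA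
  choose u₁ u₂ hu hi₁ hn₁ hi₂ hn₂ using hex
  set v : ℕ → ι → E → ℂ := fun s i =>
    kernelOp (pieceKer (highPart (N * γ ^ s) ω) (scaleCutoff (2 ^ s * r i)) A fun _ => 1) (b i)
  have hvi : ∀ s i, Integrable (v s i) := fun s i =>
    integrable_kernelOp_pieceKer (hω.highPart _) (hcut _ (hR s i)) (hR s i) hA (hfam.integrable i)
  have hvn : ∀ s, ∑ i, ∫ x, ‖v s i x‖ ≤
      4 * 3 ^ n * (D * L * sphereNorm (highPart (N * γ ^ s) ω)) * B := by
    intro s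
    rw [Finset.mul_sum]
    exact Finset.sum_le_sum fun i _ => integral_norm_kernelOp_pieceKer_le (hω.highPart _)
      (hcut _ (hR s i)) (hR s i) hD hA (hfam.integrable i)
  refine ⟨fun x => ∑ s ∈ Finset.range (S + 1), (u₁ s x + ∑ i, v s i x),
    fun x => ∑ s ∈ Finset.range (S + 1), u₂ s x, fun x => ?_, ?_, ?_, ?_, ?_⟩
  · rw [scaleSum, ← Finset.sum_add_distrib]
    refine Finset.sum_congr rfl fun s _ => ?_
    rw [add_right_comm, ← hu s x, ← Finset.sum_add_distrib]
    refine Finset.sum_congr rfl fun i _ => ?_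
    rw [← kernelOp_pieceKer_add (hω.lowPart _) (hω.highPart _) (hcut _ (hR s i)) (hR s i) hA
      (hfam.integrable i) (hM i)]
    simp only [lowPart_add_highPart]
  · exact integrable_finsetSum _ fun s _ =>
      (hi₁ s).add (integrable_finsetSum _ fun i _ => hvi s i)
  · have h1 : ∫ x, ‖∑ s ∈ Finset.range (S + 1), (u₁ s x + ∑ i, v s i x)‖ ≤
        ∑ s ∈ Finset.range (S + 1), ((∫ x, ‖u₁ s x‖) + ∑ i, ∫ x, ‖v s i x‖) := by
      have h2 : ∀ s, Integrable fun x => ‖u₁ s x‖ + ∑ i, ‖v s i x‖ := fun s =>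
        (hi₁ s).norm.add (integrable_finsetSum _ fun i _ => (hvi s i).norm)
      calc ∫ x, ‖∑ s ∈ Finset.range (S + 1), (u₁ s x + ∑ i, v s i x)‖
          ≤ ∫ x, ∑ s ∈ Finset.range (S + 1), (‖u₁ s x‖ + ∑ i, ‖v s i x‖) := by
            refine integral_mono (integrable_finsetSum _ fun s _ =>
              (hi₁ s).add (integrable_finsetSum _ fun i _ => hvi s i)).norm
              (integrable_finsetSum _ fun s _ => h2 s) fun x => ?_
            refine (norm_sum_le _ _).trans (Finset.sum_le_sum fun s _ => ?_)
            exact (norm_add_le _ _).trans (by gcongr; exact norm_sum_le _ _)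
        _ = _ := by
            rw [integral_finsetSum _ fun s _ => h2 s]
            refine Finset.sum_congr rfl fun s _ => ?_
            rw [integral_add (hi₁ s).norm (integrable_finsetSum _ fun i _ => (hvi s i).norm),
              integral_finsetSum _ fun i _ => (hvi s i).norm]
    refine h1.trans ?_
    rw [Finset.sum_add_distrib]
    have h3 : ∑ s ∈ Finset.range (S + 1), ∫ x, ‖u₁ s x‖ ≤ C₁ * D * G * (H * L) * B := by
      calc ∑ s ∈ Finset.range (S + 1), ∫ x, ‖u₁ s x‖
          ≤ ∑ s ∈ Finset.range (S + 1), C₁ * (N * D * L) * B * (γ⁻¹) ^ s := by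
            refine Finset.sum_le_sum fun s _ => (hn₁ s).trans ?_
            have h4 : γ ^ s * ((γ⁻¹) ^ (4 * s)) ^ 2 ≤ (γ⁻¹) ^ s := by
              have h5 : ((γ⁻¹) ^ (4 * s)) ^ 2 = (γ⁻¹) ^ s * (γ⁻¹) ^ (7 * s) := by
                rw [← pow_mul, ← pow_add]; congr 1; ring
              rw [h5, ← mul_assoc, ← mul_pow, mul_inv_cancel₀ hγ0.ne', one_pow, one_mul]
              exact pow_le_pow_of_le_one (by positivity) (inv_lt_one_of_one_lt₀ hγ).le (by omega)
            calc C₁ * (N * γ ^ s * D * L) * ((γ⁻¹) ^ (4 * s)) ^ 2 * B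
                = C₁ * (N * D * L) * B * (γ ^ s * ((γ⁻¹) ^ (4 * s)) ^ 2) := by ring
              _ ≤ _ := by gcongr
        _ ≤ C₁ * (N * D * L) * B * G := by
            rw [← Finset.mul_sum]
            gcongr
            exact sum_range_inv_pow_le hγ _
        _ = C₁ * D * G * (N * L) * B := by ring
        _ ≤ _ := by gcongr
    have h6 : ∑ s ∈ Finset.range (S + 1), ∑ i, ∫ x, ‖v s i x‖ ≤
        4 * 3 ^ n * D * (1 + (Real.log γ)⁻¹) * (H * L) * B := by
      calc ∑ s ∈ Finset.range (S + 1), ∑ i, ∫ x, ‖v s i x‖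
          ≤ ∑ s ∈ Finset.range (S + 1),
            4 * 3 ^ n * D * L * B * sphereNorm (highPart (N * γ ^ s) ω) :=
            Finset.sum_le_sum fun s _ => (hvn s).trans_eq (by ring)
        _ ≤ 4 * 3 ^ n * D * L * B * ((1 + (Real.log γ)⁻¹) * H) := by
            rw [← Finset.mul_sum]
            gcongr
            exact sum_sphereNorm_highPart_le hω hlog hN hγ _
        _ = _ := by ring
    have h7 : 0 ≤ G ^ 2 * C₁ * D ^ 2 * (H * L) * B := by positivity
    nlinarith
  · exact memLp_finsetSum _ fun s _ => hi₂ s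
  · have hsq : ∀ s, Integrable fun x => ‖u₂ s x‖ ^ 2 := fun s => (hi₂ s).integrable_norm_pow two_ne_zero
    calc ∫ x, ‖∑ s ∈ Finset.range (S + 1), u₂ s x‖ ^ 2
        ≤ ∫ x, G * ∑ s ∈ Finset.range (S + 1), γ ^ s * ‖u₂ s x‖ ^ 2 := by
          refine integral_mono_of_nonneg (ae_of_all _ fun x => by positivity)
            ((integrable_finsetSum _ fun s _ => (hsq s).const_mul _).const_mul _)
            (ae_of_all _ fun x => norm_sum_sq_le hγ _ _)
      _ = G * ∑ s ∈ Finset.range (S + 1), γ ^ s * ∫ x, ‖u₂ s x‖ ^ 2 := by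
          rw [integral_const_mul, integral_finsetSum _ fun s _ => (hsq s).const_mul _]
          simp only [integral_const_mul]
      _ ≤ G * ∑ s ∈ Finset.range (S + 1), C₁ * (N * D * L) ^ 2 * α * B * (γ⁻¹) ^ s := by
          refine mul_le_mul_of_nonneg_left (Finset.sum_le_sum fun s _ => ?_) hG0
          refine (mul_le_mul_of_nonneg_left (hn₂ s) (by positivity)).trans_eq ?_
          have h5 : (γ⁻¹) ^ (4 * s) = (γ⁻¹) ^ s * (γ⁻¹) ^ s * (γ⁻¹) ^ s * (γ⁻¹) ^ s := by
            rw [← pow_add, ← pow_add, ← pow_add]; congr 1; ring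
          have h6 : γ ^ s * (γ⁻¹) ^ s = 1 := by
            rw [← mul_pow, mul_inv_cancel₀ hγ0.ne', one_pow]
          rw [h5]
          linear_combination (C₁ * (N * D * L) ^ 2 * α * B * (γ⁻¹) ^ s) *
            ((γ ^ s * (γ⁻¹) ^ s) ^ 2 + γ ^ s * (γ⁻¹) ^ s + 1) * h6
      _ ≤ G * (C₁ * (N * D * L) ^ 2 * α * B * G) := by
          rw [← Finset.mul_sum]
          gcongr
          exact sum_range_inv_pow_le hγ _
      _ = G ^ 2 * C₁ * D ^ 2 * (N * L) ^ 2 * α * B := by ring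
      _ ≤ G ^ 2 * C₁ * D ^ 2 * (H * L) ^ 2 * α * B := by gcongr
      _ ≤ _ := by
          have h8 : 0 ≤ C₁ * D * G + 4 * 3 ^ n * D * (1 + (Real.log γ)⁻¹) := by positivity
          have h9 : 0 ≤ (H * L) ^ 2 * α * B := by positivity
          nlinarith

end MultiScale

section TruncatedCommutator

variable {d : ℕ} {ω A : EuclideanSpace ℝ (Fin d) → ℝ} {L : NNReal}
  {f g : EuclideanSpace ℝ (Fin d) → ℂ} {ε : ℝ}

/-- The kernel of the Calderón commutator. -/
def commutatorKer (ω A : EuclideanSpace ℝ (Fin d) → ℝ) (x y : EuclideanSpace ℝ (Fin d)) : ℝ :=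
  ω (x - y) / ‖x - y‖ ^ d * ((A x - A y) / ‖x - y‖)

/-- The Calderón commutator truncated at distance `ε`. -/
def truncatedCommutator (ω A : EuclideanSpace ℝ (Fin d) → ℝ) (f : EuclideanSpace ℝ (Fin d) → ℂ)
    (ε : ℝ) (x : EuclideanSpace ℝ (Fin d)) : ℂ :=
  ∫ y in {y | ε < ‖x - y‖}, (commutatorKer ω A x y : ℂ) * f y

theorem measurable_commutatorKer (hω : Measurable ω) (hA : LipschitzWith L A) :
    Measurable fun p : EuclideanSpace ℝ (Fin d) × EuclideanSpace ℝ (Fin d) =>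
      commutatorKer ω A p.1 p.2 := by
  have hA := hA.continuous.measurable
  unfold commutatorKer
  fun_prop

theorem measurableSet_lt_norm_sub (ε : ℝ) (x : EuclideanSpace ℝ (Fin d)) :
    MeasurableSet {y | ε < ‖x - y‖} :=
  measurableSet_lt measurable_const (by fun_prop)

theorem abs_commutatorKer_le (hA : LipschitzWith L A) (hε : 0 < ε)
    {x y : EuclideanSpace ℝ (Fin d)} (h : ε < ‖x - y‖) :
    |commutatorKer ω A x y| ≤ L / ε ^ d * |ω (x - y)| := by
  have h0 : 0 < ‖x - y‖ := hε.trans h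
  have h1 : |A x - A y| ≤ L * ‖x - y‖ := by
    have := hA.dist_le_mul x y
    rwa [Real.dist_eq, dist_eq_norm] at this
  rw [commutatorKer, abs_mul, abs_div, abs_div, abs_of_pos h0, abs_of_pos (pow_pos h0 d)]
  calc |ω (x - y)| / ‖x - y‖ ^ d * (|A x - A y| / ‖x - y‖)
      ≤ |ω (x - y)| / ε ^ d * L := by
        gcongr
        rwa [div_le_iff₀ h0]
    _ = _ := by ring

theorem integrableOn_commutatorKer_mul [Nontrivial (EuclideanSpace ℝ (Fin d))]
    (hω : IsIntegrableSymbol ω) (hA : LipschitzWith L A)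
    (hf : Continuous f) (hs : HasCompactSupport f) (hε : 0 < ε) (x : EuclideanSpace ℝ (Fin d)) :
    IntegrableOn (fun y => (commutatorKer ω A x y : ℂ) * f y) {y | ε < ‖x - y‖} := by
  obtain ⟨M, hM⟩ := hs.exists_bound_of_continuous hf
  obtain ⟨ρ, hρ⟩ := hs.isBounded.subset_ball 0
  have hρ0 : ∀ y, f y ≠ 0 → ‖y‖ < ρ := fun y hy => by
    simpa using hρ (subset_tsupport f hy)
  have hint : Integrable fun y =>
      M * (L / ε ^ d) * (ball (0 : EuclideanSpace ℝ (Fin d)) (‖x‖ + |ρ| + 1)).indicator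
        (fun z => |ω z|) (x - y) := by
    refine Integrable.const_mul ?_ _
    refine Integrable.comp_sub_left (f := (ball (0 : EuclideanSpace ℝ (Fin d))
      (‖x‖ + |ρ| + 1)).indicator fun z => |ω z|) ?_ x
    rw [integrable_indicator_iff measurableSet_ball]
    refine integrableOn_ball_of_homogeneous hω.measurable.abs (fun r hr z hz => ?_)
      hω.integrable (by positivity)
    rw [hω.smul r hr z hz]
  refine hint.integrableOn.mono' ?_ ?_
  · refine ((Complex.measurable_ofReal.comp ((measurable_commutatorKer hω.measurable hA).comp
      (measurable_const.prodMk measurable_id))).mul hf.measurable).aestronglyMeasurable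
  · filter_upwards [ae_restrict_mem (measurableSet_lt_norm_sub ε x)] with y hy
    have hM0 : 0 ≤ M := (norm_nonneg _).trans (hM 0)
    have hnn : 0 ≤ (ball (0 : EuclideanSpace ℝ (Fin d)) (‖x‖ + |ρ| + 1)).indicator
        (fun z => |ω z|) (x - y) := Set.indicator_nonneg (fun _ _ => abs_nonneg _) _
    by_cases h0 : f y = 0
    · rw [h0, mul_zero, norm_zero]
      positivity
    · have hy1 : x - y ∈ ball (0 : EuclideanSpace ℝ (Fin d)) (‖x‖ + |ρ| + 1) := by
        rw [mem_ball_zero_iff]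
        linarith [norm_sub_le x y, hρ0 y h0, le_abs_self ρ]
      rw [Set.indicator_of_mem hy1, norm_mul, Complex.norm_real, Real.norm_eq_abs]
      calc |commutatorKer ω A x y| * ‖f y‖ ≤ (L / ε ^ d * |ω (x - y)|) * M := by
            gcongr
            · exact abs_commutatorKer_le hA hε hy
            · exact hM y
        _ = _ := by ring

theorem truncatedCommutator_add [Nontrivial (EuclideanSpace ℝ (Fin d))]
    (hω : IsIntegrableSymbol ω) (hA : LipschitzWith L A)
    (hf : Continuous f) (hs : HasCompactSupport f) (hg : Continuous g) (hgs : HasCompactSupport g)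
    (hε : 0 < ε) (x : EuclideanSpace ℝ (Fin d)) :
    truncatedCommutator ω A (fun y => f y + g y) ε x =
      truncatedCommutator ω A f ε x + truncatedCommutator ω A g ε x := by
  unfold truncatedCommutator
  rw [← integral_add (integrableOn_commutatorKer_mul hω hA hf hs hε x)
    (integrableOn_commutatorKer_mul hω hA hg hgs hε x)]
  simp only [mul_add]

theorem truncatedCommutator_sum [Nontrivial (EuclideanSpace ℝ (Fin d))] {ι : Type} [Fintype ι]
    {b : ι → EuclideanSpace ℝ (Fin d) → ℂ} (hω : IsIntegrableSymbol ω) (hA : LipschitzWith L A)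
    (hb : ∀ i, Continuous (b i)) (hs : ∀ i, HasCompactSupport (b i)) (hε : 0 < ε)
    (x : EuclideanSpace ℝ (Fin d)) :
    truncatedCommutator ω A (fun y => ∑ i, b i y) ε x =
      ∑ i, truncatedCommutator ω A (b i) ε x := by
  unfold truncatedCommutator
  rw [← integral_finsetSum _ fun i _ => integrableOn_commutatorKer_mul hω hA (hb i) (hs i) hε x]
  simp only [Finset.mul_sum]

theorem stronglyMeasurable_truncatedCommutator (hω : Measurable ω) (hA : LipschitzWith L A)
    (hf : Continuous f) (ε : ℝ) : StronglyMeasurable (truncatedCommutator ω A f ε) := by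
  have h : truncatedCommutator ω A f ε = fun x => ∫ y, ({y | ε < ‖x - y‖} : Set _).indicator
      (fun y => (commutatorKer ω A x y : ℂ) * f y) y := by
    ext x
    rw [integral_indicator (measurableSet_lt_norm_sub ε x), truncatedCommutator]
  rw [h]
  refine StronglyMeasurable.integral_prod_right (f := fun x y =>
    ({y | ε < ‖x - y‖} : Set _).indicator (fun y => (commutatorKer ω A x y : ℂ) * f y) y) ?_
  have hm : Measurable fun p : EuclideanSpace ℝ (Fin d) × EuclideanSpace ℝ (Fin d) =>
      (commutatorKer ω A p.1 p.2 : ℂ) * f p.2 :=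
    (Complex.measurable_ofReal.comp (measurable_commutatorKer hω hA)).mul
      (hf.measurable.comp measurable_snd)
  exact (hm.indicator (measurableSet_lt (f := fun _ => ε)
    (g := fun p : EuclideanSpace ℝ (Fin d) × EuclideanSpace ℝ (Fin d) => ‖p.1 - p.2‖)
    measurable_const (by fun_prop))).stronglyMeasurable

theorem truncatedCommutator_eq_sum_kernelOp [Nontrivial (EuclideanSpace ℝ (Fin d))]
    (hω : IsIntegrableSymbol ω) (hA : LipschitzWith L A) (hf : Continuous f)
    (hs : HasCompactSupport f) {r : ℝ} (hr : 0 < r) {x y : EuclideanSpace ℝ (Fin d)}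
    (hfr : ∀ z, f z ≠ 0 → ‖z - y‖ ≤ r) {S : ℕ} (hx : 2 * r < ‖x - y‖)
    (hxS : ‖x - y‖ + r ≤ 2 ^ S * r) (hεr : ε < r) :
    truncatedCommutator ω A f ε x = ∑ s ∈ Finset.range (S + 1),
      kernelOp (pieceKer ω (scaleCutoff (2 ^ s * r)) A fun _ => 1) f x := by
  obtain ⟨M, hM⟩ := hs.exists_bound_of_continuous hf
  obtain ⟨D, -, hcut⟩ := exists_isScaleCutoff (EuclideanSpace ℝ (Fin d))
  have hfi : Integrable f := hf.integrable_of_hasCompactSupport hs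
  have hlow : ∀ z, f z ≠ 0 → r < ‖x - z‖ := fun z hz => by
    have h1 := hfr z hz
    have h2 := norm_sub_le_norm_sub_add_norm_sub x z y
    linarith
  have hup : ∀ z, f z ≠ 0 → ‖x - z‖ ≤ 2 ^ S * r := fun z hz => by
    have h1 := hfr z hz
    have h2 := norm_sub_le_norm_sub_add_norm_sub x y z
    rw [norm_sub_rev y z] at h2
    linarith
  have hfull : truncatedCommutator ω A f ε x = ∫ z, (commutatorKer ω A x z : ℂ) * f z := by
    refine setIntegral_eq_integral_of_forall_compl_eq_zero fun z hz => ?_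
    by_contra h
    have h0 : f z ≠ 0 := fun h' => h (by rw [h', mul_zero])
    exact hz (hεr.trans (hlow z h0))
  have hR : ∀ s : ℕ, 0 < 2 ^ s * r := fun s => by positivity
  unfold kernelOp
  rw [hfull, ← integral_sub_left_eq_self _ _ x, ← integral_finsetSum _ fun s _ =>
    integrable_pieceKer_mul hω (hcut _ (hR s)) (hR s) hA hfi hM x]
  congr 1 with z
  rw [← Finset.sum_mul]
  by_cases h0 : f (x - z) = 0
  · rw [h0, mul_zero, mul_zero]
  congr 1
  have h1 := hlow _ h0
  have h2 := hup _ h0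
  rw [_root_.sub_sub_cancel] at h1 h2
  have hz : 0 < ‖z‖ := hr.trans h1
  rw [← Complex.ofReal_sum]
  congr 1
  have h3 := sum_scaleCutoff hr h1.le h2
  rw [finrank_euclideanSpace_fin] at h3
  simp only [pieceKer, commutatorKer, sub_add_cancel, _root_.sub_sub_cancel]
  rw [← Finset.sum_mul, ← Finset.mul_sum, h3]
  field_simp
  ring

end TruncatedCommutator

section WeakType

theorem volume_lt_norm_le_of_integrable {E F : Type*} [MeasurableSpace E] [NormedAddCommGroup F]
    {μ : Measure E} {u : E → F} {t : ℝ} (hu : Integrable u μ) (ht : 0 < t) :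
    μ {x | t < ‖u x‖} ≤ ENNReal.ofReal ((∫ x, ‖u x‖ ∂μ) / t) := by
  rw [ENNReal.ofReal_div_of_pos ht, ENNReal.le_div_iff_mul_le (by simp [ht]) (by simp), mul_comm,
    ofReal_integral_norm_eq_lintegral_enorm hu]
  refine le_trans ?_ (mul_meas_ge_le_lintegral₀ hu.1.enorm (ENNReal.ofReal t))
  refine mul_le_mul' le_rfl (measure_mono fun x (h : t < ‖u x‖) => ?_)
  change ENNReal.ofReal t ≤ ‖u x‖ₑ
  rw [← ofReal_norm]
  exact ENNReal.ofReal_le_ofReal h.le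

theorem volume_lt_norm_le_of_memLp_two {E F : Type*} [MeasurableSpace E] [NormedAddCommGroup F]
    {μ : Measure E} {u : E → F} {t : ℝ} (hu : MemLp u 2 μ) (ht : 0 < t) :
    μ {x | t < ‖u x‖} ≤ ENNReal.ofReal ((∫ x, ‖u x‖ ^ 2 ∂μ) / t ^ 2) := by
  have h := volume_lt_norm_le_of_integrable (hu.integrable_norm_pow two_ne_zero) (pow_pos ht 2)
  simp only [norm_pow, norm_norm] at h
  refine le_trans (measure_mono fun x hx => ?_) h
  exact pow_lt_pow_left₀ hx ht.le two_ne_zero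

theorem eLpNorm_two_eq_sqrt {E F : Type*} [MeasurableSpace E] [NormedAddCommGroup F]
    {μ : Measure E} {u : E → F} (hu : MemLp u 2 μ) :
    eLpNorm u 2 μ = ENNReal.ofReal (√(∫ x, ‖u x‖ ^ 2 ∂μ)) := by
  rw [hu.eLpNorm_eq_integral_rpow_norm two_ne_zero ofNat_ne_top, Real.sqrt_eq_rpow]
  norm_num

theorem integral_norm_sq_le_of_eLpNorm_le {E F : Type*} [MeasurableSpace E] [NormedAddCommGroup F]
    {μ : Measure E} {u v : E → F} {K : ℝ} (hu : AEStronglyMeasurable u μ) (hv : MemLp v 2 μ)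
    (hK : 0 ≤ K) (h : eLpNorm u 2 μ ≤ ENNReal.ofReal K * eLpNorm v 2 μ) :
    MemLp u 2 μ ∧ ∫ x, ‖u x‖ ^ 2 ∂μ ≤ K ^ 2 * ∫ x, ‖v x‖ ^ 2 ∂μ := by
  have hmu : MemLp u 2 μ :=
    ⟨hu, h.trans_lt (ENNReal.mul_lt_top ENNReal.ofReal_lt_top hv.2)⟩
  refine ⟨hmu, ?_⟩
  have hnn : ∀ w : E → F, 0 ≤ ∫ x, ‖w x‖ ^ 2 ∂μ := fun w => integral_nonneg fun _ => by positivity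
  rw [eLpNorm_two_eq_sqrt hmu, eLpNorm_two_eq_sqrt hv, ← ENNReal.ofReal_mul hK,
    ENNReal.ofReal_le_ofReal_iff (by positivity)] at h
  calc ∫ x, ‖u x‖ ^ 2 ∂μ = √(∫ x, ‖u x‖ ^ 2 ∂μ) ^ 2 := (Real.sq_sqrt (hnn u)).symm
    _ ≤ (K * √(∫ x, ‖v x‖ ^ 2 ∂μ)) ^ 2 := by gcongr
    _ = _ := by rw [mul_pow, Real.sq_sqrt (hnn v)]

variable {d : ℕ}

theorem measure_iUnion_norm_le {μ : Measure (EuclideanSpace ℝ (Fin d))}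
    {P : Set (EuclideanSpace ℝ (Fin d))} {c : ℝ≥0∞}
    (h : ∀ ρ : ℕ, μ {x | x ∈ P ∧ ‖x‖ ≤ ρ} ≤ c) : μ P ≤ c := by
  have h1 : P = ⋃ ρ : ℕ, {x | x ∈ P ∧ ‖x‖ ≤ ρ} := by
    ext x
    simp only [Set.mem_iUnion, Set.mem_ofPred_eq]
    refine ⟨fun hx => ?_, fun ⟨_, hx, _⟩ => hx⟩
    obtain ⟨ρ, hρ⟩ := exists_nat_ge ‖x‖
    exact ⟨ρ, hx, hρ⟩
  have h2 : Monotone fun ρ : ℕ => {x | x ∈ P ∧ ‖x‖ ≤ ρ} := fun ρ ρ' hρ x hx =>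
    ⟨hx.1, hx.2.trans (by exact_mod_cast hρ)⟩
  rw [h1, h2.measure_iUnion]
  exact iSup_le h

theorem truncatedCommutator_eventually_eq [Nontrivial (EuclideanSpace ℝ (Fin d))] {ι : Type}
    [Fintype ι] {ω A : EuclideanSpace ℝ (Fin d) → ℝ} {L : NNReal} {r : ι → ℝ}
    {y : ι → EuclideanSpace ℝ (Fin d)} {b : ι → EuclideanSpace ℝ (Fin d) → ℂ}
    (hω : IsIntegrableSymbol ω) (hA : LipschitzWith L A)
    (hb : ∀ i, Continuous (b i)) (hs : ∀ i, HasCompactSupport (b i)) (hr : ∀ i, 0 < r i)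
    (hbr : ∀ i z, b i z ≠ 0 → ‖z - y i‖ ≤ r i) {S : ℕ} {x : EuclideanSpace ℝ (Fin d)}
    (hx : ∀ i, 2 * r i < ‖x - y i‖) (hxS : ∀ i, ‖x - y i‖ + r i ≤ 2 ^ S * r i) :
    ∀ᶠ ε in 𝓝[>] (0 : ℝ),
      truncatedCommutator ω A (fun z => ∑ i, b i z) ε x = scaleSum ω A r b S x := by
  have h1 : ∀ᶠ ε in 𝓝[>] (0 : ℝ), ∀ i, ε < r i := by
    rw [eventually_all]
    exact fun i => mem_nhdsWithin_of_mem_nhds (Iio_mem_nhds (hr i))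
  filter_upwards [h1, self_mem_nhdsWithin] with ε hε hε0
  rw [truncatedCommutator_sum hω hA hb hs hε0, scaleSum, Finset.sum_comm]
  exact Finset.sum_congr rfl fun i _ => truncatedCommutator_eq_sum_kernelOp hω hA (hb i) (hs i)
    (hr i) (hbr i) (hx i) (hxS i) (hε i)

theorem exists_two_pow_mul_ge {ι : Type} [Fintype ι] {r c : ι → ℝ} (hr : ∀ i, 0 < r i) :
    ∃ S : ℕ, ∀ i, c i ≤ 2 ^ S * r i := by
  have h : ∀ᶠ S : ℕ in atTop, ∀ i, c i ≤ 2 ^ S * r i := by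
    rw [eventually_all]
    exact fun i => ((tendsto_pow_atTop_atTop_of_one_lt (one_lt_two (α := ℝ))).atTop_mul_const
      (hr i)).eventually_ge_atTop _
  exact h.exists

theorem exists_weak_bound_bad_part (d : ℕ) [Nontrivial (EuclideanSpace ℝ (Fin d))] :
    ∃ C : ℝ, 0 ≤ C ∧ ∀ {ι : Type} [Fintype ι] {α lam : ℝ} {r : ι → ℝ}
      {y : ι → EuclideanSpace ℝ (Fin d)} {Q : ι → Set (EuclideanSpace ℝ (Fin d))}
      {b : ι → EuclideanSpace ℝ (Fin d) → ℂ} {L : NNReal} {ω A : EuclideanSpace ℝ (Fin d) → ℝ}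
      {u : EuclideanSpace ℝ (Fin d) → ℂ},
      0 ≤ α → 0 < lam → IsAtomFamily α 1 r y Q b → (∀ i, Continuous (b i)) →
      (∀ i, HasCompactSupport (b i)) → IsIntegrableSymbol ω →
      Integrable (fun θ : sphere (0 : EuclideanSpace ℝ (Fin d)) 1 =>
        |ω θ| * (1 + max (Real.log (|ω θ| / sphereNorm ω)) 0))
        (volume : Measure (EuclideanSpace ℝ (Fin d))).toSphere →
      0 < sphereNorm ω → LipschitzWith L A →
      (∀ᵐ x, Tendsto (fun ε => truncatedCommutator ω A (fun z => ∑ i, b i z) ε x)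
        (𝓝[>] 0) (𝓝 (u x))) →
      volume {x | lam < ‖u x‖ ∧ ∀ i, 2 * r i < ‖x - y i‖} ≤
        ENNReal.ofReal (C * ((sphereLogNorm ω * L) / lam +
          (sphereLogNorm ω * L) ^ 2 * α / lam ^ 2) * ∑ i, ∫ x, ‖b i x‖) := by
  obtain ⟨C, hC, hsplit⟩ := exists_multiscale_split (EuclideanSpace ℝ (Fin d))
  refine ⟨4 * C, by positivity, ?_⟩
  intro ι _ α lam r y Q b L ω A u hα hlam hfam hb hs hω hlog hN hA hu
  have hM : ∃ M, ∀ i x, ‖b i x‖ ≤ M := by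
    choose M hM using fun i => (hs i).exists_bound_of_continuous (hb i)
    exact ⟨∑ i, M i, fun i x => (hM i x).trans (Finset.single_le_sum
      (fun j _ => (norm_nonneg _).trans (hM j 0)) (Finset.mem_univ i))⟩
  obtain ⟨M, hM⟩ := hM
  refine measure_iUnion_norm_le fun ρ => ?_
  obtain ⟨S, hS⟩ := exists_two_pow_mul_ge (c := fun i => ρ + ‖y i‖ + r i) hfam.R_pos
  obtain ⟨u₁, u₂, hsum, hi₁, hn₁, hi₂, hn₂⟩ := hsplit hα hfam hM hω hlog hN hA S
  have hlam2 : 0 < lam / 2 := half_pos hlam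
  set H := sphereLogNorm ω
  set B := ∑ i, ∫ x, ‖b i x‖
  have hB : 0 ≤ B := Finset.sum_nonneg fun _ _ => integral_nonneg fun _ => norm_nonneg _
  have hH : 0 ≤ H := hN.le.trans (sphereNorm_le_sphereLogNorm hω hlog)
  have hsub : {x | x ∈ {x | lam < ‖u x‖ ∧ ∀ i, 2 * r i < ‖x - y i‖} ∧ ‖x‖ ≤ ρ} ≤ᵐ[volume]
      ({x | lam / 2 < ‖u₁ x‖} ∪ {x | lam / 2 < ‖u₂ x‖} : Set _) := by
    filter_upwards [hu] with x hx hxm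
    obtain ⟨⟨h1, h2⟩, h3⟩ := hxm
    have h4 := truncatedCommutator_eventually_eq hω hA hb hs hfam.R_pos
      (fun i z hz => by simpa using hfam.norm_sub_le i z hz) h2
      (fun i => le_trans (by linarith [norm_sub_le x (y i)]) (hS i))
    have h5 : u x = u₁ x + u₂ x := by
      rw [← hsum x]
      exact tendsto_nhds_unique hx (tendsto_const_nhds.congr' (h4.mono fun _ h => h.symm))
    by_contra hcon
    rw [show ({x | lam / 2 < ‖u₁ x‖} ∪ {x | lam / 2 < ‖u₂ x‖} : Set _) x ↔
      lam / 2 < ‖u₁ x‖ ∨ lam / 2 < ‖u₂ x‖ from Iff.rfl] at hcon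
    push Not at hcon
    have h6 := norm_add_le (u₁ x) (u₂ x)
    rw [← h5] at h6
    linarith [hcon.1, hcon.2]
  calc volume _ ≤ volume ({x | lam / 2 < ‖u₁ x‖} ∪ {x | lam / 2 < ‖u₂ x‖} : Set _) :=
        measure_mono_ae hsub
    _ ≤ volume {x | lam / 2 < ‖u₁ x‖} + volume {x | lam / 2 < ‖u₂ x‖} := measure_union_le _ _
    _ ≤ ENNReal.ofReal ((∫ x, ‖u₁ x‖) / (lam / 2)) +
        ENNReal.ofReal ((∫ x, ‖u₂ x‖ ^ 2) / (lam / 2) ^ 2) :=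
      add_le_add (volume_lt_norm_le_of_integrable hi₁ hlam2)
        (volume_lt_norm_le_of_memLp_two hi₂ hlam2)
    _ = ENNReal.ofReal ((∫ x, ‖u₁ x‖) / (lam / 2) + (∫ x, ‖u₂ x‖ ^ 2) / (lam / 2) ^ 2) :=
      (ENNReal.ofReal_add (by positivity)
        (div_nonneg (integral_nonneg fun _ => by positivity) (by positivity))).symm
    _ ≤ _ := by
      refine ENNReal.ofReal_le_ofReal ?_
      calc (∫ x, ‖u₁ x‖) / (lam / 2) + (∫ x, ‖u₂ x‖ ^ 2) / (lam / 2) ^ 2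
          ≤ (C * (H * L) * B) / (lam / 2) + (C * (H * L) ^ 2 * α * B) / (lam / 2) ^ 2 := by
            gcongr
        _ = 2 * (C * (H * L / lam) * B) + 4 * (C * ((H * L) ^ 2 * α / lam ^ 2) * B) := by
            field_simp; ring
        _ ≤ _ := by
            have : 0 ≤ C * (H * L / lam) * B := by positivity
            linarith

end WeakType

section Assembly

variable {d : ℕ} {ω A : EuclideanSpace ℝ (Fin d) → ℝ} {L : NNReal}

theorem integrable_abs_of_integrable_mul_log {X : Type*} [MeasurableSpace X] {μ : Measure X}
    {h : X → ℝ} (hm : Measurable h) (hi : Integrable (fun θ => |h θ| * Real.log (2 + |h θ|)) μ) :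
    Integrable (fun θ => |h θ|) μ := by
  refine (hi.const_mul (Real.log 2)⁻¹).mono' hm.abs.aestronglyMeasurable (ae_of_all _ fun θ => ?_)
  have h2 : 0 < Real.log 2 := Real.log_pos one_lt_two
  rw [Real.norm_eq_abs, abs_abs, ← mul_assoc, mul_comm _ |h θ|, mul_assoc]
  refine le_mul_of_one_le_right (abs_nonneg _) ?_
  rw [inv_mul_eq_div, one_le_div h2]
  exact Real.log_le_log two_pos (by linarith [abs_nonneg (h θ)])

theorem integrable_mul_one_add_posLog_div {X : Type*} [MeasurableSpace X] {μ : Measure X}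
    {h : X → ℝ} (hm : Measurable h) (hi : Integrable (fun θ => |h θ| * Real.log (2 + |h θ|)) μ)
    {N : ℝ} (hN : 0 < N) :
    Integrable (fun θ => |h θ| * (1 + max (Real.log (|h θ| / N)) 0)) μ := by
  refine (((integrable_abs_of_integrable_mul_log hm hi).mul_const (1 + |Real.log N|)).add hi).mono'
    (Measurable.aestronglyMeasurable (by fun_prop)) (ae_of_all _ fun θ => ?_)
  rw [Real.norm_eq_abs, abs_of_nonneg (by positivity), Pi.add_apply, ← mul_add]
  refine mul_le_mul_of_nonneg_left ?_ (abs_nonneg _)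
  have h0 : 0 ≤ Real.log (2 + |h θ|) := Real.log_nonneg (by linarith [abs_nonneg (h θ)])
  have h1 : max (Real.log (|h θ| / N)) 0 ≤ |Real.log N| + Real.log (2 + |h θ|) := by
    refine max_le ?_ (by positivity)
    rcases (abs_nonneg (h θ)).eq_or_lt with h2 | h2
    · rw [← h2, zero_div, Real.log_zero]
      positivity
    · rw [Real.log_div h2.ne' hN.ne']
      have h3 := Real.log_le_log h2 (show |h θ| ≤ 2 + |h θ| by linarith)
      linarith [neg_abs_le (Real.log N)]
  linarith

theorem sphLlogL_nonneg (d : ℕ) (ω : EuclideanSpace ℝ (Fin d) → ℝ) : 0 ≤ sphLlogL d ω :=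
  integral_nonneg fun θ => mul_nonneg (abs_nonneg _)
    (Real.log_nonneg (by linarith [abs_nonneg (ω θ)]))

theorem COmega_eq (d : ℕ) (ω : EuclideanSpace ℝ (Fin d) → ℝ) :
    COmega d ω = sphLlogL d ω + sphereLogNorm ω := rfl

theorem sphLlogL_eq_zero_of_sphereNorm_eq_zero (hω : IsIntegrableSymbol ω)
    (h0 : sphereNorm ω = 0) : sphLlogL d ω = 0 := by
  have h1 := (integral_eq_zero_iff_of_nonneg (fun _ => abs_nonneg _) hω.integrable).1 h0
  refine integral_eq_zero_of_ae ?_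
  filter_upwards [h1] with θ hθ
  simp only [Pi.zero_apply] at hθ ⊢
  rw [hθ, zero_mul]

theorem sphereLogNorm_nonneg (ω : EuclideanSpace ℝ (Fin d) → ℝ) : 0 ≤ sphereLogNorm ω :=
  integral_nonneg fun θ => by positivity

theorem volume_iUnion_closedBall_le {ι : Type} [Fintype ι] {r c : ι → ℝ} (hr : ∀ i, 0 < r i)
    (y : ι → EuclideanSpace ℝ (Fin d)) {G : ℝ} (hc : ∀ i, r i ^ d = G * c i) :
    volume (⋃ i, closedBall (y i) (2 * r i)) ≤ ENNReal.ofReal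
      (2 ^ d * G * volume.real (ball (0 : EuclideanSpace ℝ (Fin d)) 1) * ∑ i, c i) := by
  have hv : ∀ i, volume (closedBall (y i) (2 * r i)) = ENNReal.ofReal ((2 * r i) ^ d *
      volume.real (ball (0 : EuclideanSpace ℝ (Fin d)) 1)) := fun i => by
    have := hr i
    rw [Measure.addHaar_closedBall _ _ (by positivity), finrank_euclideanSpace_fin,
      ENNReal.ofReal_mul (by positivity), ofReal_measureReal measure_ball_lt_top.ne]
  refine (measure_iUnion_fintype_le _ _).trans ?_
  simp only [hv]
  rw [← ENNReal.ofReal_sum_of_nonneg fun i _ => by have := hr i; positivity, Finset.mul_sum]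
  refine ENNReal.ofReal_le_ofReal (Finset.sum_le_sum fun i _ => le_of_eq ?_)
  rw [mul_pow, hc]
  ring

theorem integral_norm_sq_le_of_norm_le {X : Type*} [MeasurableSpace X] {μ : Measure X}
    {u : X → ℂ} {K : ℝ} (hu : Integrable u μ) (h : ∀ x, ‖u x‖ ≤ K) :
    ∫ x, ‖u x‖ ^ 2 ∂μ ≤ K * ∫ x, ‖u x‖ ∂μ := by
  rw [← integral_const_mul]
  refine integral_mono_of_nonneg (ae_of_all _ fun x => by positivity) (hu.norm.const_mul K)
    (ae_of_all _ fun x => ?_)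
  change ‖u x‖ ^ 2 ≤ K * ‖u x‖
  rw [sq]
  exact mul_le_mul_of_nonneg_right (h x) (norm_nonneg _)

/-- The limit of the truncated commutators, assumed to exist almost everywhere. -/
def IsPrincipalValue (ω A : EuclideanSpace ℝ (Fin d) → ℝ)
    (f u : EuclideanSpace ℝ (Fin d) → ℂ) : Prop :=
  ∀ᵐ x, Tendsto (fun ε => truncatedCommutator ω A f ε x) (𝓝[>] 0) (𝓝 (u x))

theorem IsPrincipalValue.aestronglyMeasurable {f u : EuclideanSpace ℝ (Fin d) → ℂ}
    (h : IsPrincipalValue ω A f u) (hω : Measurable ω) (hA : LipschitzWith L A)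
    (hf : Continuous f) : AEStronglyMeasurable u :=
  aestronglyMeasurable_of_tendsto_ae (𝓝[>] (0 : ℝ))
    (fun ε => (stronglyMeasurable_truncatedCommutator hω hA hf ε).aestronglyMeasurable) h

theorem IsPrincipalValue.ae_eq_add [Nontrivial (EuclideanSpace ℝ (Fin d))]
    {f g u v w : EuclideanSpace ℝ (Fin d) → ℂ} (hω : IsIntegrableSymbol ω) (hA : LipschitzWith L A)
    (hf : Continuous f) (hfs : HasCompactSupport f) (hg : Continuous g)
    (hgs : HasCompactSupport g) (hu : IsPrincipalValue ω A f u) (hv : IsPrincipalValue ω A g v)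
    (hw : IsPrincipalValue ω A (fun x => f x + g x) w) : ∀ᵐ x, w x = u x + v x := by
  filter_upwards [hu, hv, hw] with x hux hvx hwx
  refine tendsto_nhds_unique hwx ((hux.add hvx).congr' ?_)
  filter_upwards [self_mem_nhdsWithin] with ε hε
  exact (truncatedCommutator_add hω hA hf hfs hg hgs hε x).symm

theorem exists_weak_bound (d : ℕ) [Nontrivial (EuclideanSpace ℝ (Fin d))] {A₀ : ℝ} (hA₀ : 0 < A₀) :
    ∃ C : ℝ, 0 < C ∧ ∀ {ω A : EuclideanSpace ℝ (Fin d) → ℝ} {L : NNReal}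
      {T : (EuclideanSpace ℝ (Fin d) → ℂ) → EuclideanSpace ℝ (Fin d) → ℂ},
      IsIntegrableSymbol ω →
      Integrable (fun θ : sphere (0 : EuclideanSpace ℝ (Fin d)) 1 =>
        |ω θ| * (1 + max (Real.log (|ω θ| / sphereNorm ω)) 0))
        (volume : Measure (EuclideanSpace ℝ (Fin d))).toSphere →
      0 < sphereNorm ω → 0 < L → LipschitzWith L A →
      (∀ f, ContDiff ℝ (⊤ : ℕ∞) f → HasCompactSupport f → IsPrincipalValue ω A f (T f)) →
      (∀ f, ContDiff ℝ (⊤ : ℕ∞) f → HasCompactSupport f → eLpNorm (T f) 2 volume ≤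
        ENNReal.ofReal (A₀ * L * sphLlogL d ω) * eLpNorm f 2 volume) →
      ∀ lam : ℝ, 0 < lam → ∀ f : EuclideanSpace ℝ (Fin d) → ℂ,
        ContDiff ℝ (⊤ : ℕ∞) f → HasCompactSupport f →
        volume {x | lam < ‖T f x‖} ≤
          ENNReal.ofReal (C * lam⁻¹ * COmega d ω * L * ∫ x, ‖f x‖) := by
  obtain ⟨C₁, hC₁, hbad⟩ := exists_weak_bound_bad_part d
  set V := volume.real (ball (0 : EuclideanSpace ℝ (Fin d)) 1)
  have hd : 0 < d := by
    rw [← finrank_euclideanSpace_fin (𝕜 := ℝ) (n := d)]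
    exact Module.finrank_pos
  refine ⟨12 * A₀ ^ 2 * 2 ^ (d + 2) + 2 ^ d * (2 * d) ^ d * V +
    (4 * C₁ + 8 * 2 ^ (d + 1) * C₁) , by positivity, ?_⟩
  intro ω A L T hω hlog hN hL hA hT hT2 lam hlam f hf hfs
  have hH : 0 < sphereLogNorm ω := hN.trans_le (sphereNorm_le_sphereLogNorm hω hlog)
  have hsL := sphLlogL_nonneg d ω
  set K := COmega d ω * L with hK
  have hL' : (0 : ℝ) < L := hL
  have hK0 : 0 < K := by rw [hK, COmega_eq]; positivity
  have hHK : sphereLogNorm ω * L ≤ K := by rw [hK, COmega_eq]; gcongr; linarith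
  have hsK : A₀ * L * sphLlogL d ω ≤ A₀ * K := by
    rw [hK, COmega_eq, mul_assoc, mul_comm (L : ℝ)]; gcongr; linarith
  have hα : 0 < lam / K := by positivity
  set F := ∫ x, ‖f x‖
  have hF : 0 ≤ F := integral_nonneg fun _ => norm_nonneg _
  obtain ⟨ι, _, r, y, Q, b, hfam, hbsm, hbF, hrQ, hQF, hgb⟩ :=
    exists_smooth_decomposition hd hα hf.continuous hfs
  set B := ∑ i, ∫ x, ‖b i x‖
  have hB : 0 ≤ B := Finset.sum_nonneg fun _ _ => integral_nonneg fun _ => norm_nonneg _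
  have hbs : ∀ i, HasCompactSupport (b i) := fun i =>
    HasCompactSupport.intro (isCompact_closedBall (y i) (r i)) fun x hx => by
      by_contra h
      exact hx (by simpa [dist_eq_norm] using hfam.norm_sub_le i x h)
  set β : EuclideanSpace ℝ (Fin d) → ℂ := fun x => ∑ i, b i x
  have hβ : ContDiff ℝ (⊤ : ℕ∞) β := ContDiff.sum fun i _ => hbsm i
  have hβs : HasCompactSupport β := by
    refine HasCompactSupport.intro (K := ⋃ i, tsupport (b i)) (isCompact_iUnion hbs) fun x hx => ?_
    refine Finset.sum_eq_zero fun i _ => image_eq_zero_of_notMem_tsupport fun h => hx ?_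
    exact Set.mem_iUnion.2 ⟨i, h⟩
  set g : EuclideanSpace ℝ (Fin d) → ℂ := fun x => f x - β x with hg_def
  have hg : ContDiff ℝ (⊤ : ℕ∞) g := hf.sub hβ
  have hgs : HasCompactSupport g := by
    have h := hfs.sub hβs
    exact h
  have hgi : Integrable g := hg.continuous.integrable_of_hasCompactSupport hgs
  have hfi : Integrable f := hf.continuous.integrable_of_hasCompactSupport hfs
  have hgF : ∫ x, ‖g x‖ ≤ 3 * F := by
    calc ∫ x, ‖g x‖ ≤ ∫ x, (‖f x‖ + ∑ i, ‖b i x‖) := by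
          refine integral_mono hgi.norm (hfi.norm.add
            (integrable_finsetSum _ fun i _ => (hfam.integrable i).norm)) fun x => ?_
          exact (norm_sub_le _ _).trans (by gcongr; exact norm_sum_le _ _)
      _ = F + B := by
          rw [integral_add hfi.norm (integrable_finsetSum _ fun i _ => (hfam.integrable i).norm),
            integral_finsetSum _ fun i _ => (hfam.integrable i).norm]
      _ ≤ 3 * F := by linarith
  have hg2 : ∫ x, ‖g x‖ ^ 2 ≤ 2 ^ (d + 2) * (lam / K) * (3 * F) :=
    (integral_norm_sq_le_of_norm_le hgi hgb).trans (by gcongr)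
  obtain ⟨hTg, hTg2⟩ := integral_norm_sq_le_of_eLpNorm_le
    ((hT g hg hgs).aestronglyMeasurable hω.measurable hA hg.continuous)
    (memLp_two_of_integrable_of_norm_le hgi hgb) (by positivity) (hT2 g hg hgs)
  have hlam2 : 0 < lam / 2 := half_pos hlam
  have hgood : volume {x | lam / 2 < ‖T g x‖} ≤
      ENNReal.ofReal (12 * A₀ ^ 2 * 2 ^ (d + 2) * (K / lam * F)) := by
    refine (volume_lt_norm_le_of_memLp_two hTg hlam2).trans (ENNReal.ofReal_le_ofReal ?_)
    calc (∫ x, ‖T g x‖ ^ 2) / (lam / 2) ^ 2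
        ≤ ((A₀ * K) ^ 2 * (2 ^ (d + 2) * (lam / K) * (3 * F))) / (lam / 2) ^ 2 := by
          gcongr
          refine hTg2.trans ?_
          gcongr
      _ = _ := by field_simp; ring
  have hexc : volume (⋃ i, closedBall (y i) (2 * r i)) ≤
      ENNReal.ofReal (2 ^ d * (2 * d) ^ d * V * (K / lam * F)) := by
    refine (volume_iUnion_closedBall_le hfam.R_pos y hrQ).trans (ENNReal.ofReal_le_ofReal ?_)
    gcongr
    rw [div_mul_eq_mul_div, le_div_iff₀ hlam]
    rw [div_mul_eq_mul_div, div_le_iff₀ hK0] at hQF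
    linarith
  have hoff := hbad (by positivity) hlam2 hfam (fun i => (hbsm i).continuous) hbs hω hlog hN hA
    (hT β hβ hβs)
  have hoff' : volume {x | lam / 2 < ‖T β x‖ ∧ ∀ i, 2 * r i < ‖x - y i‖} ≤
      ENNReal.ofReal ((4 * C₁ + 8 * 2 ^ (d + 1) * C₁) * (K / lam * F)) := by
    refine hoff.trans (ENNReal.ofReal_le_ofReal ?_)
    calc C₁ * (sphereLogNorm ω * L / (lam / 2) +
          (sphereLogNorm ω * L) ^ 2 * (2 ^ (d + 1) * (lam / K)) / (lam / 2) ^ 2) * B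
        ≤ C₁ * (K / (lam / 2) + K ^ 2 * (2 ^ (d + 1) * (lam / K)) / (lam / 2) ^ 2) * (2 * F) := by
          gcongr
      _ = _ := by field_simp; ring
  have hsplit : {x | lam < ‖T f x‖} ≤ᵐ[volume] (({x | lam / 2 < ‖T g x‖} ∪
      ⋃ i, closedBall (y i) (2 * r i)) ∪
      {x | lam / 2 < ‖T β x‖ ∧ ∀ i, 2 * r i < ‖x - y i‖} : Set _) := by
    have hfe : f = fun x => g x + β x := by
      ext x
      rw [hg_def, sub_add_cancel]
    have hsum := IsPrincipalValue.ae_eq_add hω hA hg.continuous hgs hβ.continuous hβs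
      (hT g hg hgs) (hT β hβ hβs) (w := T f) (by rw [← hfe]; exact hT f hf hfs)
    filter_upwards [hsum] with x hx hxm
    by_cases h1 : lam / 2 < ‖T g x‖
    · exact Or.inl (Or.inl h1)
    by_cases h2 : x ∈ ⋃ i, closedBall (y i) (2 * r i)
    · exact Or.inl (Or.inr h2)
    refine Or.inr ⟨?_, fun i => ?_⟩
    · have h3 : lam < ‖T f x‖ := hxm
      have h4 := norm_add_le (T g x) (T β x)
      rw [← hx] at h4
      linarith
    · by_contra h3
      refine h2 (Set.mem_iUnion.2 ⟨i, ?_⟩)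
      rw [mem_closedBall, dist_eq_norm]
      exact not_lt.1 h3
  have hKF : 0 ≤ K / lam * F := by positivity
  calc volume {x | lam < ‖T f x‖} ≤ _ := measure_mono_ae hsplit
    _ ≤ _ := (measure_union_le _ _).trans (add_le_add (measure_union_le _ _) le_rfl)
    _ ≤ _ := add_le_add (add_le_add hgood hexc) hoff'
    _ = _ := by
      rw [← ENNReal.ofReal_add (by positivity) (by positivity),
        ← ENNReal.ofReal_add (by positivity) (by positivity), hK]
      congr 1
      ring

theorem volume_lt_norm_eq_zero_of_eLpNorm_le {f u : EuclideanSpace ℝ (Fin d) → ℂ} {K lam : ℝ}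
    (hu : AEStronglyMeasurable u) (hK : K = 0) (hlam : 0 < lam)
    (h : eLpNorm u 2 volume ≤ ENNReal.ofReal K * eLpNorm f 2 volume) :
    volume {x | lam < ‖u x‖} = 0 := by
  rw [hK, ENNReal.ofReal_zero, zero_mul, nonpos_iff_eq_zero, eLpNorm_eq_zero_iff hu two_ne_zero]
    at h
  refine measure_mono_null ?_ (ae_iff.1 h)
  intro x hx h0
  have h1 : lam < ‖u x‖ := hx
  rw [show u x = 0 from h0, norm_zero] at h1
  exact h1.not_ge hlam.le

end Assembly

theorem calderon_commutator_weak11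
    (d : ℕ) (hd : 2 ≤ d) (A₀ : ℝ) (hA₀ : 0 < A₀) :
    ∃ C : ℝ, 0 < C ∧
      ∀ (Ω : EuclideanSpace ℝ (Fin d) → ℝ)
        (A : EuclideanSpace ℝ (Fin d) → ℝ) (L : NNReal)
        (T : (EuclideanSpace ℝ (Fin d) → ℂ) → EuclideanSpace ℝ (Fin d) → ℂ),
        -- Ω is measurable, homogeneous of degree zero, and in L log⁺ L(S^{d-1})
        Measurable Ω →
        (∀ r : ℝ, 0 < r → ∀ x : EuclideanSpace ℝ (Fin d), x ≠ 0 → Ω (r • x) = Ω x) →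
        Integrable (fun θ : sphere (0 : EuclideanSpace ℝ (Fin d)) 1 =>
          |Ω θ| * Real.log (2 + |Ω θ|)) (sphereMeasure d) →
        -- first order moment (cancellation) conditions: ∫ Ω(θ) θ^α dθ = 0, |α| = 1
        (∀ i : Fin d,
          ∫ θ : sphere (0 : EuclideanSpace ℝ (Fin d)) 1,
            Ω θ * (θ : EuclideanSpace ℝ (Fin d)) i ∂(sphereMeasure d) = 0) →
        -- A is Lipschitz with constant L = ‖∇A‖_∞
        LipschitzWith L A →
        -- T f is the a.e. principal value of the Calderón commutator, for f ∈ C_c^∞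
        (∀ f : EuclideanSpace ℝ (Fin d) → ℂ, ContDiff ℝ (⊤ : ℕ∞) f → HasCompactSupport f →
          ∀ᵐ x : EuclideanSpace ℝ (Fin d) ∂volume,
            Tendsto (fun ε : ℝ =>
                ∫ y in {y : EuclideanSpace ℝ (Fin d) | ε < ‖x - y‖},
                  ((Ω (x - y) / ‖x - y‖ ^ d * ((A x - A y) / ‖x - y‖) : ℝ) : ℂ) * f y)
              (𝓝[>] 0) (𝓝 (T f x))) →
        -- Calderón's L² bound (Theorem C)
        (∀ f : EuclideanSpace ℝ (Fin d) → ℂ, ContDiff ℝ (⊤ : ℕ∞) f → HasCompactSupport f →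
          eLpNorm (T f) 2 volume ≤
            ENNReal.ofReal (A₀ * (L : ℝ) * sphLlogL d Ω) * eLpNorm f 2 volume) →
        -- weak type (1,1) bound
        ∀ lam : ℝ, 0 < lam →
          ∀ f : EuclideanSpace ℝ (Fin d) → ℂ, ContDiff ℝ (⊤ : ℕ∞) f → HasCompactSupport f →
            volume {x : EuclideanSpace ℝ (Fin d) | lam < ‖T f x‖} ≤
              ENNReal.ofReal (C * lam⁻¹ * COmega d Ω * (L : ℝ)) * eLpNorm f 1 volume := by
  have : Nontrivial (EuclideanSpace ℝ (Fin d)) := by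
    refine Module.nontrivial_of_finrank_pos (R := ℝ) ?_
    rw [finrank_euclideanSpace_fin]
    omega
  obtain ⟨C, hC, hweak⟩ := exists_weak_bound d hA₀
  refine ⟨C, hC, fun Ω A L T hm hh hi _ hA hT hT2 lam hlam f hf hfs => ?_⟩
  have hm' : Measurable fun θ : sphere (0 : EuclideanSpace ℝ (Fin d)) 1 => Ω θ :=
    hm.comp measurable_subtype_coe
  have hω : IsIntegrableSymbol Ω := ⟨hm, hh, integrable_abs_of_integrable_mul_log hm' hi⟩
  have hTpv : ∀ f, ContDiff ℝ (⊤ : ℕ∞) f → HasCompactSupport f → IsPrincipalValue Ω A f (T f) := hT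
  have hzero : A₀ * (L : ℝ) * sphLlogL d Ω = 0 → volume {x | lam < ‖T f x‖} = 0 := fun h0 =>
    volume_lt_norm_eq_zero_of_eLpNorm_le
      ((hTpv f hf hfs).aestronglyMeasurable hm hA hf.continuous) h0 hlam (hT2 f hf hfs)
  rcases (sphereNorm_nonneg Ω).eq_or_lt with hN | hN
  · rw [hzero (by rw [sphLlogL_eq_zero_of_sphereNorm_eq_zero hω hN.symm, mul_zero])]
    exact zero_le
  rcases eq_or_ne L 0 with hL | hL
  · rw [hzero (by rw [hL, NNReal.coe_zero, mul_zero, zero_mul])]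
    exact zero_le
  refine (hweak hω (integrable_mul_one_add_posLog_div hm' hi hN) hN (pos_iff_ne_zero.2 hL) hA hTpv
    hT2 lam hlam f hf hfs).trans_eq ?_
  have hfi : Integrable f := hf.continuous.integrable_of_hasCompactSupport hfs
  have hH := sphereLogNorm_nonneg Ω
  have hS := sphLlogL_nonneg d Ω
  rw [eLpNorm_one_eq_lintegral_enorm, ← ofReal_integral_norm_eq_lintegral_enorm hfi,
    ← ENNReal.ofReal_mul (by rw [COmega_eq]; positivity)]

end
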